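/- Let D ⊂ ℂⁿ be a bounded convex domain with C∞-smooth boundary. If h_D(z) → 0 as z → ∂D, then ∂D is strongly pseudoconvex at every boundary point. -/

import Mathlib

open MeasureTheory Metric Filter Topology Set
open scoped ENNReal

noncomputable section

/-- Membership in the Bergman space `A²(Ω)`: holomorphic and square-integrable. -/
def MemA2 {n : ℕ} (Ω : Set (Fin n → ℂ)) (f : (Fin n → ℂ) → ℂ) : Prop :=
  DifferentiableOn ℂ f Ω ∧ MemLp f 2 (volume.restrict Ω)

/-- `K` is the Bergman kernel of `Ω`: the reproducing kernel of `A²(Ω)`. -/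
def IsBergmanKernel {n : ℕ} (Ω : Set (Fin n → ℂ)) (K : (Fin n → ℂ) → (Fin n → ℂ) → ℂ) : Prop :=
  (∀ w ∈ Ω, MemA2 Ω fun z => K z w) ∧
  ∀ f, MemA2 Ω f → ∀ w ∈ Ω, f w = ∫ z in Ω, f z * (starRingEnd ℂ) (K z w)

/-- Wirtinger derivative `∂f/∂z_μ`. -/
def wderiv {n : ℕ} (μ : Fin n) (f : (Fin n → ℂ) → ℂ) (z : Fin n → ℂ) : ℂ :=
  (fderiv ℝ f z (Pi.single μ 1) - Complex.I * fderiv ℝ f z (Pi.single μ Complex.I)) / 2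

/-- Wirtinger derivative `∂f/∂z̄_μ`. -/
def wderivBar {n : ℕ} (μ : Fin n) (f : (Fin n → ℂ) → ℂ) (z : Fin n → ℂ) : ℂ :=
  (fderiv ℝ f z (Pi.single μ 1) + Complex.I * fderiv ℝ f z (Pi.single μ Complex.I)) / 2

/-- One-variable Wirtinger derivative `∂f/∂z`. -/
def wderiv1 (f : ℂ → ℂ) (z : ℂ) : ℂ :=
  (fderiv ℝ f z 1 - Complex.I * fderiv ℝ f z Complex.I) / 2

/-- One-variable Wirtinger derivative `∂f/∂z̄`. -/
def wderiv1Bar (f : ℂ → ℂ) (z : ℂ) : ℂ :=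
  (fderiv ℝ f z 1 + Complex.I * fderiv ℝ f z Complex.I) / 2

/-- Bergman metric tensor `g_{μν}(z) = ∂² log K(z,z) / ∂z_μ ∂z̄_ν`. -/
def bergmanTensor {n : ℕ} (K : (Fin n → ℂ) → (Fin n → ℂ) → ℂ) (μ ν : Fin n)
    (z : Fin n → ℂ) : ℂ :=
  wderiv μ (fun w => wderivBar ν (fun u => Complex.log (K u u)) w) z

/-- The hermitian quadratic form of the Bergman metric. -/
def bergmanQuad {n : ℕ} (K : (Fin n → ℂ) → (Fin n → ℂ) → ℂ) (z ξ : Fin n → ℂ) : ℝ :=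
  (∑ μ, ∑ ν, bergmanTensor K μ ν z * ξ μ * (starRingEnd ℂ) (ξ ν)).re

/-- The Bergman metric `b_Ω(z,ξ)`. -/
def bergmanMetric {n : ℕ} (K : (Fin n → ℂ) → (Fin n → ℂ) → ℂ) (z ξ : Fin n → ℂ) : ℝ :=
  Real.sqrt (bergmanQuad K z ξ)

/-- Piecewise-`C¹` curves on `[0,1]`. -/
def PiecewiseC1 {n : ℕ} (γ : ℝ → (Fin n → ℂ)) : Prop :=
  ContinuousOn γ (Set.Icc 0 1) ∧
  ∃ (k : ℕ) (t : Fin (k + 1) → ℝ), StrictMono t ∧ t 0 = 0 ∧ t (Fin.last k) = 1 ∧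
    ∀ i : Fin k, ContDiffOn ℝ 1 γ (Set.Icc (t i.castSucc) (t i.succ))

/-- The Bergman length of a curve. -/
def bergmanLength {n : ℕ} (K : (Fin n → ℂ) → (Fin n → ℂ) → ℂ) (γ : ℝ → (Fin n → ℂ)) : ℝ :=
  ∫ t in (0:ℝ)..1, bergmanMetric K (γ t) (deriv γ t)

/-- The Bergman pseudodistance of `Ω`. -/
def bergmanDist {n : ℕ} (Ω : Set (Fin n → ℂ)) (K : (Fin n → ℂ) → (Fin n → ℂ) → ℂ)
    (z w : Fin n → ℂ) : ℝ :=
  sInf { L : ℝ | ∃ γ : ℝ → (Fin n → ℂ), γ 0 = z ∧ γ 1 = w ∧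
    (∀ t ∈ Set.Icc (0:ℝ) 1, γ t ∈ Ω) ∧ PiecewiseC1 γ ∧ L = bergmanLength K γ }

/-- The Bergman ball `B_Ω(p,r)`. -/
def bergmanBall {n : ℕ} (Ω : Set (Fin n → ℂ)) (K : (Fin n → ℂ) → (Fin n → ℂ) → ℂ)
    (p : Fin n → ℂ) (r : ℝ) : Set (Fin n → ℂ) :=
  { z ∈ Ω | bergmanDist Ω K p z < r }

/-- The Bergman pseudodistance is an honest distance. -/
def BergmanDistIsDistance {n : ℕ} (Ω : Set (Fin n → ℂ))
    (K : (Fin n → ℂ) → (Fin n → ℂ) → ℂ) : Prop :=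
  ∀ z ∈ Ω, ∀ w ∈ Ω, z ≠ w → 0 < bergmanDist Ω K z w

/-- `Ω` is complete with respect to the Bergman distance. -/
def BergmanComplete {n : ℕ} (Ω : Set (Fin n → ℂ))
    (K : (Fin n → ℂ) → (Fin n → ℂ) → ℂ) : Prop :=
  ∀ x : ℕ → (Fin n → ℂ), (∀ k, x k ∈ Ω) →
    (∀ ε : ℝ, 0 < ε → ∃ N, ∀ k ≥ N, ∀ l ≥ N, bergmanDist Ω K (x k) (x l) < ε) →
    ∃ p ∈ Ω, Filter.Tendsto (fun k => bergmanDist Ω K (x k) p) Filter.atTop (nhds 0)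

/-- The Euclidean unit ball `𝔹ⁿ ⊂ ℂⁿ`. -/
def euclUnitBall (n : ℕ) : Set (Fin n → ℂ) :=
  { z | ∑ μ, ‖z μ‖ ^ 2 < 1 }

/-- The Bergman–Fridman invariant `h_X(p)`. -/
def fridmanInv {n : ℕ} (Ω : Set (Fin n → ℂ)) (K : (Fin n → ℂ) → (Fin n → ℂ) → ℂ)
    (p : Fin n → ℂ) : ℝ :=
  sInf { c : ℝ | ∃ r : ℝ, 0 < r ∧ c = 1 / r ∧ ∃ f : (Fin n → ℂ) → (Fin n → ℂ),
    DifferentiableOn ℂ f (euclUnitBall n) ∧ Set.InjOn f (euclUnitBall n) ∧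
    f '' euclUnitBall n ⊆ Ω ∧ bergmanBall Ω K p r ⊆ f '' euclUnitBall n }

/-- Biholomorphic equivalence of domains in `ℂⁿ` (an injective holomorphic map of `ℂⁿ`
restricted to a domain is automatically a biholomorphism onto its image). -/
def Biholomorphic {n : ℕ} (U V : Set (Fin n → ℂ)) : Prop :=
  ∃ f : (Fin n → ℂ) → (Fin n → ℂ),
    DifferentiableOn ℂ f U ∧ Set.InjOn f U ∧ f '' U = V

/-- The Levi form of a real-valued function `ρ` at `p` in direction `ξ`. -/
def leviForm {n : ℕ} (ρ : (Fin n → ℂ) → ℝ) (p ξ : Fin n → ℂ) : ℝ :=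
  (∑ μ, ∑ ν, wderiv μ (fun w => wderivBar ν (fun u => (ρ u : ℂ)) w) p
      * ξ μ * (starRingEnd ℂ) (ξ ν)).re

/-- The complex tangent space of `{ρ = 0}` at `p`. -/
def complexTangent {n : ℕ} (ρ : (Fin n → ℂ) → ℝ) (p : Fin n → ℂ) : Set (Fin n → ℂ) :=
  { ξ | ∑ μ, wderiv μ (fun u => (ρ u : ℂ)) p * ξ μ = 0 }

/-- Strong pseudoconvexity at a boundary point, for defining function `ρ`. -/
def StronglyPseudoconvexAt {n : ℕ} (ρ : (Fin n → ℂ) → ℝ) (p : Fin n → ℂ) : Prop :=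
  ∀ ξ ∈ complexTangent ρ p, ξ ≠ 0 → 0 < leviForm ρ p ξ

/-- `ρ` is a (global) defining function for `D`. -/
def IsDefiningFunction {n : ℕ} (D : Set (Fin n → ℂ)) (ρ : (Fin n → ℂ) → ℝ) : Prop :=
  (∀ z, z ∈ D ↔ ρ z < 0) ∧ ∀ z ∈ frontier D, fderiv ℝ ρ z ≠ 0

/-- Plurisubharmonicity via the sub-mean-value property on complex lines. -/
def PlurisubharmonicOn {n : ℕ} (u : (Fin n → ℂ) → ℝ) (Ω : Set (Fin n → ℂ)) : Prop :=
  UpperSemicontinuousOn u Ω ∧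
  ∀ (a b : Fin n → ℂ) (r : ℝ), 0 < r →
    (∀ w : ℂ, ‖w‖ ≤ r → a + w • b ∈ Ω) →
    u a ≤ (1 / (2 * Real.pi)) *
      ∫ θ in (0:ℝ)..(2 * Real.pi), u (a + ((r : ℂ) * Complex.exp (θ * Complex.I)) • b)

/-- Pseudoconvexity: `-log dist(·, ∂D)` is plurisubharmonic on `D`. -/
def IsPseudoconvex {n : ℕ} (D : Set (Fin n → ℂ)) : Prop :=
  PlurisubharmonicOn (fun z => -Real.log (Metric.infDist z Dᶜ)) D

/-- Order of vanishing at `0` of a vector-valued map on `ℂ` (`⊤` if it vanishes to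
infinite order). -/
def vanishingOrderC {n : ℕ} (f : ℂ → (Fin n → ℂ)) : ℝ≥0∞ :=
  sInf ((fun m : ℕ => (m : ℝ≥0∞)) '' { m : ℕ | iteratedDeriv m f 0 ≠ 0 })

/-- Order of vanishing at `0` of a real-valued function on `ℂ`. -/
def vanishingOrderR (g : ℂ → ℝ) : ℝ≥0∞ :=
  sInf ((fun m : ℕ => (m : ℝ≥0∞)) '' { m : ℕ | iteratedFDeriv ℝ m g 0 ≠ 0 })

/-- The D'Angelo 1-type of `ρ` at `p`. -/
def dAngeloOneType {n : ℕ} (ρ : (Fin n → ℂ) → ℝ) (p : Fin n → ℂ) : ℝ≥0∞ :=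
  ⨆ (φ : ℂ → (Fin n → ℂ)) (_ : AnalyticAt ℂ φ 0) (_ : φ 0 = p)
    (_ : vanishingOrderC (fun w => φ w - p) ≠ ⊤),
    vanishingOrderR (fun w => ρ (φ w)) / vanishingOrderC (fun w => φ w - p)

/-- The Levi form at `p` has at most one degenerate eigenvalue. -/
def LeviCorankOneAt {n : ℕ} (ρ : (Fin n → ℂ) → ℝ) (p : Fin n → ℂ) : Prop :=
  ∃ V : Submodule ℂ (Fin n → ℂ), n - 2 ≤ Module.finrank ℂ V ∧
    (V : Set (Fin n → ℂ)) ⊆ complexTangent ρ p ∧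
    ∀ ξ ∈ V, ξ ≠ 0 → 0 < leviForm ρ p ξ

/-- A bounded smooth pseudoconvex finite-type Levi corank one domain, with defining
function `ρ`. -/
def IsLeviCorankOneDomain {n : ℕ} (D : Set (Fin n → ℂ)) (ρ : (Fin n → ℂ) → ℝ) : Prop :=
  IsOpen D ∧ IsConnected D ∧ Bornology.IsBounded D ∧ IsPseudoconvex D ∧
  ContDiff ℝ (⊤ : ℕ∞) ρ ∧ IsDefiningFunction D ρ ∧
  (∀ p ∈ frontier D, dAngeloOneType ρ p ≠ ⊤) ∧
  ∀ p ∈ frontier D, LeviCorankOneAt ρ p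

/-- The open unit disc in `ℂ`. -/
def openUnitDisc : Set ℂ := Metric.ball 0 1

/-- Tautness of a domain in `ℂⁿ`. -/
def IsTaut {n : ℕ} (D : Set (Fin n → ℂ)) : Prop :=
  ∀ f : ℕ → ℂ → (Fin n → ℂ),
    (∀ k, DifferentiableOn ℂ (f k) openUnitDisc ∧ f k '' openUnitDisc ⊆ D) →
    ∃ φ : ℕ → ℕ, StrictMono φ ∧
      ((∃ g : ℂ → (Fin n → ℂ), DifferentiableOn ℂ g openUnitDisc ∧ g '' openUnitDisc ⊆ D ∧
          TendstoLocallyUniformlyOn (fun k => f (φ k)) g Filter.atTop openUnitDisc) ∨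
        ∀ S : Set ℂ, IsCompact S → S ⊆ openUnitDisc →
          ∀ L : Set (Fin n → ℂ), IsCompact L → L ⊆ D →
            ∀ᶠ k in Filter.atTop, ∀ w ∈ S, f (φ k) w ∉ L)

/-- Convergence of a sequence of domains in the local Hausdorff sense. -/
def LocalHausdorffConv {n : ℕ} (Ω : ℕ → Set (Fin n → ℂ)) (Ωl : Set (Fin n → ℂ)) : Prop :=
  (∀ S : Set (Fin n → ℂ), IsCompact S → S ⊆ Ωl → ∀ᶠ j in Filter.atTop, S ⊆ Ω j) ∧
  ∀ S : Set (Fin n → ℂ), IsCompact S →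
    (∃ j₀ : ℕ, S ⊆ interior (⋂ j, ⋂ (_ : j₀ ≤ j), Ω j)) → S ⊆ Ωl

/-- A real-valued subharmonic polynomial of degree at most `d` in one complex variable,
containing no harmonic terms. -/
def SubharmonicPolyNoHarm (P : ℂ → ℝ) (d : ℕ) : Prop :=
  (∃ c : Fin (d + 1) → Fin (d + 1) → ℂ,
    (∀ j, c j 0 = 0) ∧ (∀ k, c 0 k = 0) ∧
    ∀ w : ℂ, (P w : ℂ) = ∑ j, ∑ k, c j k * w ^ (j : ℕ) * (starRingEnd ℂ) w ^ (k : ℕ)) ∧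
  ∀ w : ℂ, 0 ≤ (wderiv1 (fun u => wderiv1Bar (fun v => (P v : ℂ)) u) w).re

/-- A strictly subharmonic real polynomial of degree `2` in one complex variable. -/
def StrictlySubharmonicPolyDeg2 (Q : ℂ → ℝ) : Prop :=
  (∃ c : Fin 3 → Fin 3 → ℂ, ∀ w : ℂ,
      (Q w : ℂ) = ∑ j, ∑ k, c j k * w ^ (j : ℕ) * (starRingEnd ℂ) w ^ (k : ℕ)) ∧
  ∀ w : ℂ, 0 < (wderiv1 (fun u => wderiv1Bar (fun v => (Q v : ℂ)) u) w).re

/-- A nontangential cone in `D` with vertex `p0 ∈ ∂D`. -/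
def IsNontangentialCone {n : ℕ} (D Γ : Set (Fin n → ℂ)) (p0 : Fin n → ℂ) : Prop :=
  Γ ⊆ D ∧ p0 ∈ closure Γ ∧
  ∃ C : ℝ, 0 < C ∧ ∀ z ∈ Γ, ‖z - p0‖ ≤ C * Metric.infDist z Dᶜ

/-- The Bergman kernel is positive on the diagonal of `Ω`. -/
def DiagPos {n : ℕ} (Ω : Set (Fin n → ℂ)) (K : (Fin n → ℂ) → (Fin n → ℂ) → ℂ) : Prop :=
  ∀ z ∈ Ω, (K z z).im = 0 ∧ 0 < (K z z).re

/-- The Bergman metric of `Ω` is positive definite. -/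
def BergPosDef {n : ℕ} (Ω : Set (Fin n → ℂ)) (K : (Fin n → ℂ) → (Fin n → ℂ) → ℂ) : Prop :=
  ∀ z ∈ Ω, ∀ ξ : Fin n → ℂ, ξ ≠ 0 → 0 < bergmanMetric K z ξ

/-- The real coordinate directions of `ℂⁿ ≃ ℝ^{2n}`. -/
def realDir {n : ℕ} (μ : Fin (2 * n)) : Fin n → ℂ :=
  Pi.single ⟨(μ : ℕ) / 2, by have := μ.isLt; omega⟩
    (if (μ : ℕ) % 2 = 0 then 1 else Complex.I)

/-- The real coefficients `g̃_{μν}` of the Bergman metric, obtained by polarization. -/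
def realTensor {n : ℕ} (K : (Fin n → ℂ) → (Fin n → ℂ) → ℂ) (μ ν : Fin (2 * n))
    (z : Fin n → ℂ) : ℝ :=
  (bergmanQuad K z (realDir μ + realDir ν) - bergmanQuad K z (realDir μ)
    - bergmanQuad K z (realDir ν)) / 2

/-- The Christoffel symbols `Γ^η_{μν}` of the Bergman metric, in real coordinates. -/
def christoffel {n : ℕ} (K : (Fin n → ℂ) → (Fin n → ℂ) → ℂ) (η μ ν : Fin (2 * n))
    (z : Fin n → ℂ) : ℝ :=
  (1 / 2) * ∑ τ : Fin (2 * n),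
    (fderiv ℝ (realTensor K ν τ) z (realDir μ)
      + fderiv ℝ (realTensor K τ μ) z (realDir ν)
      - fderiv ℝ (realTensor K μ ν) z (realDir τ))
    * (Matrix.of fun a b => realTensor K a b z)⁻¹ τ η

/-- `z0 ∈ ∂D` is a local holomorphic peak point of `D`. -/
def IsLocalPeakPoint {n : ℕ} (D : Set (Fin n → ℂ)) (z0 : Fin n → ℂ) : Prop :=
  ∃ U ∈ nhds z0, ∃ g : (Fin n → ℂ) → ℂ,
    DifferentiableOn ℂ g (U ∩ D) ∧ ContinuousOn g (closure (U ∩ D)) ∧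
    g z0 = 1 ∧ ∀ z ∈ closure (U ∩ D), z ≠ z0 → ‖g z‖ < 1

/-- A real polynomial on `ℂⁿ` containing no pluriharmonic terms. -/
def IsPolyNoPluriharm {n : ℕ} (P : (Fin n → ℂ) → ℝ) : Prop :=
  ∃ (d : ℕ) (c : (Fin n → Fin (d + 1)) → (Fin n → Fin (d + 1)) → ℂ),
    (∀ α β, (∀ j, (β j : ℕ) = 0) → c α β = 0) ∧
    (∀ α β, (∀ j, (α j : ℕ) = 0) → c α β = 0) ∧
    ∀ z, (P z : ℂ) = ∑ α, ∑ β, c α β * (∏ j, z j ^ (α j : ℕ)) *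
      ∏ j, (starRingEnd ℂ) (z j) ^ (β j : ℕ)


section Holomorphy

variable {E F G : Type*} [NormedAddCommGroup E] [NormedSpace ℂ E]
  [NormedAddCommGroup F] [NormedSpace ℂ F] [NormedAddCommGroup G] [NormedSpace ℂ G]

/-- Cauchy estimate for the derivative at the centre of a ball. -/
theorem norm_fderiv_le_of_bounded_on_ball {f : E → F} {c : E} {R M : ℝ} (hR : 0 < R)
    (hd : DifferentiableOn ℂ f (ball c R)) (hb : ∀ x ∈ ball c R, ‖f x‖ ≤ M) :
    ‖fderiv ℂ f c‖ ≤ 2 * M / R := by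
  refine Complex.norm_fderiv_le_div_of_mapsTo_ball hd (fun x hx => ?_) hR
  rw [mem_closedBall, dist_eq_norm]
  have h1 := hb x hx
  have h2 := hb c (mem_ball_self hR)
  linarith [norm_sub_le (f x) (f c)]

theorem norm_fderiv_le_of_bounded_on_ball' {f : E → F} {c x : E} {R r M : ℝ} (hR : r < R)
    (hx : x ∈ ball c r)
    (hd : DifferentiableOn ℂ f (ball c R)) (hb : ∀ x ∈ ball c R, ‖f x‖ ≤ M) :
    ‖fderiv ℂ f x‖ ≤ 2 * M / (R - r) := by
  have hs : ball x (R - r) ⊆ ball c R := by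
    apply ball_subset_ball'
    rw [mem_ball] at hx; linarith
  exact norm_fderiv_le_of_bounded_on_ball (by linarith) (hd.mono hs) fun y hy => hb y (hs hy)

theorem norm_fderiv_sub_fderiv_le {f : E → F} {c k : E} {R M : ℝ} (hR : 0 < R)
    (hk : ‖k‖ < R / 4)
    (hd : DifferentiableOn ℂ f (ball c R)) (hb : ∀ x ∈ ball c R, ‖f x‖ ≤ M) :
    ‖fderiv ℂ f (c + k) - fderiv ℂ f c‖ ≤ 32 * M / R ^ 2 * ‖k‖ := by
  have hlip : ∀ x ∈ ball c (R / 2), ∀ y ∈ ball c (R / 2), ‖f y - f x‖ ≤ 4 * M / R * ‖y - x‖ := by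
    intro x hx y hy
    refine (convex_ball c (R / 2)).norm_image_sub_le_of_norm_fderiv_le (𝕜 := ℂ)
      (fun z hz => ?_) (fun z hz => ?_) hx hy
    · exact hd.differentiableAt (isOpen_ball.mem_nhds (ball_subset_ball (by linarith) hz))
    · refine (norm_fderiv_le_of_bounded_on_ball' (by linarith : R / 2 < R) hz hd hb).trans
        (le_of_eq ?_)
      field_simp; ring
  have hmem : ∀ x ∈ ball c (R / 4), x + k ∈ ball c (R / 2) := by
    intro x hx
    rw [mem_ball, dist_eq_norm] at hx ⊢
    calc ‖x + k - c‖ = ‖(x - c) + k‖ := by congr 1; abel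
      _ ≤ ‖x - c‖ + ‖k‖ := norm_add_le _ _
      _ < R / 2 := by linarith
  have hdiff : ∀ x ∈ ball c (R / 2), DifferentiableAt ℂ f x := fun z hz =>
    hd.differentiableAt (isOpen_ball.mem_nhds (ball_subset_ball (by linarith) hz))
  have hdc : ∀ x ∈ ball c (R / 4), DifferentiableAt ℂ (fun y => f (y + k)) x := by
    intro x hx
    exact (hdiff _ (hmem x hx)).comp x (differentiableAt_id.add_const k)
  have hc : c ∈ ball c (R / 4) := mem_ball_self (by linarith)
  have hc2 : ball c (R / 4) ⊆ ball c (R / 2) := ball_subset_ball (by linarith)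
  have key := norm_fderiv_le_of_bounded_on_ball (f := fun y => f (y + k) - f y) (c := c)
    (M := 4 * M / R * ‖k‖) (by linarith : 0 < R / 4)
    (fun x hx => ((hdc x hx).sub (hdiff x (hc2 hx))).differentiableWithinAt)
    (fun x hx => by
      have := hlip x (hc2 hx) (x + k) (hmem x hx)
      simpa using this)
  rw [fderiv_fun_sub (hdc c hc) (hdiff c (hc2 hc)), fderiv_comp_add_right] at key
  refine key.trans (le_of_eq ?_)
  field_simp; ring

/-- Second order Taylor estimate. -/
theorem norm_sub_sub_fderiv_le {f : E → F} {c h : E} {R M : ℝ} (hR : 0 < R)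
    (hh : ‖h‖ < R / 4)
    (hd : DifferentiableOn ℂ f (ball c R)) (hb : ∀ x ∈ ball c R, ‖f x‖ ≤ M) :
    ‖f (c + h) - f c - fderiv ℂ f c h‖ ≤ 32 * M / R ^ 2 * ‖h‖ ^ 2 := by
  have hM : 0 ≤ M := (norm_nonneg _).trans (hb c (mem_ball_self hR))
  have := (convex_closedBall c ‖h‖).norm_image_sub_le_of_norm_fderiv_le' (𝕜 := ℂ) (f := f)
    (φ := fderiv ℂ f c) (C := 32 * M / R ^ 2 * ‖h‖) (x := c) (y := c + h)
    (fun z hz => hd.differentiableAt (isOpen_ball.mem_nhds (by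
      rw [mem_closedBall] at hz; rw [mem_ball]; linarith)))
    (fun z hz => by
      rw [mem_closedBall, dist_eq_norm] at hz
      have := norm_fderiv_sub_fderiv_le hR (k := z - c) (by linarith) hd hb
      rw [add_sub_cancel] at this
      exact this.trans (by gcongr))
    (by simp) (by simp)
  rw [add_sub_cancel_left] at this
  refine this.trans (le_of_eq ?_)
  ring

theorem exists_ball_bounded {E F : Type*} [NormedAddCommGroup E] [NormedAddCommGroup F] {U : Set E}
    (hU : IsOpen U) {f : E → F} (hf : ContinuousOn f U)
    {c : E} (hc : c ∈ U) :
    ∃ R > 0, ball c R ⊆ U ∧ ∃ M, 0 ≤ M ∧ ∀ x ∈ ball c R, ‖f x‖ ≤ M := by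
  have h1 : ContinuousAt f c := hf.continuousAt (hU.mem_nhds hc)
  have h2 : ∀ᶠ x in 𝓝 c, ‖f x‖ < ‖f c‖ + 1 := h1.norm.eventually (gt_mem_nhds (by simp))
  obtain ⟨R, hR, h⟩ := Metric.eventually_nhds_iff_ball.1 (h2.and (hU.mem_nhds hc))
  exact ⟨R, hR, fun x hx => (h x hx).2, ‖f c‖ + 1, by positivity, fun x hx => (h x hx).1.le⟩

/-- A uniform limit of holomorphic maps is holomorphic. -/
theorem differentiableOn_of_tendstoUniformlyOn_ball [CompleteSpace F] {ι : Type*} {l : Filter ι}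
    [l.NeBot] {f : ι → E → F} {g : E → F} {c : E} {R : ℝ}
    (hf : ∀ᶠ i in l, DifferentiableOn ℂ (f i) (ball c R))
    (hfg : TendstoUniformlyOn f g l (ball c R)) : DifferentiableOn ℂ g (ball c R) := by
  intro x hx
  set r := (R - dist x c) / 2 with hr
  have hxR : dist x c < R := hx
  have hr0 : 0 < r := by rw [hr]; linarith
  have hs : ball x (2 * r) ⊆ ball c R := ball_subset_ball' (by rw [hr]; linarith)
  have hs1 : ball x r ⊆ ball c R := (ball_subset_ball (by linarith)).trans hs
  have hcau : UniformCauchySeqOn (fun i y => fderiv ℂ (f i) y) l (ball x r) := by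
    intro u hu
    obtain ⟨ε, hε, hεu⟩ := Metric.mem_uniformity_dist.1 hu
    have h1 := hfg.uniformCauchySeqOn {p | dist p.1 p.2 < ε * r / 4}
      (Metric.dist_mem_uniformity (by positivity))
    filter_upwards [h1, hf.prod_mk hf] with m hm hm2 y hy
    apply hεu
    have hys : y ∈ ball x (2 * r) := ball_subset_ball (by linarith) hy
    have hsub : ball y r ⊆ ball c R :=
      (ball_subset_ball' (by rw [mem_ball] at hy; linarith)).trans hs
    have h2 := norm_fderiv_le_of_bounded_on_ball (f := fun z => f m.1 z - f m.2 z) hr0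
      ((hm2.1.sub hm2.2).mono hsub) (M := ε * r / 4) (fun z hz => by
        have : dist (f m.1 z) (f m.2 z) < ε * r / 4 := hm z (hsub hz)
        rw [dist_eq_norm] at this
        exact this.le)
    have hnb := isOpen_ball.mem_nhds (hs hys)
    rw [fderiv_fun_sub (hm2.1.differentiableAt hnb) (hm2.2.differentiableAt hnb)] at h2
    rw [dist_eq_norm]
    refine h2.trans_lt ?_
    have : 2 * (ε * r / 4) / r = ε / 2 := by field_simp; ring
    rw [this]; linarith
  have hlim : ∀ y ∈ ball x r, ∃ L, Tendsto (fun i => fderiv ℂ (f i) y) l (𝓝 L) :=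
    fun y hy => cauchy_map_iff_exists_tendsto.1 (hcau.cauchy_map hy)
  choose! g' hg' using hlim
  have hunif := hcau.tendstoUniformlyOn_of_tendsto hg'
  have hnx : ball x r ∈ 𝓝 x := ball_mem_nhds x hr0
  refine (hasFDerivAt_of_tendstoUniformlyOnFilter (l := l) (f := f) (g := g)
    (f' := fun i y => fderiv ℂ (f i) y) (g' := g') (x := x) ?_ ?_
        ?_).differentiableAt.differentiableWithinAt
  · exact (tendstoUniformlyOn_iff_tendstoUniformlyOnFilter.1 hunif).mono_right
      (le_principal_iff.2 hnx)
  · filter_upwards [hf.prod_mk (eventually_mem_set.2 hnx)] with m hm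
    exact (hm.1.differentiableAt (isOpen_ball.mem_nhds (hs1 hm.2))).hasFDerivAt
  · filter_upwards [hnx] with y hy
    exact hfg.tendsto_at (hs1 hy)

/-- Locally bounded families of operators depending pointwise holomorphically on a parameter are
holomorphic in operator norm. -/
theorem differentiableOn_clm_of_apply {U : Set E} (hU : IsOpen U) {e : E → F →L[ℂ] G}
    (hb : ∀ x ∈ U, ∃ R > 0, ∃ C, ∀ y ∈ ball x R, ‖e y‖ ≤ C)
    (he : ∀ y, DifferentiableOn ℂ (fun x => e x y) U) : DifferentiableOn ℂ e U := by
  intro x hx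
  obtain ⟨R₀, hR₀, C, hC⟩ := hb x hx
  obtain ⟨R₁, hR₁, hRU⟩ := Metric.isOpen_iff.1 hU x hx
  set R := min R₀ R₁ with hR
  have hRpos : 0 < R := lt_min hR₀ hR₁
  have hRU' : ball x R ⊆ U := (ball_subset_ball (min_le_right _ _)).trans hRU
  have hC' : ∀ y ∈ ball x R, ‖e y‖ ≤ C := fun y hy => hC y (ball_subset_ball (min_le_left _ _) hy)
  have hCn : 0 ≤ C := (norm_nonneg _).trans (hC' x (mem_ball_self hRpos))
  have hbd : ∀ v, ∀ y ∈ ball x R, ‖e y v‖ ≤ C * ‖v‖ := fun v y hy =>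
    (e y).le_of_opNorm_le (hC' y hy) v
  have hda : ∀ v, DifferentiableAt ℂ (fun x => e x v) x := fun v =>
    (he v).differentiableAt (hU.mem_nhds hx)
  let T : F →L[ℂ] E →L[ℂ] G := LinearMap.mkContinuous
    { toFun := fun v => fderiv ℂ (fun x => e x v) x
      map_add' := fun v w => by
        simp only [map_add]
        exact fderiv_fun_add (hda v) (hda w)
      map_smul' := fun a v => by
        simp only [map_smul]
        exact fderiv_fun_const_smul (hda v) a } (2 * C / R) (fun v => by
          refine (norm_fderiv_le_of_bounded_on_ball hRpos ((he v).mono hRU') (hbd v)).trans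
            (le_of_eq ?_)
          ring)
  have hT : ∀ v, T v = fderiv ℂ (fun x => e x v) x := fun v => rfl
  have key : ∀ h, ‖h‖ < R / 4 → ‖e (x + h) - e x - T.flip h‖ ≤ 32 * C / R ^ 2 * ‖h‖ ^ 2 := by
    intro h hh
    refine ContinuousLinearMap.opNorm_le_bound _ (by positivity) fun v => ?_
    have := norm_sub_sub_fderiv_le hRpos hh ((he v).mono hRU') (hbd v)
    simp only [sub_apply, ContinuousLinearMap.flip_apply, hT]
    refine this.trans (le_of_eq ?_)
    ring
  refine HasFDerivAt.differentiableAt (f' := T.flip) ?_ |>.differentiableWithinAt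
  rw [hasFDerivAt_iff_isLittleO_nhds_zero]
  refine Asymptotics.IsBigO.trans_isLittleO (g := fun h : E => ‖h‖ ^ 2) ?_ ?_
  · refine Asymptotics.IsBigO.of_bound (32 * C / R ^ 2) ?_
    filter_upwards [Metric.ball_mem_nhds (0 : E) (by positivity : 0 < R / 4)] with h hh
    rw [mem_ball_zero_iff] at hh
    simpa using key h hh
  · have := Asymptotics.isLittleO_norm_pow_id (E' := E) (n := 2) (by norm_num)
    simpa using this

/-- Directional derivatives of holomorphic maps are holomorphic. -/
theorem differentiableOn_fderiv_apply [CompleteSpace F] {U : Set E} (hU : IsOpen U) {f : E → F}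
    (hf : DifferentiableOn ℂ f U) (v : E) : DifferentiableOn ℂ (fun x => fderiv ℂ f x v) U := by
  intro c hc
  obtain ⟨R, hR, hRU, M, hM, hb⟩ := exists_ball_bounded hU hf.continuousOn hc
  have hfR := hf.mono hRU
  suffices DifferentiableOn ℂ (fun x => fderiv ℂ f x v) (ball c (R / 2)) from
    (this.differentiableAt (ball_mem_nhds c (by linarith))).differentiableWithinAt
  refine differentiableOn_of_tendstoUniformlyOn_ball (l := 𝓝[≠] (0 : ℂ))
    (f := fun t x => t⁻¹ • (f (x + t • v) - f x)) ?_ ?_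
  · have hev : ∀ᶠ t : ℂ in 𝓝[≠] (0 : ℂ), ‖t • v‖ < R / 2 := by
      have : Tendsto (fun t : ℂ => ‖t • v‖) (𝓝 0) (𝓝 0) := by
        have : Continuous fun t : ℂ => ‖t • v‖ := by fun_prop
        simpa using this.tendsto 0
      exact (this.mono_left nhdsWithin_le_nhds).eventually (gt_mem_nhds (by positivity))
    filter_upwards [hev] with t ht x hx
    have h1 : x ∈ ball c R := ball_subset_ball (by linarith) hx
    have h2 : x + t • v ∈ ball c R := by
      rw [mem_ball, dist_eq_norm] at hx ⊢
      calc ‖x + t • v - c‖ = ‖(x - c) + t • v‖ := by congr 1; abel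
        _ ≤ ‖x - c‖ + ‖t • v‖ := norm_add_le _ _
        _ < R := by linarith
    have d1 : DifferentiableAt ℂ f x := hfR.differentiableAt (isOpen_ball.mem_nhds h1)
    have d2 : DifferentiableAt ℂ (fun x => f (x + t • v)) x :=
      (hfR.differentiableAt (isOpen_ball.mem_nhds h2)).comp x (differentiableAt_id.add_const _)
    exact ((d2.sub d1).const_smul t⁻¹).differentiableWithinAt
  · rw [Metric.tendstoUniformlyOn_iff]
    intro ε hε
    set A := 128 * M / R ^ 2 * ‖v‖ ^ 2 with hA
    have hA0 : 0 ≤ A := by positivity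
    have hev : ∀ᶠ t : ℂ in 𝓝[≠] (0 : ℂ), ‖t‖ * ‖v‖ < R / 8 ∧ A * ‖t‖ < ε := by
      have h1 : Tendsto (fun t : ℂ => ‖t‖ * ‖v‖) (𝓝 0) (𝓝 0) := by
        have : Continuous fun t : ℂ => ‖t‖ * ‖v‖ := by fun_prop
        simpa using this.tendsto 0
      have h2 : Tendsto (fun t : ℂ => A * ‖t‖) (𝓝 0) (𝓝 0) := by
        have : Continuous fun t : ℂ => A * ‖t‖ := by fun_prop
        simpa using this.tendsto 0
      exact ((h1.mono_left nhdsWithin_le_nhds).eventually (gt_mem_nhds (by positivity))).and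
        ((h2.mono_left nhdsWithin_le_nhds).eventually (gt_mem_nhds hε))
    filter_upwards [hev, self_mem_nhdsWithin] with t ht ht0 x hx
    have hs : ball x (R / 2) ⊆ ball c R := ball_subset_ball' (by rw [mem_ball] at hx; linarith)
    have ht0' : (t : ℂ) ≠ 0 := ht0
    have key := norm_sub_sub_fderiv_le (h := t • v) (by linarith : 0 < R / 2)
      (by rw [norm_smul]; linarith [ht.1]) (hfR.mono hs) (fun y hy => hb y (hs hy))
    rw [dist_comm, dist_eq_norm]
    have e : t⁻¹ • (f (x + t • v) - f x) - fderiv ℂ f x v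
        = t⁻¹ • (f (x + t • v) - f x - fderiv ℂ f x (t • v)) := by
      rw [map_smul, smul_sub t⁻¹ (f (x + t • v) - f x), smul_smul, inv_mul_cancel₀ ht0', one_smul]
    rw [e, norm_smul, norm_inv]
    have hpos : 0 < ‖t‖ := norm_pos_iff.2 ht0'
    calc ‖t‖⁻¹ * ‖f (x + t • v) - f x - fderiv ℂ f x (t • v)‖
        ≤ ‖t‖⁻¹ * (32 * M / (R / 2) ^ 2 * ‖t • v‖ ^ 2) := by gcongr
      _ = A * ‖t‖ := by rw [norm_smul, hA]; field_simp; ring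
      _ < ε := ht.2

theorem exists_ball_fderiv_bounded {U : Set E} (hU : IsOpen U) {f : E → F}
    (hf : DifferentiableOn ℂ f U) : ∀ x ∈ U, ∃ R > 0, ∃ C, ∀ y ∈ ball x R, ‖fderiv ℂ f y‖ ≤ C := by
  intro c hc
  obtain ⟨R, hR, hRU, M, hM, hb⟩ := exists_ball_bounded hU hf.continuousOn hc
  exact ⟨R / 2, by positivity, _, fun y hy =>
    norm_fderiv_le_of_bounded_on_ball' (by linarith) hy (hf.mono hRU) hb⟩

/-- The derivative of a holomorphic map is holomorphic. -/
theorem differentiableOn_fderiv_of_isOpen [CompleteSpace F] {U : Set E} (hU : IsOpen U) {f : E → F}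
    (hf : DifferentiableOn ℂ f U) : DifferentiableOn ℂ (fderiv ℂ f) U :=
  differentiableOn_clm_of_apply hU (exists_ball_fderiv_bounded hU hf)
    (differentiableOn_fderiv_apply hU hf)

/-- Holomorphic maps are smooth. -/
theorem contDiffOn_of_differentiableOn_complex.{u} {E : Type u} [NormedAddCommGroup E]
    [NormedSpace ℂ E] (k : ℕ) : ∀ {F : Type u} [NormedAddCommGroup F] [NormedSpace ℂ F]
      [CompleteSpace F] {U : Set E} (_ : IsOpen U) {f : E → F} (_ : DifferentiableOn ℂ f U),
      ContDiffOn ℂ k f U := by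
  induction k with
  | zero =>
    intro F _ _ _ U hU f hf
    exact contDiffOn_zero.2 hf.continuousOn
  | succ k ih =>
    intro F _ _ _ U hU f hf
    have := (contDiffOn_succ_iff_fderiv_of_isOpen (n := (k : WithTop ℕ∞)) hU (𝕜 := ℂ) (f := f)).2
      ⟨hf, by simp, ih hU (differentiableOn_fderiv_of_isOpen hU hf)⟩
    exact_mod_cast this

end Holomorphy

/-- An injective holomorphic function of one variable has nonvanishing derivative. -/
theorem deriv_ne_zero_of_injOn_nhds {f : ℂ → ℂ} {z₀ : ℂ} (hf : AnalyticAt ℂ f z₀) {V : Set ℂ}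
    (hV : V ∈ 𝓝 z₀) (hinj : InjOn f V) : deriv f z₀ ≠ 0 := by
  have hz₀ : z₀ ∈ V := mem_of_mem_nhds hV
  have hg : AnalyticAt ℂ (fun z => f z - f z₀) z₀ := hf.sub analyticAt_const
  have hne : ¬∀ᶠ z in 𝓝 z₀, f z - f z₀ = 0 := by
    intro h
    obtain ⟨z, ⟨hz1, hz2⟩, hz3⟩ := (((h.filter_mono nhdsWithin_le_nhds).and
      (nhdsWithin_le_nhds hV)).and (self_mem_nhdsWithin (a := z₀) (s := {z₀}ᶜ))).exists
    exact hz3 (hinj hz2 hz₀ (sub_eq_zero.1 hz1))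
  obtain ⟨n, u, hu, hu0, hgu⟩ := hg.exists_eventuallyEq_pow_smul_nonzero_iff.2 hne
  have hn0 : n ≠ 0 := by
    rintro rfl
    have := hgu.self_of_nhds
    simp at this
    exact hu0 this.symm
  have hn : (n : ℂ) ≠ 0 := Nat.cast_ne_zero.2 hn0
  obtain ⟨c, hc⟩ := IsAlgClosed.exists_pow_nat_eq (u z₀) (Nat.pos_of_ne_zero hn0)
  have hc0 : c ≠ 0 := by
    rintro rfl
    rw [zero_pow hn0] at hc
    exact hu0 hc.symm
  set v : ℂ → ℂ := fun z => c * Complex.exp (Complex.log (u z / u z₀) / n) with hv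
  have hratio : AnalyticAt ℂ (fun z => u z / u z₀) z₀ := hu.div analyticAt_const hu0
  have hva : AnalyticAt ℂ v z₀ := by
    refine analyticAt_const.mul (AnalyticAt.cexp ?_)
    refine AnalyticAt.div (AnalyticAt.clog hratio ?_) analyticAt_const hn
    rw [div_self hu0]; exact Complex.one_mem_slitPlane
  have hv0 : v z₀ = c := by simp [hv, div_self hu0]
  have hvn : ∀ᶠ z in 𝓝 z₀, v z ^ n = u z := by
    filter_upwards [hu.continuousAt.eventually_ne hu0] with z hz
    rw [hv]
    simp only
    rw [mul_pow, hc, ← Complex.exp_nat_mul, mul_div_cancel₀ _ hn,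
      Complex.exp_log (div_ne_zero hz hu0), mul_div_cancel₀ _ hu0]
  set W : ℂ → ℂ := fun z => (z - z₀) * v z with hW
  have hWa : AnalyticAt ℂ W z₀ := (analyticAt_id.sub analyticAt_const).mul hva
  have hW' : HasStrictDerivAt W c z₀ := by
    have h1 := hWa.hasStrictDerivAt
    have h2 : HasDerivAt W (1 * v z₀ + (z₀ - z₀) * deriv v z₀) z₀ :=
      ((hasDerivAt_id z₀).sub_const z₀).mul hva.differentiableAt.hasDerivAt
    rw [h2.deriv] at h1
    simpa [hv0] using h1
  have hW0 : W z₀ = 0 := by simp [hW]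
  have hmap : map W (𝓝 z₀) = 𝓝 0 := by rw [hW'.map_nhds_eq hc0, hW0]
  have hgW : ∀ᶠ z in 𝓝 z₀, f z - f z₀ = W z ^ n := by
    filter_upwards [hgu, hvn] with z h1 h2
    rw [h1, hW, mul_pow, h2, smul_eq_mul]
  by_cases hn1 : n = 1
  · subst hn1
    have h1 : (fun z => f z - f z₀) =ᶠ[𝓝 z₀] W := by
      filter_upwards [hgW] with z hz
      rw [hz, pow_one]
    have h2 := h1.deriv_eq
    rw [hW'.hasDerivAt.deriv, deriv_sub_const] at h2
    rw [h2]; exact hc0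
  · exfalso
    set ζ := Complex.exp (2 * Real.pi * Complex.I / n)
    have hζ : IsPrimitiveRoot ζ n := Complex.isPrimitiveRoot_exp n hn0
    have hS := image_mem_map (m := W) (inter_mem hV hgW)
    rw [hmap] at hS
    have hS2 : ∀ᶠ w in 𝓝 (0 : ℂ), ζ * w ∈ W '' (V ∩ {z | f z - f z₀ = W z ^ n}) := by
      have : Tendsto (fun w => ζ * w) (𝓝 0) (𝓝 0) := by
        simpa using (continuous_const_mul ζ).tendsto 0
      exact this hS
    obtain ⟨w, ⟨hw1, hw2⟩, hw3⟩ := (((hS2.and hS).filter_mono nhdsWithin_le_nhds).and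
      (self_mem_nhdsWithin (a := (0 : ℂ)) (s := {0}ᶜ))).exists
    obtain ⟨z1, ⟨hz1, hz1'⟩, e1⟩ := hw1
    obtain ⟨z2, ⟨hz2, hz2'⟩, e2⟩ := hw2
    have h1 : f z1 - f z₀ = W z1 ^ n := hz1'
    have h2 : f z2 - f z₀ = W z2 ^ n := hz2'
    rw [e1, mul_pow, hζ.pow_eq_one, one_mul] at h1
    rw [e2] at h2
    have : z1 = z2 := hinj hz1 hz2 (sub_left_injective (h1.trans h2.symm))
    rw [this, e2] at e1
    have hw0 : w ≠ 0 := hw3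
    have : ζ = 1 := mul_right_cancel₀ hw0 (by rw [one_mul]; exact e1.symm)
    exact hζ.ne_one (by omega) this

section SeveralVariables

variable {E F : Type} [NormedAddCommGroup E] [NormedSpace ℂ E] [FiniteDimensional ℂ E]
  [NormedAddCommGroup F] [NormedSpace ℂ F] [FiniteDimensional ℂ F]

theorem contDiffAt_of_differentiableOn {E F : Type} [NormedAddCommGroup E] [NormedSpace ℂ E]
    [NormedAddCommGroup F] [NormedSpace ℂ F] [FiniteDimensional ℂ F] {U : Set E} (hU : IsOpen U)
        {f : E → F}
    (hf : DifferentiableOn ℂ f U) {x : E} (hx : x ∈ U) : ContDiffAt ℂ 1 f x := by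
  have : CompleteSpace F := FiniteDimensional.complete ℂ F
  exact (contDiffOn_of_differentiableOn_complex 1 hU hf).contDiffAt (hU.mem_nhds hx)

/-- Holomorphic parametrization of a smooth complex hypersurface. -/
theorem exists_parametrization_of_hypersurface {U : Set E} (hU : IsOpen U) {h : E → ℂ}
    (hh : DifferentiableOn ℂ h U) {a : E} (ha : a ∈ U) (ha0 : h a = 0)
    (hne : fderiv ℂ h a ≠ 0) :
    ∃ ψ : (fderiv ℂ h a).ker → E, ∃ V : Set (fderiv ℂ h a).ker, IsOpen V ∧
      (0 : (fderiv ℂ h a).ker) ∈ V ∧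
      DifferentiableOn ℂ ψ V ∧ ψ 0 = a ∧ HasFDerivAt ψ (fderiv ℂ h a).ker.subtypeL 0 ∧
      (∀ y ∈ V, h (ψ y) = 0) ∧ InjOn ψ V := by
  have : CompleteSpace E := FiniteDimensional.complete ℂ E
  set L := fderiv ℂ h a with hL
  obtain ⟨π, hπ⟩ := Submodule.ClosedComplemented.of_finiteDimensional L.ker
  have hLs : L.range = ⊤ := by
    apply LinearMap.range_eq_top.2
    exact LinearMap.surjective (f := (L : E →ₗ[ℂ] ℂ))
        (fun h0 => hne (by ext x; exact congrArg (fun l => l x) h0))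
  have hπs : π.range = ⊤ := LinearMap.range_eq_top.2 fun y => ⟨y, hπ y⟩
  have hcompl : IsCompl L.ker π.ker := LinearMap.isCompl_of_proj hπ
  let e := L.equivProdOfSurjectiveOfIsCompl π hLs hπs hcompl
  let Θ : E → ℂ × L.ker := fun x => (h x, π (x - a))
  have hΘ : ContDiffAt ℂ 1 Θ a :=
    (contDiffAt_of_differentiableOn hU hh ha).prodMk
      ((π.contDiff.comp (contDiff_id.sub contDiff_const)).contDiffAt)
  have hΘ' : HasFDerivAt Θ (e : E →L[ℂ] ℂ × L.ker) a := by
    have h1 : HasFDerivAt h L a := (hh.differentiableAt (hU.mem_nhds ha)).hasFDerivAt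
    have h2 : HasFDerivAt (fun x => π (x - a)) π a :=
      π.hasFDerivAt.comp a ((hasFDerivAt_id a).sub_const a)
    exact h1.prodMk h2
  have hΘs := hΘ.hasStrictFDerivAt' hΘ' one_ne_zero
  have hΘa : Θ a = (0, 0) := by simp [Θ, ha0]
  let ι : L.ker → ℂ × L.ker := fun y => (0, y)
  have hι : ContDiff ℂ 1 ι := contDiff_const.prodMk contDiff_id
  let g := hΘ.localInverse hΘ' one_ne_zero
  let ψ : L.ker → E := fun y => g (ι y)
  have hι0 : ι 0 = Θ a := hΘa.symm
  have hga : g (Θ a) = a := hΘ.localInverse_apply_image hΘ' one_ne_zero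
  have hψ : ContDiffAt ℂ 1 ψ 0 := by
    have h1 : ContDiffAt ℂ 1 g (ι 0) := by
      rw [hι0]; exact hΘ.to_localInverse hΘ' one_ne_zero
    exact h1.comp 0 hι.contDiffAt
  have hdiff : ∀ᶠ y in 𝓝 (0 : L.ker), DifferentiableAt ℂ ψ y := by
    filter_upwards [hψ.eventually (by simp)] with y hy using hy.differentiableAt (by simp)
  have hright : ∀ᶠ y in 𝓝 (0 : L.ker), Θ (ψ y) = ι y := by
    have h1 := hΘs.eventually_right_inverse
    rw [← hι0] at h1
    exact hι.continuous.continuousAt.eventually h1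
  obtain ⟨V, hV, hVo, h0V⟩ := _root_.eventually_nhds_iff.1 (hdiff.and hright)
  refine ⟨ψ, V, hVo, h0V, fun y hy => (hV y hy).1.differentiableWithinAt, ?_, ?_, ?_, ?_⟩
  · change g (ι 0) = a
    rw [hι0, hga]
  · have h1 : HasStrictFDerivAt g (e.symm : ℂ × L.ker →L[ℂ] E) (ι 0) := by
      rw [hι0]; exact hΘs.to_localInverse
    have h2 : HasFDerivAt ι (ContinuousLinearMap.inr ℂ ℂ L.ker) 0 :=
      (ContinuousLinearMap.inr ℂ ℂ L.ker).hasFDerivAt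
    have h3 := h1.hasFDerivAt.comp 0 h2
    refine h3.congr_fderiv (ContinuousLinearMap.ext fun y => ?_)
    have hy : e (y : E) = (0, y) := by
      have : e (y : E) = (L y, π y) := rfl
      rw [this, hπ y]
      exact Prod.ext y.2 rfl
    change e.symm (0, y) = (y : E)
    rw [← hy, e.symm_apply_apply]
  · intro y hy
    exact congrArg Prod.fst (hV y hy).2
  · intro y hy y' hy' hyy
    have h1 := (hV y hy).2
    have h2 := (hV y' hy').2
    rw [hyy, h2] at h1
    exact (congrArg Prod.snd h1).symm

end SeveralVariables

section SeveralVariables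

variable {E F : Type} [NormedAddCommGroup E] [NormedSpace ℂ E] [FiniteDimensional ℂ E]
  [NormedAddCommGroup F] [NormedSpace ℂ F] [FiniteDimensional ℂ F]

/-- The determinant as a holomorphic function detecting injectivity. -/
theorem exists_differentiable_eq_zero_iff_not_injective
    (hEF : Module.finrank ℂ E = Module.finrank ℂ F) :
    ∃ J : (E →L[ℂ] F) → ℂ, Differentiable ℂ J ∧ ∀ T, J T = 0 ↔ ¬ Function.Injective T := by
  let b := Module.finBasis ℂ E
  let c := (Module.finBasis ℂ F).reindex (finCongr hEF.symm)
  refine ⟨fun T => (LinearMap.toMatrix b c (T : E →ₗ[ℂ] F)).det, ?_, fun T => ?_⟩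
  · simp only [Matrix.det_apply]
    refine Differentiable.fun_sum fun σ _ => ?_
    simp only [Units.smul_def, zsmul_eq_mul]
    refine Differentiable.const_mul ?_ _
    have hl : ∀ i, Differentiable ℂ
        (fun T : E →L[ℂ] F => LinearMap.toMatrix b c (T : E →ₗ[ℂ] F) (σ i) i) := fun i =>
      (LinearMap.toContinuousLinearMap (𝕜 := ℂ)
        ({ toFun := fun T => LinearMap.toMatrix b c (T : E →ₗ[ℂ] F) (σ i) i
           map_add' := fun S T => by simp
           map_smul' := fun a T => by simp } : (E →L[ℂ] F) →ₗ[ℂ] ℂ)).differentiable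
    classical
    refine Finset.induction_on (motive := fun s => Differentiable ℂ
      (fun T : E →L[ℂ] F => ∏ i ∈ s, LinearMap.toMatrix b c (T : E →ₗ[ℂ] F) (σ i) i))
      Finset.univ (by simp) fun i s hi ih => ?_
    simp only [Finset.prod_insert hi]
    exact (hl i).mul ih
  · refine ⟨fun h0 hinj => ?_, fun h0 => by_contra fun h => h0 ?_⟩
    · have hinj' : Function.Injective (T : E →ₗ[ℂ] F) := hinj
      let e := LinearEquiv.ofBijective (T : E →ₗ[ℂ] F)
        ⟨hinj', (LinearMap.injective_iff_surjective_of_finrank_eq_finrank hEF).1 hinj'⟩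
      exact (LinearEquiv.isUnit_det e b c).ne_zero h0
    · exact (LinearEquiv.ofIsUnitDet (isUnit_iff_ne_zero.2 h)).injective

/-- Zeros of a holomorphic function near a smooth hypersurface containing its zero set fill out
the hypersurface. -/
theorem eventually_eq_zero_of_zeros_subset {E : Type} [NormedAddCommGroup E] [NormedSpace ℂ E]
    {U : Set E} (hU : IsOpen U) {J Φ : E → ℂ}
    (hJ : DifferentiableOn ℂ J U) (hΦ : DifferentiableOn ℂ Φ U) {a : E} (ha : a ∈ U) (hJa : J a = 0)
    (hsub : ∀ x ∈ U, J x = 0 → Φ x = 0) (hne : fderiv ℂ Φ a ≠ 0) :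
    ∀ᶠ x in 𝓝 a, Φ x = 0 → J x = 0 := by
  obtain ⟨v, hv⟩ : ∃ v, fderiv ℂ Φ a v ≠ 0 := by
    by_contra! h
    exact hne (by ext v; exact h v)
  have hv0 : 0 < ‖v‖ := norm_pos_iff.2 (by rintro rfl; simp at hv)
  set c := ‖fderiv ℂ Φ a v‖ with hc
  have hc0 : 0 < c := norm_pos_iff.2 hv
  -- Lipschitz transversality
  have hstrict : HasStrictFDerivAt Φ (fderiv ℂ Φ a) a :=
    (contDiffAt_of_differentiableOn hU hΦ ha).hasStrictFDerivAt one_ne_zero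
  have h1 : ∀ᶠ p : E × E in 𝓝 (a, a), ‖Φ p.1 - Φ p.2 - fderiv ℂ Φ a (p.1 - p.2)‖
      ≤ c / (2 * ‖v‖) * ‖p.1 - p.2‖ := hstrict.isLittleO.def (by positivity)
  rw [nhds_prod_eq] at h1
  obtain ⟨P, hP, hPP⟩ := mem_prod_same_iff.1 h1
  obtain ⟨r, hr, hrP⟩ := Metric.mem_nhds_iff.1 (inter_mem hP (hU.mem_nhds ha))
  have htrans : ∀ x ∈ ball a r, ∀ ζ : ℂ, x + ζ • v ∈ ball a r → Φ x = 0 → Φ (x + ζ • v) = 0 →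
      ζ = 0 := by
    intro x hx ζ hζ h0 h0'
    have := hPP (mk_mem_prod (hrP hζ).1 (hrP hx).1)
    simp only [mem_ofPred_eq, h0, h0', add_sub_cancel_left, map_smul, smul_eq_mul, norm_smul]
      at this
    rw [sub_zero, zero_sub, norm_neg, norm_mul, ← hc] at this
    by_contra hz
    have hz' : 0 < ‖ζ‖ := norm_pos_iff.2 hz
    have e : c / (2 * ‖v‖) * (‖ζ‖ * ‖v‖) = ‖ζ‖ * c / 2 := by field_simp
    rw [e] at this
    nlinarith [mul_pos hz' hc0]
  set δ := r / (2 * ‖v‖) with hδ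
  have hδ0 : 0 < δ := by positivity
  have hδv : δ * ‖v‖ = r / 2 := by rw [hδ]; field_simp
  have hmem : ∀ x ∈ ball a (r / 2), ∀ ζ ∈ closedBall (0 : ℂ) δ, x + ζ • v ∈ ball a r := by
    intro x hx ζ hζ
    rw [mem_ball, dist_eq_norm] at hx ⊢
    rw [mem_closedBall_zero_iff] at hζ
    calc ‖x + ζ • v - a‖ = ‖(x - a) + ζ • v‖ := by congr 1; abel
      _ ≤ ‖x - a‖ + ‖ζ‖ * ‖v‖ := by rw [← norm_smul]; exact norm_add_le _ _
      _ ≤ ‖x - a‖ + δ * ‖v‖ := by gcongr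
      _ < r := by rw [hδv]; linarith
  have hrU : ball a r ⊆ U := fun x hx => (hrP hx).2
  have har : a ∈ ball a (r / 2) := mem_ball_self (by linarith)
  -- lower bound on the circle
  have hΦa := hsub a ha hJa
  obtain ⟨ζ₀, hζ₀, hmin⟩ := (isCompact_sphere (0 : ℂ) δ).exists_isMinOn
    (NormedSpace.sphere_nonempty.2 hδ0.le)
    (f := fun ζ => ‖J (a + ζ • v)‖) (by
      apply ContinuousOn.norm
      refine hJ.continuousOn.comp (by fun_prop) fun ζ hζ => hrU (hmem a har ζ ?_)
      exact sphere_subset_closedBall hζ)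
  set m := ‖J (a + ζ₀ • v)‖ with hm
  have hm0 : 0 < m := by
    refine norm_pos_iff.2 fun h0 => ?_
    have hmm := hmem a har ζ₀ (sphere_subset_closedBall hζ₀)
    have := htrans a (mem_ball_self hr) ζ₀ hmm hΦa (hsub _ (hrU hmm) h0)
    rw [this] at hζ₀
    simp at hζ₀
    linarith
  -- uniform continuity near the circle
  have hclose : ∀ᶠ x in 𝓝 a, ∀ ζ ∈ sphere (0 : ℂ) δ, m / 2 < ‖J (x + ζ • v)‖ := by
    refine (isCompact_sphere (0 : ℂ) δ).eventually_forall_of_forall_eventually fun ζ hζ => ?_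
    have hmm := hmem a har ζ (sphere_subset_closedBall hζ)
    have hca : ContinuousAt J (a + ζ • v) := hJ.continuousOn.continuousAt (hU.mem_nhds (hrU hmm))
    have hcc : ContinuousAt (fun z : E × ℂ => ‖J (z.1 + z.2 • v)‖) (a, ζ) := by
      refine (ContinuousAt.comp (f := fun z : E × ℂ => z.1 + z.2 • v) (g := J) hca ?_).norm
      fun_prop
    refine hcc.eventually (lt_mem_nhds ?_)
    have : m ≤ ‖J (a + ζ • v)‖ := hmin hζ
    simp only
    linarith
  have hsmall : ∀ᶠ x in 𝓝 a, ‖J x‖ < m / 2 := by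
    have : ContinuousAt J a := hJ.continuousOn.continuousAt (hU.mem_nhds ha)
    exact this.norm.eventually (gt_mem_nhds (by simp only [hJa, norm_zero]; positivity))
  filter_upwards [hclose, hsmall, ball_mem_nhds a (by linarith : 0 < r / 2)] with x hx1 hx2 hx3 hx4
  by_contra hJx
  have hxr : x ∈ ball a r := ball_subset_ball (by linarith) hx3
  have hnz : ∀ ζ ∈ closedBall (0 : ℂ) δ, J (x + ζ • v) ≠ 0 := by
    intro ζ hζ h0
    have hmm := hmem x hx3 ζ hζ
    have := htrans x hxr ζ hmm hx4 (hsub _ (hrU hmm) h0)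
    rw [this, zero_smul, add_zero] at h0
    exact hJx h0
  have hdiff : DifferentiableOn ℂ (fun ζ : ℂ => (J (x + ζ • v))⁻¹) (closedBall 0 δ) := by
    intro ζ hζ
    have hmm := hmem x hx3 ζ hζ
    have h2 : DifferentiableAt ℂ J (x + ζ • v) := hJ.differentiableAt (hU.mem_nhds (hrU hmm))
    have h3 : DifferentiableAt ℂ (fun ζ : ℂ => J (x + ζ • v)) ζ :=
      DifferentiableAt.comp (g := J) ζ h2 (by fun_prop)
    exact (h3.inv (hnz ζ hζ)).differentiableWithinAt
  have := Complex.norm_le_of_forall_mem_frontier_norm_le (U := ball (0 : ℂ) δ) isBounded_ball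
    (f := fun ζ : ℂ => (J (x + ζ • v))⁻¹)
    ((hdiff.mono closure_ball_subset_closedBall).diffContOnCl) (C := (m / 2)⁻¹) (fun z hz => by
      rw [frontier_ball _ hδ0.ne'] at hz
      rw [norm_inv]
      exact inv_anti₀ (by positivity) (hx1 z hz).le) (z := 0)
      (subset_closure (mem_ball_self hδ0))
  rw [zero_smul, add_zero, norm_inv] at this
  exact absurd (inv_le_inv₀ (norm_pos_iff.2 hJx) (by positivity) |>.1 this) (by linarith)

end SeveralVariables

section Osgood

variable {E F : Type} [NormedAddCommGroup E] [NormedSpace ℂ E]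
  [NormedAddCommGroup F] [NormedSpace ℂ F]

theorem not_eventually_fderiv_eq_zero_of_injOn [Nontrivial E] {a : E} {U : Set E} (hU : U ∈ 𝓝 a)
    {f : E → F}
    (hf : DifferentiableOn ℂ f U) (hinj : InjOn f U) : ¬ ∀ᶠ x in 𝓝 a, fderiv ℂ f x = 0 := by
  intro h
  obtain ⟨r, hr, hrU⟩ := Metric.mem_nhds_iff.1 (inter_mem h hU)
  have hfr : DifferentiableOn ℂ f (ball a r) := hf.mono fun x hx => (hrU hx).2
  obtain ⟨v, hv⟩ := exists_ne (0 : E)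
  have hv0 : 0 < ‖v‖ := norm_pos_iff.2 hv
  have hmem : a + ((r / (2 * ‖v‖) : ℝ) : ℂ) • v ∈ ball a r := by
    rw [mem_ball, dist_eq_norm, add_sub_cancel_left, norm_smul, Complex.norm_real,
      Real.norm_of_nonneg (by positivity)]
    field_simp
    linarith
  have := isOpen_ball.is_const_of_fderiv_eq_zero (convex_ball a r).isPreconnected hfr
    (fun x hx => (hrU hx).1) hmem (mem_ball_self hr)
  have h2 := hinj (hrU hmem).2 (hrU (mem_ball_self hr)).2 this
  rw [add_eq_left, smul_eq_zero] at h2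
  rcases h2 with h2 | h2
  · norm_cast at h2
    exact absurd h2 (by positivity)
  · exact hv h2

/-- A holomorphic function vanishing at the centre of a ball, together with all iterated
derivatives in each direction, is zero;
hence some function vanishing on its zero set has a regular zero on that zero set. -/
theorem exists_regular_zero {a : E} {r : ℝ} {J : E → ℂ}
    (hJ : DifferentiableOn ℂ J (ball a r)) (hJa : J a = 0) (hne : ∃ x ∈ ball a r, J x ≠ 0) :
    ∃ g : E → ℂ, DifferentiableOn ℂ g (ball a r) ∧ (∀ x ∈ ball a r, J x = 0 → g x = 0) ∧
      ∃ x₀ ∈ ball a r, J x₀ = 0 ∧ fderiv ℂ g x₀ ≠ 0 := by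
  by_contra! hcon
  obtain ⟨x, hx, hxJ⟩ := hne
  set v := x - a with hv
  have hv0 : v ≠ 0 := by
    rintro h0
    rw [hv, sub_eq_zero] at h0
    exact hxJ (h0 ▸ hJa)
  have hvp : 0 < ‖v‖ := norm_pos_iff.2 hv0
  have hvr : ‖v‖ < r := by rwa [mem_ball, dist_eq_norm] at hx
  let T : ℕ → E → ℂ := fun k => Nat.rec J (fun _ g x => fderiv ℂ g x v) k
  have hT : ∀ k, DifferentiableOn ℂ (T k) (ball a r) ∧ ∀ x ∈ ball a r, J x = 0 → T k x = 0 := by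
    intro k
    induction k with
    | zero => exact ⟨hJ, fun x _ h => h⟩
    | succ k ih =>
      refine ⟨differentiableOn_fderiv_apply isOpen_ball ih.1 v, fun x hx h => ?_⟩
      change fderiv ℂ (T k) x v = 0
      rw [hcon (T k) ih.1 ih.2 x hx h]
      rfl
  set R := r / ‖v‖ with hR
  have hmem : ∀ ζ ∈ ball (0 : ℂ) R, a + ζ • v ∈ ball a r := by
    intro ζ hζ
    rw [mem_ball_zero_iff, hR, lt_div_iff₀ hvp] at hζ
    rwa [mem_ball, dist_eq_norm, add_sub_cancel_left, norm_smul]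
  have hder : ∀ k, ∀ ζ ∈ ball (0 : ℂ) R,
      HasDerivAt (fun ζ : ℂ => T k (a + ζ • v)) (T (k + 1) (a + ζ • v)) ζ := by
    intro k ζ hζ
    have h1 : HasFDerivAt (T k) (fderiv ℂ (T k) (a + ζ • v)) (a + ζ • v) :=
      ((hT k).1.differentiableAt (isOpen_ball.mem_nhds (hmem ζ hζ))).hasFDerivAt
    have h2 : HasDerivAt (fun ζ : ℂ => a + ζ • v) ((1 : ℂ) • v) ζ :=
      ((hasDerivAt_id ζ).smul_const v).const_add a
    have := h1.comp_hasDerivAt ζ h2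
    rwa [one_smul] at this
  have hit : ∀ k, ∀ ζ ∈ ball (0 : ℂ) R,
      iteratedDeriv k (fun ζ : ℂ => J (a + ζ • v)) ζ = T k (a + ζ • v) := by
    intro k
    induction k with
    | zero => intro ζ _; rfl
    | succ k ih =>
      intro ζ hζ
      rw [iteratedDeriv_succ]
      have : iteratedDeriv k (fun ζ : ℂ => J (a + ζ • v)) =ᶠ[𝓝 ζ] fun ζ => T k (a + ζ • v) :=
        Filter.eventually_of_mem (isOpen_ball.mem_nhds hζ) ih
      rw [this.deriv_eq]
      exact (hder k ζ hζ).deriv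
  have hR1 : 1 < R := by rwa [hR, one_lt_div hvp]
  have hsum := Complex.hasSum_taylorSeries_on_ball (f := fun ζ : ℂ => J (a + ζ • v)) (c := 0)
      (r := R)
    (z := 1) (fun ζ hζ => (hder 0 ζ hζ).differentiableAt.differentiableWithinAt)
    (by simpa using hR1)
  have hz : ∀ k, iteratedDeriv k (fun ζ : ℂ => J (a + ζ • v)) 0 = 0 := by
    intro k
    rw [hit k 0 (mem_ball_self (by linarith)), zero_smul, add_zero]
    exact (hT k).2 a (mem_ball_self (by linarith)) hJa
  simp only [hz, smul_zero] at hsum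
  have := hsum.unique hasSum_zero
  rw [one_smul, hv, add_sub_cancel] at this
  exact hxJ this

variable [FiniteDimensional ℂ E] [FiniteDimensional ℂ F]

theorem injective_fderiv_of_injOn_aux (n : ℕ) : ∀ {E F : Type} [NormedAddCommGroup E]
    [NormedSpace ℂ E] [NormedAddCommGroup F] [NormedSpace ℂ F] [FiniteDimensional ℂ E]
    [FiniteDimensional ℂ F], Module.finrank ℂ E = n → Module.finrank ℂ F = n → ∀ {U : Set E}
    {f : E → F}, IsOpen U → DifferentiableOn ℂ f U → InjOn f U → ∀ a ∈ U,
    Function.Injective (fderiv ℂ f a) := by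
  induction n with
  | zero =>
    intro E F _ _ _ _ _ _ hE _ U f _ _ _ a _
    have : Subsingleton E := Module.finrank_zero_iff.1 hE
    exact Function.injective_of_subsingleton _
  | succ n ih =>
    intro E F _ _ _ _ _ _ hE hF U f hU hf hinj
    have step : ∀ a ∈ U, fderiv ℂ f a ≠ 0 → Function.Injective (fderiv ℂ f a) := by
      intro a ha hne
      obtain ⟨v, hv⟩ : ∃ v, fderiv ℂ f a v ≠ 0 := by
        by_contra! h
        exact hne (by ext v; exact h v)
      obtain ⟨l, hl⟩ := SeparatingDual.exists_ne_zero (R := ℂ) hv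
      have hda : HasFDerivAt f (fderiv ℂ f a) a :=
          (hf.differentiableAt (hU.mem_nhds ha)).hasFDerivAt
      have hdh : HasFDerivAt (fun x => l (f x) - l (f a)) (l.comp (fderiv ℂ f a)) a :=
        (l.hasFDerivAt.comp a hda).sub_const _
      have hne' : l.comp (fderiv ℂ f a) ≠ 0 := fun h => hl (by
        simpa using congrArg (fun T => T v) h)
      have hl0 : l ≠ 0 := by rintro rfl; simp at hl
      obtain ⟨ψ, V, hV, h0V, hψ, hψ0, hψ', hψh, hψi⟩ := exists_parametrization_of_hypersurface
        (h := fun x => l (f x) - l (f a)) hU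
        ((l.differentiable.comp_differentiableOn hf).sub_const _) ha (by simp)
        (by rw [hdh.fderiv]; exact hne')
      have hLe := hdh.fderiv
      generalize fderiv ℂ (fun x => l (f x) - l (f a)) a = L at *
      have hπ := Submodule.ClosedComplemented.of_finiteDimensional (LinearMap.ker (l : F →ₗ[ℂ] ℂ))
      obtain ⟨π, hπ⟩ := hπ
      set V' := V ∩ ψ ⁻¹' U with hV'
      have hV'o : IsOpen V' := hψ.continuousOn.isOpen_inter_preimage hV hU
      have h0V' : (0 : (L : E →ₗ[ℂ] ℂ).ker) ∈ V' := ⟨h0V, by rw [mem_preimage, hψ0]; exact ha⟩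
      have hval : ∀ y ∈ V', ((π (f (ψ y) - f a) : LinearMap.ker (l : F →ₗ[ℂ] ℂ)) : F) =
          f (ψ y) - f a := by
        intro y hy
        have hk : f (ψ y) - f a ∈ LinearMap.ker (l : F →ₗ[ℂ] ℂ) := by
          rw [LinearMap.mem_ker]
          simpa using hψh y hy.1
        rw [hπ ⟨_, hk⟩]
      have hG : DifferentiableOn ℂ (fun y => π (f (ψ y) - f a)) V' := by
        refine π.differentiable.comp_differentiableOn ?_
        exact ((hf.comp (hψ.mono inter_subset_left) fun y hy => hy.2)).sub_const _
      have hGi : InjOn (fun y => π (f (ψ y) - f a)) V' := by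
        intro y hy z hz hyz
        have h1 := congrArg (fun w : LinearMap.ker (l : F →ₗ[ℂ] ℂ) => (w : F)) hyz
        simp only [hval y hy, hval z hz, sub_left_inj] at h1
        exact hψi hy.1 hz.1 (hinj hy.2 hz.2 h1)
      have hL0 : L ≠ 0 := hLe ▸ hne'
      have hdE : Module.finrank ℂ (L : E →ₗ[ℂ] ℂ).ker = n := by
        have := Module.Dual.finrank_ker_add_one_of_ne_zero (f := (L : E →ₗ[ℂ] ℂ))
          (fun h => hL0 (by ext v; exact congrArg (fun T => T v) h))
        omega
      have hdF : Module.finrank ℂ (LinearMap.ker (l : F →ₗ[ℂ] ℂ)) = n := by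
        have := Module.Dual.finrank_ker_add_one_of_ne_zero (f := (l : F →ₗ[ℂ] ℂ))
          (fun h => hl0 (by ext v; exact congrArg (fun T => T v) h))
        omega
      have hinjG := ih hdE hdF hV'o hG hGi 0 h0V'
      have hdG : HasFDerivAt (fun y => π (f (ψ y) - f a))
          (π.comp ((fderiv ℂ f a).comp (L : E →ₗ[ℂ] ℂ).ker.subtypeL)) 0 := by
        refine π.hasFDerivAt.comp 0 (HasFDerivAt.sub_const _ ?_)
        refine HasFDerivAt.comp 0 ?_ hψ'
        rw [hψ0]
        exact hda
      rw [hdG.fderiv] at hinjG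
      rw [injective_iff_map_eq_zero]
      intro x hx
      have hxk : x ∈ (L : E →ₗ[ℂ] ℂ).ker := by
        rw [LinearMap.mem_ker]
        change L x = 0
        rw [hLe]
        simp [hx]
      have := (injective_iff_map_eq_zero _).1 hinjG ⟨x, hxk⟩ (by simp [hx])
      simpa using this
    intro a ha
    by_cases hne : fderiv ℂ f a = 0
    swap
    · exact step a ha hne
    exfalso
    rcases Nat.eq_zero_or_pos n with rfl | hn
    · have hE' : Module.finrank ℂ E = Module.finrank ℂ ℂ := by simp [hE]
      have hF' : Module.finrank ℂ F = Module.finrank ℂ ℂ := by simp [hF]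
      let eE := ContinuousLinearEquiv.ofFinrankEq hE'
      let eF := ContinuousLinearEquiv.ofFinrankEq hF'
      have hUo : IsOpen (eE.symm ⁻¹' U) := hU.preimage eE.symm.continuous
      have hd : DifferentiableOn ℂ (fun z => eF (f (eE.symm z))) (eE.symm ⁻¹' U) :=
        eF.differentiable.comp_differentiableOn
          (hf.comp eE.symm.differentiable.differentiableOn fun z hz => hz)
      have haU : eE a ∈ eE.symm ⁻¹' U := by simpa using ha
      refine deriv_ne_zero_of_injOn_nhds (hd.analyticAt (hUo.mem_nhds haU)) (hUo.mem_nhds haU)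
        (fun z hz w hw hzw => eE.symm.injective (hinj hz hw (eF.injective hzw))) ?_
      have hda : HasFDerivAt f (fderiv ℂ f a) a :=
        (hf.differentiableAt (hU.mem_nhds ha)).hasFDerivAt
      rw [hne] at hda
      have h1 : HasFDerivAt (fun z => f (eE.symm z)) ((0 : E →L[ℂ] F).comp (eE.symm : ℂ →L[ℂ] E))
          (eE a) := by
        refine HasFDerivAt.comp _ ?_ eE.symm.hasFDerivAt
        simpa using hda
      have h2 := (eF.hasFDerivAt.comp (eE a) h1).hasDerivAt.deriv
      simpa [Function.comp_def] using h2
    · have : Nontrivial E := Module.nontrivial_of_finrank_pos (R := ℂ) (by omega)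
      obtain ⟨J, hJ, hJz⟩ := exists_differentiable_eq_zero_iff_not_injective (hE.trans hF.symm)
      have hJz' : ∀ x ∈ U, J (fderiv ℂ f x) = 0 → fderiv ℂ f x = 0 := fun x hx h => by
        by_contra h'
        exact (hJz _).1 h (step x hx h')
      obtain ⟨r, hr, hrU⟩ := Metric.isOpen_iff.1 hU a ha
      have hJd : DifferentiableOn ℂ (fun x => J (fderiv ℂ f x)) (ball a r) :=
        hJ.comp_differentiableOn ((differentiableOn_fderiv_of_isOpen hU hf).mono hrU)
      have hJa : J (fderiv ℂ f a) = 0 := by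
        rw [hJz, hne]
        intro h
        obtain ⟨v, hv⟩ := exists_ne (0 : E)
        exact hv (h (by simp))
      by_cases hall : ∃ x ∈ ball a r, J (fderiv ℂ f x) ≠ 0
      · obtain ⟨g, hg, hgz, x₀, hx₀, hJx, hgx⟩ := exists_regular_zero hJd hJa hall
        have hev := eventually_eq_zero_of_zeros_subset isOpen_ball hJd hg hx₀ hJx hgz hgx
        obtain ⟨ψ, V, hV, h0V, hψ, hψ0, hψ', hψh, hψi⟩ :=
          exists_parametrization_of_hypersurface isOpen_ball hg hx₀ (hgz _ hx₀ hJx) hgx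
        have hdE : Module.finrank ℂ (fderiv ℂ g x₀ : E →ₗ[ℂ] ℂ).ker = n := by
          have := Module.Dual.finrank_ker_add_one_of_ne_zero (f := (fderiv ℂ g x₀ : E →ₗ[ℂ] ℂ))
            (fun h => hgx (by ext v; exact congrArg (fun T => T v) h))
          omega
        have : Nontrivial (fderiv ℂ g x₀ : E →ₗ[ℂ] ℂ).ker :=
          Module.nontrivial_of_finrank_pos (R := ℂ) (by omega)
        set V' := V ∩ ψ ⁻¹' U with hV'
        have hV'o : IsOpen V' := hψ.continuousOn.isOpen_inter_preimage hV hU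
        have h0V' : (0 : (fderiv ℂ g x₀ : E →ₗ[ℂ] ℂ).ker) ∈ V' :=
          ⟨h0V, by rw [mem_preimage, hψ0]; exact hrU hx₀⟩
        refine not_eventually_fderiv_eq_zero_of_injOn (f := fun y => f (ψ y)) (hV'o.mem_nhds h0V')
          (hf.comp (hψ.mono inter_subset_left) fun y hy => hy.2)
          (fun y hy z hz hyz => hψi hy.1 hz.1 (hinj hy.2 hz.2 hyz)) ?_
        have hct : ContinuousAt ψ 0 := hψ'.continuousAt
        rw [ContinuousAt, hψ0] at hct
        filter_upwards [hct.eventually hev, hV'o.mem_nhds h0V'] with y hy1 hy2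
        have hfd := hJz' _ hy2.2 (hy1 (hψh y hy2.1))
        have hda : HasFDerivAt f (fderiv ℂ f (ψ y)) (ψ y) :=
          (hf.differentiableAt (hU.mem_nhds hy2.2)).hasFDerivAt
        rw [hfd] at hda
        have h1 := hda.comp y (hψ.differentiableAt (hV.mem_nhds hy2.1)).hasFDerivAt
        rw [ContinuousLinearMap.zero_comp] at h1
        exact h1.fderiv
      · push Not at hall
        refine not_eventually_fderiv_eq_zero_of_injOn (hU.mem_nhds ha) hf hinj ?_
        filter_upwards [ball_mem_nhds a hr] with x hx
        exact hJz' x (hrU hx) (hall x hx)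

/-- The derivative of an injective holomorphic map between spaces of equal dimension is injective.
-/
theorem injective_fderiv_of_injOn (hEF : Module.finrank ℂ E = Module.finrank ℂ F) {U : Set E}
    {f : E → F} (hU : IsOpen U) (hf : DifferentiableOn ℂ f U) (hinj : InjOn f U) {a : E}
    (ha : a ∈ U) : Function.Injective (fderiv ℂ f a) :=
  injective_fderiv_of_injOn_aux _ hEF rfl hU hf hinj a ha

/-- The inverse of an injective holomorphic map is holomorphic on the image, which is open. -/
theorem exists_holomorphic_inverse (hEF : Module.finrank ℂ E = Module.finrank ℂ F) {U : Set E}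
    {f : E → F} (hU : IsOpen U) (hf : DifferentiableOn ℂ f U) (hinj : InjOn f U) :
    IsOpen (f '' U) ∧ ∃ g : F → E, DifferentiableOn ℂ g (f '' U) ∧ ∀ x ∈ U, g (f x) = x := by
  have hstrict : ∀ x ∈ U, ∃ e : E ≃L[ℂ] F, HasStrictFDerivAt f (e : E →L[ℂ] F) x := by
    intro x hx
    have hi := injective_fderiv_of_injOn hEF hU hf hinj hx
    let e := (LinearEquiv.ofInjectiveOfFinrankEq (fderiv ℂ f x : E →ₗ[ℂ] F) hi
        hEF).toContinuousLinearEquiv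
    refine ⟨e, ?_⟩
    have : (e : E →L[ℂ] F) = fderiv ℂ f x := by ext v; rfl
    rw [this]
    exact (contDiffAt_of_differentiableOn hU hf hx).hasStrictFDerivAt one_ne_zero
  have hopen : IsOpen (f '' U) := by
    rw [isOpen_iff_mem_nhds]
    rintro _ ⟨x, hx, rfl⟩
    obtain ⟨e, he⟩ := hstrict x hx
    rw [← he.map_nhds_eq_of_equiv]
    exact image_mem_map (hU.mem_nhds hx)
  refine ⟨hopen, Function.invFunOn f U, ?_, fun x hx => hinj.leftInvOn_invFunOn hx⟩
  rintro _ ⟨x, hx, rfl⟩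
  obtain ⟨e, he⟩ := hstrict x hx
  have h1 : ∀ᶠ z in 𝓝 x, Function.invFunOn f U (f z) = z := by
    filter_upwards [hU.mem_nhds hx] with z hz using hinj.leftInvOn_invFunOn hz
  exact (he.to_local_left_inverse h1).hasFDerivAt.differentiableAt.differentiableWithinAt

end Osgood

section BallAutomorphism

variable {H : Type*} [NormedAddCommGroup H] [InnerProductSpace ℂ H]

/-- The automorphism of the unit ball of a complex inner product space sending `0` to `a`. -/
def ballAut (a z : H) : H :=
  (1 + inner ℂ a z)⁻¹ • ((1 + inner ℂ a z * ((1 + √(1 - ‖a‖ ^ 2))⁻¹ : ℝ)) • a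
    + ((√(1 - ‖a‖ ^ 2) : ℝ) : ℂ) • z)

theorem ballAut_zero (a : H) : ballAut a 0 = a := by simp [ballAut]

theorem one_add_inner_ne_zero {a z : H} (ha : ‖a‖ < 1) (hz : ‖z‖ < 1) :
    (1 : ℂ) + inner ℂ a z ≠ 0 := by
  intro h
  have h1 : ‖inner ℂ a z‖ ≤ ‖a‖ * ‖z‖ := norm_inner_le_norm a z
  have h2 : inner ℂ a z = -1 := by linear_combination h
  rw [h2, norm_neg, norm_one] at h1
  nlinarith [norm_nonneg a, norm_nonneg z]

theorem differentiableOn_ballAut {a : H} (ha : ‖a‖ < 1) :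
    DifferentiableOn ℂ (ballAut a) (ball 0 1) := by
  intro z hz
  have h0 := one_add_inner_ne_zero ha (mem_ball_zero_iff.1 hz)
  have hi : DifferentiableAt ℂ (fun z : H => (inner ℂ a z : ℂ)) z :=
    (innerSL ℂ a).differentiableAt
  refine DifferentiableAt.differentiableWithinAt ?_
  unfold ballAut
  refine ((hi.const_add 1).inv h0).smul ?_
  exact ((hi.mul_const _).const_add 1).smul_const a |>.add (differentiableAt_id.const_smul _)

theorem norm_ballAut_lt_one {a z : H} (ha : ‖a‖ < 1) (hz : ‖z‖ < 1) : ‖ballAut a z‖ < 1 := by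
  have h0 := one_add_inner_ne_zero ha hz
  unfold ballAut
  set s := √(1 - ‖a‖ ^ 2) with hs
  have hs2 : s ^ 2 = 1 - ‖a‖ ^ 2 := Real.sq_sqrt (by nlinarith [norm_nonneg a])
  have hs0 : 0 < s := Real.sqrt_pos.2 (by nlinarith [norm_nonneg a])
  set t := (1 + s)⁻¹ with ht
  set α : ℂ := inner ℂ a z with hα
  have key : ‖(1 + α * (t : ℂ)) • a + (s : ℂ) • z‖ ^ 2 = ‖1 + α‖ ^ 2 - s ^ 2 * (1 - ‖z‖ ^ 2) := by
    rw [@norm_add_sq ℂ, norm_smul, norm_smul, inner_smul_left, inner_smul_right, ← hα, mul_pow,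
        mul_pow]
    have e1 : ‖(1 + α * (t : ℂ))‖ ^ 2 = (1 + α.re * t) ^ 2 + (α.im * t) ^ 2 := by
      rw [← Complex.normSq_eq_norm_sq, Complex.normSq_apply]; simp; ring
    have e2 : ‖1 + α‖ ^ 2 = (1 + α.re) ^ 2 + α.im ^ 2 := by
      rw [← Complex.normSq_eq_norm_sq, Complex.normSq_apply]; simp; ring
    have e3 : RCLike.re ((starRingEnd ℂ) (1 + α * (t : ℂ)) * ((s : ℂ) * α))
        = s * (α.re + (α.re ^ 2 + α.im ^ 2) * t) := by
      simp
      ring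
    have e4 : ‖(s : ℂ)‖ ^ 2 = s ^ 2 := by simp
    rw [e1, e2, e3, e4]
    have : ‖a‖ ^ 2 = 1 - s ^ 2 := by linarith
    rw [this, ht]
    field_simp
    ring
  have hlt : ‖(1 + α * (t : ℂ)) • a + (s : ℂ) • z‖ ^ 2 < ‖1 + α‖ ^ 2 := by
    rw [key]
    have : 0 < s ^ 2 * (1 - ‖z‖ ^ 2) := mul_pos (by positivity) (by nlinarith [norm_nonneg z])
    linarith
  have hlt' := lt_of_pow_lt_pow_left₀ 2 (norm_nonneg _) hlt
  have hp : 0 < ‖1 + α‖ := norm_pos_iff.2 h0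
  rw [norm_smul, norm_inv, inv_mul_lt_iff₀ hp, mul_one]
  exact hlt'

theorem ballAut_ballAut_neg {a z : H} (ha : ‖a‖ < 1) (hz : ‖z‖ < 1) :
    ballAut a (ballAut (-a) z) = z := by
  have hw0 : ballAut (-a) z = (1 - inner ℂ a z : ℂ)⁻¹ •
      ((-1 + inner ℂ a z * ((1 + √(1 - ‖a‖ ^ 2))⁻¹ : ℝ)) • a + ((√(1 - ‖a‖ ^ 2) : ℝ) : ℂ) • z) := by
    unfold ballAut
    rw [inner_neg_left, norm_neg, ← sub_eq_add_neg]
    congr 2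
    rw [smul_neg, ← neg_smul]
    congr 1
    ring
  have hb : ∀ w : H, ballAut a w = (1 + inner ℂ a w : ℂ)⁻¹ •
      ((1 + inner ℂ a w * ((1 + √(1 - ‖a‖ ^ 2))⁻¹ : ℝ)) • a + ((√(1 - ‖a‖ ^ 2) : ℝ) : ℂ) • w) :=
    fun w => rfl
  set s := √(1 - ‖a‖ ^ 2) with hs
  have hs2 : s ^ 2 = 1 - ‖a‖ ^ 2 := Real.sq_sqrt (by nlinarith [norm_nonneg a])
  have hs0 : 0 < s := Real.sqrt_pos.2 (by nlinarith [norm_nonneg a])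
  have hts : ((1 + s)⁻¹ : ℝ) * (1 + s) = 1 := by field_simp
  set t := (1 + s)⁻¹ with ht
  have hts' : (t : ℂ) * (1 + s) = 1 := by exact_mod_cast hts
  set α : ℂ := inner ℂ a z with hα
  have h0 : (1 : ℂ) - α ≠ 0 := by
    have := one_add_inner_ne_zero (a := -a) (by rwa [norm_neg]) hz
    rwa [inner_neg_left, ← sub_eq_add_neg] at this
  have hsc : (s : ℂ) ≠ 0 := by exact_mod_cast hs0.ne'
  have haa : (inner ℂ a a : ℂ) = 1 - (s : ℂ) ^ 2 := by
    rw [inner_self_eq_norm_sq_to_K]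
    have h : ‖a‖ ^ 2 = 1 - s ^ 2 := by linarith
    have h' := congrArg (fun x : ℝ => (x : ℂ)) h
    push_cast at h'
    exact h'
  set w := ballAut (-a) z with hwdef
  have hwi : (inner ℂ a w : ℂ) = (1 - α)⁻¹ * (α - (1 - (s : ℂ) ^ 2)) := by
    rw [hw0, inner_smul_right, inner_add_right, inner_smul_right, inner_smul_right, haa, ← hα]
    congr 1
    linear_combination α * (1 - (s : ℂ)) * hts'
  have h1 : 1 + (inner ℂ a w : ℂ) = (1 - α)⁻¹ * (s : ℂ) ^ 2 := by
    rw [hwi]; field_simp; ring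
  rw [hb, h1, inv_smul_eq_iff₀ (mul_ne_zero (inv_ne_zero h0) (pow_ne_zero 2 hsc)), hwi, hw0]
  have e : (1 + (1 - α)⁻¹ * (α - (1 - (s : ℂ) ^ 2)) * t) + s * ((1 - α)⁻¹ * (-1 + α * t)) = 0 := by
    field_simp
    linear_combination (α - 1 + (s : ℂ)) * hts'
  calc _ = ((1 + (1 - α)⁻¹ * (α - (1 - (s : ℂ) ^ 2)) * t) + s * ((1 - α)⁻¹ * (-1 + α * t))) • a
        + ((1 - α)⁻¹ * (s : ℂ) ^ 2) • z := by module
    _ = _ := by rw [e, zero_smul, zero_add]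

theorem norm_fderiv_ballAut_zero_le {a : H} (ha : ‖a‖ < 1) (w : H) :
    ‖fderiv ℂ (ballAut a) 0 w‖ ≤ 2 * √(1 - ‖a‖ ^ 2) * ‖w‖ := by
  have hb : ∀ w : H, ballAut a w = (1 + inner ℂ a w : ℂ)⁻¹ •
      ((1 + inner ℂ a w * ((1 + √(1 - ‖a‖ ^ 2))⁻¹ : ℝ)) • a + ((√(1 - ‖a‖ ^ 2) : ℝ) : ℂ) • w) :=
    fun w => rfl
  set s := √(1 - ‖a‖ ^ 2) with hs
  have hs2 : s ^ 2 = 1 - ‖a‖ ^ 2 := Real.sq_sqrt (by nlinarith [norm_nonneg a])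
  have hs0 : 0 < s := Real.sqrt_pos.2 (by nlinarith [norm_nonneg a])
  have hts : ((1 + s)⁻¹ : ℝ) * (1 + s) = 1 := by field_simp
  set t := (1 + s)⁻¹ with ht
  have ht0 : 0 < t := by positivity
  have hd : HasFDerivAt (ballAut a) (fderiv ℂ (ballAut a) 0) ((0 : ℂ) • w) := by
    rw [zero_smul]
    exact ((differentiableOn_ballAut ha).differentiableAt (ball_mem_nhds _ one_pos)).hasFDerivAt
  have h1 : HasDerivAt (fun ζ : ℂ => ζ • w) ((1 : ℂ) • w) 0 := (hasDerivAt_id (0 : ℂ)).smul_const w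
  have h2 := (hd.comp_hasDerivAt 0 h1).deriv
  rw [one_smul] at h2
  rw [← h2]
  set β : ℂ := inner ℂ a w with hβ
  have hfun : (ballAut a ∘ fun ζ : ℂ => ζ • w) = fun ζ : ℂ =>
      (1 + ζ * β)⁻¹ • ((1 + ζ * β * (t : ℂ)) • a + ((s : ℂ) * ζ) • w) := by
    ext1 ζ
    simp only [Function.comp, hb, inner_smul_right, ← hβ, smul_smul]
  have hlin : ∀ c : ℂ, HasDerivAt (fun ζ : ℂ => 1 + ζ * c) c 0 := fun c => by
    simpa using ((hasDerivAt_id (0 : ℂ)).mul_const c).const_add 1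
  have h3 : HasDerivAt (fun ζ : ℂ => (1 + ζ * β)⁻¹) (-β) 0 := by
    simpa using (hlin β).fun_inv (by simp)
  have h4 : HasDerivAt (fun ζ : ℂ => (1 + ζ * β * (t : ℂ)) • a + ((s : ℂ) * ζ) • w)
      ((β * t) • a + (s : ℂ) • w) 0 := by
    have h5 := (hlin (β * t)).smul_const a
    have h6 : HasDerivAt (fun ζ : ℂ => (s : ℂ) * ζ) (s : ℂ) 0 := by
      simpa using (hasDerivAt_id (0 : ℂ)).const_mul (s : ℂ)
    simpa only [mul_assoc] using h5.fun_add (h6.smul_const w)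
  have h7 := (h3.fun_smul h4).deriv
  rw [hfun, h7]
  have e : (1 + 0 * β)⁻¹ • ((β * t) • a + (s : ℂ) • w) + (-β) •
      ((1 + 0 * β * (t : ℂ)) • a + ((s : ℂ) * 0) • w)
      = (s : ℂ) • w - (β * ((s * t : ℝ) : ℂ)) • a := by
    have hts' : (t : ℂ) * (1 + s) = 1 := by exact_mod_cast hts
    have : β * t - β = - (β * ((s * t : ℝ) : ℂ)) := by push_cast; linear_combination β * hts'
    rw [sub_eq_add_neg ((s : ℂ) • w), ← neg_smul, ← this]
    simp
    module
  rw [e]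
  have hβn : ‖β‖ ≤ ‖a‖ * ‖w‖ := norm_inner_le_norm a w
  have ht1 : t ≤ 1 := by nlinarith
  calc _ ≤ ‖(s : ℂ) • w‖ + ‖(β * ((s * t : ℝ) : ℂ)) • a‖ := norm_sub_le _ _
    _ = s * ‖w‖ + ‖β‖ * (s * t) * ‖a‖ := by
        rw [norm_smul, norm_smul, norm_mul, Complex.norm_real, Complex.norm_real,
          Real.norm_of_nonneg hs0.le, Real.norm_of_nonneg (by positivity)]
    _ ≤ s * ‖w‖ + (1 * ‖w‖) * (s * 1) * 1 := by gcongr; exact hβn.trans (by gcongr)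
    _ = _ := by ring

end BallAutomorphism

section SchwarzPick

variable {H : Type*} [NormedAddCommGroup H] [InnerProductSpace ℂ H]

/-- Schwarz–Pick estimate for discs in the unit ball. -/
theorem norm_deriv_le_of_mapsTo_unit_ball {φ : ℂ → H} {r : ℝ} (hr : 0 < r)
    (hd : DifferentiableOn ℂ φ (ball 0 r)) (hm : MapsTo φ (ball 0 r) (ball 0 1)) :
    ‖deriv φ 0‖ ≤ 2 * √(1 - ‖φ 0‖ ^ 2) / r := by
  set a := φ 0 with ha'
  have h0r : (0 : ℂ) ∈ ball (0 : ℂ) r := mem_ball_self hr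
  have ha : ‖a‖ < 1 := mem_ball_zero_iff.1 (hm h0r)
  have ha2 : ‖-a‖ < 1 := by rwa [norm_neg]
  set χ : ℂ → H := fun z => ballAut (-a) (φ z) with hχ
  have hχd : DifferentiableOn ℂ χ (ball 0 r) := (differentiableOn_ballAut ha2).comp hd hm
  have haut : ballAut a (ballAut (-a) a) = a := ballAut_ballAut_neg ha ha
  have hχ0 : χ 0 = 0 := by
    have h1 := ballAut_ballAut_neg ha2 (norm_zero (E := H) ▸ zero_lt_one)
    rw [neg_neg, ballAut_zero] at h1
    exact h1
  have hχm : MapsTo χ (ball 0 r) (closedBall (χ 0) 1) := by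
    intro z hz
    rw [hχ0, mem_closedBall_zero_iff]
    exact (norm_ballAut_lt_one ha2 (mem_ball_zero_iff.1 (hm hz))).le
  have hχ' := Complex.norm_deriv_le_div_of_mapsTo_ball hχd hχm hr
  have hφ : φ =ᶠ[𝓝 0] ballAut a ∘ χ := by
    filter_upwards [ball_mem_nhds (0 : ℂ) hr] with z hz
    exact (ballAut_ballAut_neg ha (mem_ball_zero_iff.1 (hm hz))).symm
  have hda : HasFDerivAt (ballAut a) (fderiv ℂ (ballAut a) 0) (χ 0) := by
    rw [hχ0]
    exact ((differentiableOn_ballAut ha).differentiableAt (ball_mem_nhds _ one_pos)).hasFDerivAt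
  have hdχ : HasDerivAt χ (deriv χ 0) 0 := (hχd.differentiableAt (ball_mem_nhds _ hr)).hasDerivAt
  rw [hφ.deriv_eq, (hda.comp_hasDerivAt 0 hdχ).deriv]
  calc _ ≤ 2 * √(1 - ‖a‖ ^ 2) * ‖deriv χ 0‖ := norm_fderiv_ballAut_zero_le ha _
    _ ≤ 2 * √(1 - ‖a‖ ^ 2) * (1 / r) := by gcongr
    _ = _ := by ring

/-- Harnack-type lower bound for holomorphic functions with positive real part. -/
theorem one_sub_norm_sq_le_of_re_pos {F : H → ℂ} (hd : DifferentiableOn ℂ F (ball 0 1))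
    (hre : ∀ z ∈ ball (0 : H) 1, 0 < (F z).re) (h0 : F 0 = 1) {z : H} (hz : ‖z‖ < 1) :
    1 - ‖z‖ ^ 2 ≤ 4 * (F z).re := by
  have hne : ∀ z ∈ ball (0 : H) 1, F z + 1 ≠ 0 := by
    intro z hz h
    have := congrArg Complex.re h
    simp at this
    linarith [hre z hz]
  have hc : DifferentiableOn ℂ (fun z => (F z - 1) / (F z + 1)) (ball 0 1) := by
    simp only [div_eq_mul_inv]
    exact (hd.sub_const 1).mul ((hd.add_const 1).inv hne)
  have hsq : ∀ w : ℂ, ‖w - 1‖ ^ 2 = (w.re - 1) ^ 2 + w.im ^ 2 ∧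
      ‖w + 1‖ ^ 2 = (w.re + 1) ^ 2 + w.im ^ 2 := by
    intro w
    constructor <;> rw [← Complex.normSq_eq_norm_sq, Complex.normSq_apply] <;> simp <;> ring
  have hm : MapsTo (fun z => (F z - 1) / (F z + 1)) (ball 0 1) (closedBall 0 1) := by
    intro z hz
    rw [mem_closedBall_zero_iff, norm_div, div_le_one (norm_pos_iff.2 (hne z hz))]
    refine le_of_sq_le_sq ?_ (norm_nonneg _)
    rw [(hsq _).1, (hsq _).2]
    nlinarith [hre z hz]
  have h := Complex.norm_le_norm_of_mapsTo_ball hc hm (by simp [h0]) hz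
  have hzb : z ∈ ball (0 : H) 1 := mem_ball_zero_iff.2 hz
  rw [norm_div, div_le_iff₀ (norm_pos_iff.2 (hne z hzb))] at h
  have h2 : ‖F z - 1‖ ^ 2 ≤ ‖z‖ ^ 2 * ‖F z + 1‖ ^ 2 := by
    rw [← mul_pow]; gcongr
  rw [(hsq _).1, (hsq _).2] at h2
  have hx := hre z hzb
  have ht : ‖z‖ ^ 2 ≤ 1 := by nlinarith [norm_nonneg z]
  nlinarith [mul_nonneg (sub_nonneg.2 ht) (add_nonneg (sq_nonneg (F z).re) (sq_nonneg (F z).im)),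
      mul_nonneg (sub_nonneg.2 ht) hx.le]

theorem norm_deriv_le_two_mul_re {h : ℂ → ℂ} (hd : DifferentiableOn ℂ h (ball 0 1))
    (hre : ∀ z ∈ ball (0 : ℂ) 1, 0 < (h z).re) : ‖deriv h 0‖ ≤ 2 * (h 0).re := by
  have h0m : (0 : ℂ) ∈ ball (0 : ℂ) 1 := mem_ball_self one_pos
  set c : ℂ := (starRingEnd ℂ) (h 0) with hc
  have hcre : c.re = (h 0).re := by simp [hc]
  have hne : ∀ z ∈ ball (0 : ℂ) 1, h z + c ≠ 0 := by
    intro z hz h'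
    have := congrArg Complex.re h'
    simp [hcre] at this
    linarith [hre z hz, hre 0 h0m]
  have hc' : DifferentiableOn ℂ (fun z => (h z - h 0) / (h z + c)) (ball 0 1) :=
    (hd.sub_const _).div (hd.add_const _) hne
  have hm : MapsTo (fun z => (h z - h 0) / (h z + c)) (ball 0 1)
      (closedBall ((h 0 - h 0) / (h 0 + c)) 1) := by
    intro z hz
    rw [sub_self, zero_div, mem_closedBall_zero_iff, norm_div,
      div_le_one (norm_pos_iff.2 (hne z hz))]
    refine le_of_sq_le_sq ?_ (norm_nonneg _)
    rw [← Complex.normSq_eq_norm_sq, ← Complex.normSq_eq_norm_sq, Complex.normSq_apply,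
        Complex.normSq_apply]
    simp [hc]
    nlinarith [mul_pos (hre z hz) (hre 0 h0m)]
  have h1 := Complex.norm_deriv_le_div_of_mapsTo_ball hc' hm one_pos
  have hd0 : HasDerivAt h (deriv h 0) 0 := (hd.differentiableAt
      (ball_mem_nhds _ one_pos)).hasDerivAt
  have h2 := ((hd0.sub_const (h 0)).fun_div (hd0.add_const c) (hne 0 h0m)).deriv
  rw [h2] at h1
  have hpos := hre 0 h0m
  have hsum : h 0 + c = ((2 * (h 0).re : ℝ) : ℂ) := by rw [hc, Complex.add_conj]
  rw [sub_self, zero_mul, sub_zero, hsum, norm_div, norm_mul, norm_pow, Complex.norm_real,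
    Real.norm_of_nonneg (by positivity), div_one, div_le_one (by positivity), sq] at h1
  exact le_of_mul_le_mul_right h1 (by positivity)

/-- A two-constants estimate on a truncated disc tangent to the imaginary axis near its left end. -/
theorem not_forall_norm_le_rpow_of_le_norm {V : ℂ → H} {ε : ℝ} (hε : ε = (1 / 2) ^ 174)
    (hd : ∀ ω : ℂ, ε ≤ ω.re → ‖ω - 1‖ ≤ 2 → DifferentiableAt ℂ V ω)
    (hb : ∀ ω : ℂ, ε ≤ ω.re → ‖ω - 1‖ ≤ 2 → ‖V ω‖ ≤ 64 * ω.re ^ (1 / 6 : ℝ)) :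
    ‖V 1‖ < 1 / 4 := by
  by_contra! hlow
  have hε0 : 0 < ε := by rw [hε]; positivity
  have hε1 : ε < 1 := by rw [hε]; norm_num
  set M : ℝ := 4 * Real.log 1024 with hM
  have hM0 : 0 ≤ M := by have := Real.log_nonneg (by norm_num : (1 : ℝ) ≤ 1024); positivity
  set W : Set ℂ := {ω | ε < ω.re} ∩ ball 1 2 with hW
  have hcl : closure W ⊆ {ω | ε ≤ ω.re} ∩ closedBall 1 2 :=
    closure_minimal (inter_subset_inter (fun ω (h : ε < ω.re) => show ε ≤ ω.re from h.le)
        ball_subset_closedBall)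
      ((isClosed_le continuous_const Complex.continuous_re).inter isClosed_closedBall)
  have hWo : IsOpen W := (isOpen_lt continuous_const Complex.continuous_re).inter isOpen_ball
  have hne : ∀ ω : ℂ, ε ≤ ω.re → ω + 1 ≠ 0 := by
    intro ω h h'
    have := congrArg Complex.re h'
    simp at this
    linarith
  have hnorm : ∀ ω : ℂ, ‖Complex.exp (M * (1 / (ω + 1) - 1 / 4))‖ =
      Real.exp (M * ((1 / (ω + 1)).re - 1 / 4)) := by
    intro ω
    rw [Complex.norm_exp]
    congr 1
    have : ((M : ℂ) * (1 / (ω + 1) - 1 / 4)) = (M : ℂ) * ((1 / (ω + 1)) - ((1 / 4 : ℝ) : ℂ)) := by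
      push_cast; ring
    rw [this, Complex.re_ofReal_mul, Complex.sub_re, Complex.ofReal_re]
  have hre : ∀ ω : ℂ, (1 / (ω + 1)).re = (ω.re + 1) / ((ω.re + 1) ^ 2 + ω.im ^ 2) := by
    intro ω
    rw [one_div, Complex.inv_re, Complex.normSq_apply]
    simp
    ring
  have hdist : ∀ ω : ℂ, ‖ω - 1‖ ^ 2 = (ω.re - 1) ^ 2 + ω.im ^ 2 := by
    intro ω
    rw [← Complex.normSq_eq_norm_sq, Complex.normSq_apply]; simp; ring
  have hbd := Complex.norm_le_of_forall_mem_frontier_norm_le (U := W)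
    (isBounded_ball.subset inter_subset_right)
    (f := fun ω => Complex.exp (M * (1 / (ω + 1) - 1 / 4)) • V ω) (C := 128)
    (by
      refine DifferentiableOn.diffContOnCl fun ω hω => ?_
      obtain ⟨h1, h2⟩ := hcl hω
      rw [mem_closedBall, dist_eq_norm] at h2
      refine DifferentiableAt.differentiableWithinAt ?_
      refine DifferentiableAt.smul ?_ (hd ω h1 h2)
      have := hne ω h1
      refine DifferentiableAt.cexp ?_
      refine DifferentiableAt.const_mul (DifferentiableAt.sub_const ?_ _) _
      exact (differentiableAt_const _).div (differentiableAt_id.add_const 1) this)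
    (by
      intro ω hω
      obtain ⟨h1, h2⟩ := hcl (frontier_subset_closure hω)
      rw [mem_closedBall, dist_eq_norm] at h2
      have h1 : ε ≤ ω.re := h1
      have hω' : ω ∉ W := by
        rw [hWo.frontier_eq] at hω
        exact hω.2
      have hx0 : 0 < ω.re := lt_of_lt_of_le hε0 h1
      rw [norm_smul, hnorm]
      by_cases hc : ε < ω.re
      · have h3 : ‖ω - 1‖ = 2 := by
          refine le_antisymm h2 (not_lt.1 fun h => hω' ⟨hc, ?_⟩)
          rwa [mem_ball, dist_eq_norm]
        have h4 := hdist ω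
        rw [h3] at h4
        have h5 : (1 / (ω + 1)).re = 1 / 4 := by
          rw [hre, div_eq_iff (by positivity)]
          linarith
        have h6 : ω.re ≤ 3 := by nlinarith [sq_nonneg ω.im]
        have h7 : ω.re ^ (1 / 6 : ℝ) ≤ 2 := by
          calc ω.re ^ (1 / 6 : ℝ) ≤ (2 ^ (6 : ℝ)) ^ (1 / 6 : ℝ) := by
                gcongr
                norm_num
                linarith
            _ = 2 := by rw [← Real.rpow_mul (by norm_num)]; norm_num
        rw [h5, sub_self, mul_zero, Real.exp_zero, one_mul]
        linarith [hb ω h1 h2]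
      · have h3 : ω.re = ε := le_antisymm (not_lt.1 hc) h1
        have h4 : ω.re ^ (1 / 6 : ℝ) = (1 / 2) ^ 29 := by
          rw [h3, hε, show (174 : ℕ) = 29 * 6 by norm_num, pow_mul, ← Real.rpow_natCast,
            ← Real.rpow_mul (by positivity)]
          norm_num
        have h5 : (1 / (ω + 1)).re ≤ 1 := by
          rw [hre, div_le_one (by positivity)]
          nlinarith [sq_nonneg ω.im]
        have h6 : Real.exp (M * ((1 / (ω + 1)).re - 1 / 4)) ≤ 2 ^ 30 := by
          calc Real.exp (M * ((1 / (ω + 1)).re - 1 / 4)) ≤ Real.exp (M * (3 / 4)) := by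
                gcongr; linarith
            _ = Real.exp (Real.log 1024) ^ 3 := by
                rw [← Real.exp_nat_mul]; congr 1; rw [hM]; push_cast; ring
            _ = 2 ^ 30 := by rw [Real.exp_log (by norm_num)]; norm_num
        have h7 := hb ω h1 h2
        rw [h4] at h7
        calc _ ≤ (2 : ℝ) ^ 30 * (64 * (1 / 2) ^ 29) := by gcongr
          _ = 128 := by norm_num)
    (z := 1) (subset_closure ⟨by simpa using hε1, mem_ball_self two_pos⟩)
  rw [norm_smul, hnorm, hre] at hbd
  have h8 : Real.exp (M * ((((1 : ℂ).re + 1) / (((1 : ℂ).re + 1) ^ 2 + (1 : ℂ).im ^ 2)) - 1 / 4)) =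
      1024 := by
    rw [← Real.exp_log (by norm_num : (0 : ℝ) < 1024)]
    congr 1
    rw [hM]; simp
    ring
  rw [h8] at hbd
  linarith

end SchwarzPick

section Core

variable {H X : Type} [NormedAddCommGroup H] [InnerProductSpace ℂ H] [CompleteSpace H]
  [NormedAddCommGroup X] [NormedSpace ℂ X]

theorem false_of_ball_image_contains_window_of_center {D : Set X} {f : H → X} {g : X → H}
    (hf : DifferentiableOn ℂ f (ball 0 1)) (hfD : MapsTo f (ball 0 1) D)
    (hgo : IsOpen (f '' ball 0 1)) (hg : DifferentiableOn ℂ g (f '' ball 0 1))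
    (hgf : ∀ x ∈ ball (0 : H) 1, g (f x) = x) {q a b : X} {ε : ℝ} (hε : ε = (1 / 2) ^ 174)
    {l : X → ℂ} (hl : Differentiable ℂ l) (hlD : ∀ z ∈ D, 0 < (l z).re)
    (hlQ : ∀ ω : ℂ, l (q + ω • a) = ω) (m : X →L[ℂ] ℂ) {s : ℂ} (hs : ‖s‖ ≤ 2)
    (hm : ∀ z ∈ D, (m z).re < (m (q + a + s • b)).re)
    (hR : ∀ ω : ℂ, ε ≤ ω.re → ‖ω - 1‖ ≤ 2 → ∀ μ : ℂ, ‖μ‖ ≤ 1 / 16 * ω.re ^ (1 / 3 : ℝ) →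
      q + ω • a + μ • b ∈ f '' ball 0 1) (hcen : f 0 = q + a) : False := by
  have hε0 : 0 < ε := by rw [hε]; positivity
  have hε1 : ε < 1 := by rw [hε]; norm_num
  have h0m : (0 : H) ∈ ball (0 : H) 1 := mem_ball_self one_pos
  have hfg : ∀ y ∈ f '' ball 0 1, f (g y) = y := by
    rintro _ ⟨x, hx, rfl⟩; rw [hgf x hx]
  have hgm : ∀ y ∈ f '' ball 0 1, g y ∈ ball (0 : H) 1 := by
    rintro _ ⟨x, hx, rfl⟩; rwa [hgf x hx]
  have hQ : ∀ ω : ℂ, ε ≤ ω.re → ‖ω - 1‖ ≤ 2 → q + ω • a ∈ f '' ball 0 1 := by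
    intro ω h1 h2
    have hx : 0 < ω.re := lt_of_lt_of_le hε0 h1
    simpa using hR ω h1 h2 0 (by rw [norm_zero]; positivity)
  set V : ℂ → H := fun ω => fderiv ℂ g (q + ω • a) b with hV
  have hVd : ∀ ω : ℂ, ε ≤ ω.re → ‖ω - 1‖ ≤ 2 → DifferentiableAt ℂ V ω := by
    intro ω h1 h2
    have h3 : DifferentiableAt ℂ (fun y => fderiv ℂ g y b) (q + ω • a) :=
      (differentiableOn_fderiv_apply hgo hg b).differentiableAt (hgo.mem_nhds (hQ ω h1 h2))
    exact h3.comp (f := fun ω : ℂ => q + ω • a) ω (by fun_prop)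
  have hlF : DifferentiableOn ℂ (fun x => l (f x)) (ball 0 1) := hl.comp_differentiableOn hf
  have hVb : ∀ ω : ℂ, ε ≤ ω.re → ‖ω - 1‖ ≤ 2 → ‖V ω‖ ≤ 64 * ω.re ^ (1 / 6 : ℝ) := by
    intro ω h1 h2
    have hx : 0 < ω.re := lt_of_lt_of_le hε0 h1
    set r := 1 / 16 * ω.re ^ (1 / 3 : ℝ) with hr
    have hr0 : 0 < r := by positivity
    have hmemr : ∀ μ ∈ ball (0 : ℂ) r, q + ω • a + μ • b ∈ f '' ball 0 1 := fun μ hμ =>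
      hR ω h1 h2 μ (mem_ball_zero_iff.1 hμ).le
    have hd1 : DifferentiableOn ℂ (fun μ : ℂ => g (q + ω • a + μ • b)) (ball 0 r) :=
      hg.comp (by fun_prop) hmemr
    have hsp := norm_deriv_le_of_mapsTo_unit_ball hr0 hd1 fun μ hμ => hgm _ (hmemr μ hμ)
    have hgd : HasFDerivAt g (fderiv ℂ g (q + ω • a)) (q + ω • a + (0 : ℂ) • b) := by
      rw [zero_smul, add_zero]
      exact (hg.differentiableAt (hgo.mem_nhds (hQ ω h1 h2))).hasFDerivAt
    have hlin : HasDerivAt (fun μ : ℂ => q + ω • a + μ • b) ((1 : ℂ) • b) 0 :=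
      ((hasDerivAt_id (0 : ℂ)).smul_const b).const_add _
    have hder : deriv (fun μ : ℂ => g (q + ω • a + μ • b)) 0 = V ω := by
      have := (hgd.comp_hasDerivAt 0 hlin).deriv
      rwa [one_smul] at this
    rw [hder, zero_smul, add_zero] at hsp
    have hz := hgm _ (hQ ω h1 h2)
    have hh := one_sub_norm_sq_le_of_re_pos hlF (fun z hz => hlD _ (hfD hz))
      (by simpa [hcen] using hlQ 1) (mem_ball_zero_iff.1 hz)
    rw [hfg _ (hQ ω h1 h2), hlQ] at hh
    have hsq : √(1 - ‖g (q + ω • a)‖ ^ 2) ≤ 2 * ω.re ^ (1 / 2 : ℝ) := by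
      calc √(1 - ‖g (q + ω • a)‖ ^ 2) ≤ √(2 ^ 2 * ω.re) := Real.sqrt_le_sqrt (by linarith)
        _ = 2 * √ω.re := by rw [Real.sqrt_mul (by positivity), Real.sqrt_sq (by norm_num)]
        _ = _ := by rw [Real.sqrt_eq_rpow]
    calc ‖V ω‖ ≤ 2 * √(1 - ‖g (q + ω • a)‖ ^ 2) / r := hsp
      _ ≤ 2 * (2 * ω.re ^ (1 / 2 : ℝ)) / r := by gcongr
      _ = 64 * (ω.re ^ (1 / 2 : ℝ) / ω.re ^ (1 / 3 : ℝ)) := by rw [hr]; field_simp; norm_num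
      _ = 64 * ω.re ^ (1 / 6 : ℝ) := by rw [← Real.rpow_sub hx]; norm_num
  have hlt := not_forall_norm_le_rpow_of_le_norm hε hVd hVb
  have h1U : q + a ∈ f '' ball 0 1 := by rw [← hcen]; exact mem_image_of_mem f h0m
  have hV1 : V 1 = fderiv ℂ g (q + a) b := by simp [hV]
  have hf0 : HasFDerivAt f (fderiv ℂ f 0) (g (q + a)) := by
    rw [← hcen, hgf 0 h0m]
    exact (hf.differentiableAt (ball_mem_nhds _ one_pos)).hasFDerivAt
  have hgd : HasFDerivAt g (fderiv ℂ g (q + a)) (q + a) :=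
    (hg.differentiableAt (hgo.mem_nhds h1U)).hasFDerivAt
  have hid : fderiv ℂ f 0 (V 1) = b := by
    have h1 : HasFDerivAt (f ∘ g) (ContinuousLinearMap.id ℂ X) (q + a) :=
      (hasFDerivAt_id (q + a)).congr_of_eventuallyEq
        (Filter.eventually_of_mem (hgo.mem_nhds h1U) hfg)
    have h2 := (hf0.comp _ hgd).unique h1
    rw [hV1]
    exact congrArg (fun T => T b) h2
  have hms : 0 < (s * m b).re := by
    have := hm (q + a) (by rw [← hcen]; exact hfD h0m)
    simpa using this
  have hmb : 0 < ‖m b‖ := norm_pos_iff.2 fun h => by simp [h] at hms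
  have hV0 : 0 < ‖V 1‖ := norm_pos_iff.2 fun h => by
    rw [h, map_zero] at hid
    rw [← hid] at hmb
    simp at hmb
  set u : H := ((‖V 1‖⁻¹ : ℝ) : ℂ) • V 1 with hu
  have hun : ‖u‖ = 1 := by
    rw [hu, norm_smul, Complex.norm_real, Real.norm_of_nonneg (by positivity)]
    field_simp
  have hmem : ∀ z ∈ ball (0 : ℂ) 1, z • u ∈ ball (0 : H) 1 := by
    intro z hz
    rw [mem_ball_zero_iff] at hz ⊢
    rwa [norm_smul, hun, mul_one]
  have hh := norm_deriv_le_two_mul_re (h := fun z : ℂ => m (q + a + s • b) - m (f (z • u)))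
    ((differentiableOn_const _).sub (m.differentiable.comp_differentiableOn
      (hf.comp (by fun_prop) hmem)))
    (fun z hz => by
      rw [Complex.sub_re]
      linarith [hm _ (hfD (hmem z hz))])
  have hlin : HasDerivAt (fun z : ℂ => z • u) ((1 : ℂ) • u) 0 :=
    (hasDerivAt_id (0 : ℂ)).smul_const u
  have hf0' : HasFDerivAt f (fderiv ℂ f 0) ((0 : ℂ) • u) := by
    rw [zero_smul]; exact (hf.differentiableAt (ball_mem_nhds _ one_pos)).hasFDerivAt
  have hdd := ((m.hasFDerivAt.comp_hasDerivAt 0 (hf0'.comp_hasDerivAt 0 hlin)).const_sub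
    (m (q + a + s • b))).deriv
  have hdd' : deriv (fun z : ℂ => m (q + a + s • b) - m (f (z • u))) 0
      = - (((‖V 1‖⁻¹ : ℝ) : ℂ) * m b) := by
    refine hdd.trans ?_
    rw [one_smul, hu, map_smul, hid, map_smul, smul_eq_mul]
  rw [hdd', norm_neg, norm_mul, Complex.norm_real, Real.norm_of_nonneg (by positivity), zero_smul,
    hcen] at hh
  have e : m (q + a + s • b) - m (q + a) = s * m b := by
    rw [← map_sub, add_sub_cancel_left, map_smul, smul_eq_mul]
  rw [e] at hh
  have h3 : (s * m b).re ≤ 2 * ‖m b‖ := by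
    calc (s * m b).re ≤ ‖s * m b‖ := Complex.re_le_norm _
      _ = ‖s‖ * ‖m b‖ := norm_mul _ _
      _ ≤ _ := by gcongr
  have h4 : ‖V 1‖⁻¹ * ‖m b‖ ≤ 4 * ‖m b‖ := by linarith
  have h5 := le_of_mul_le_mul_right h4 hmb
  have h6 : 4 < ‖V 1‖⁻¹ := by
    rw [lt_inv_comm₀ (by norm_num) hV0]
    norm_num at hlt ⊢
    exact hlt
  linarith

/-- A biholomorphic image of a ball inside `D` cannot contain a window that narrows too slowly
towards the boundary of `D`. -/
theorem false_of_ball_image_contains_window {D : Set X} {f : H → X} {g : X → H}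
    (hf : DifferentiableOn ℂ f (ball 0 1)) (hfD : MapsTo f (ball 0 1) D)
    (hgo : IsOpen (f '' ball 0 1)) (hg : DifferentiableOn ℂ g (f '' ball 0 1))
    (hgf : ∀ x ∈ ball (0 : H) 1, g (f x) = x) {q a b : X} {ε : ℝ} (hε : ε = (1 / 2) ^ 174)
    {l : X → ℂ} (hl : Differentiable ℂ l) (hlD : ∀ z ∈ D, 0 < (l z).re)
    (hlQ : ∀ ω : ℂ, l (q + ω • a) = ω) (m : X →L[ℂ] ℂ) {s : ℂ} (hs : ‖s‖ ≤ 2)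
    (hm : ∀ z ∈ D, (m z).re < (m (q + a + s • b)).re)
    (hR : ∀ ω : ℂ, ε ≤ ω.re → ‖ω - 1‖ ≤ 2 → ∀ μ : ℂ, ‖μ‖ ≤ 1 / 16 * ω.re ^ (1 / 3 : ℝ) →
      q + ω • a + μ • b ∈ f '' ball 0 1) : False := by
  have hε1 : ε < 1 := by rw [hε]; norm_num
  obtain ⟨p, hp, hpf⟩ : q + a ∈ f '' ball 0 1 := by
    simpa using hR 1 (by simpa using hε1.le) (by simp) 0 (by simp)
  have hp1 : ‖p‖ < 1 := mem_ball_zero_iff.1 hp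
  have hp2 : ‖-p‖ < 1 := by rwa [norm_neg]
  have hmaps : MapsTo (ballAut p) (ball 0 1) (ball 0 1) := fun z hz =>
    mem_ball_zero_iff.2 (norm_ballAut_lt_one hp1 (mem_ball_zero_iff.1 hz))
  have hmaps' : MapsTo (ballAut (-p)) (ball 0 1) (ball 0 1) := fun z hz =>
    mem_ball_zero_iff.2 (norm_ballAut_lt_one hp2 (mem_ball_zero_iff.1 hz))
  have him : (fun z => f (ballAut p z)) '' ball 0 1 = f '' ball 0 1 := by
    apply Subset.antisymm
    · rintro _ ⟨z, hz, rfl⟩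
      exact mem_image_of_mem f (hmaps hz)
    · rintro _ ⟨z, hz, rfl⟩
      refine ⟨ballAut (-p) z, hmaps' hz, ?_⟩
      simp only
      rw [ballAut_ballAut_neg hp1 (mem_ball_zero_iff.1 hz)]
  have hgm : MapsTo g (f '' ball 0 1) (ball 0 1) := by
    rintro _ ⟨x, hx, rfl⟩; rwa [hgf x hx]
  refine false_of_ball_image_contains_window_of_center (f := fun z => f (ballAut p z))
    (g := fun y => ballAut (-p) (g y)) (hf.comp (differentiableOn_ballAut hp1) hmaps)
    (fun z hz => hfD (hmaps hz)) (by rwa [him])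
    (by rw [him]; exact (differentiableOn_ballAut hp2).comp hg hgm) (fun x hx => ?_)
    hε hl hlD hlQ m hs hm
    (by rwa [him]) (by simp only [ballAut_zero, hpf])
  rw [hgf _ (hmaps hx)]
  have := ballAut_ballAut_neg hp2 (mem_ball_zero_iff.1 hx)
  rwa [neg_neg] at this

end Core

theorem measurePreserving_smul_of_norm_eq_one {n : ℕ} {c : ℂ} (hc : ‖c‖ = 1) :
    MeasurePreserving (fun x : Fin n → ℂ => c • x) := by
  obtain ⟨a, rfl⟩ : ∃ a : Circle, (a : ℂ) = c :=
    ⟨⟨c, mem_sphere_zero_iff_norm.2 hc⟩, rfl⟩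
  have h1 : MeasurePreserving (fun z : ℂ => a * z) := (rotation a).measurePreserving
  exact volume_preserving_pi (f := fun _ : Fin n => fun z : ℂ => a * z) (fun _ => h1)

theorem integral_closedBall_add_eq {n : ℕ} {U : Set (Fin n → ℂ)}
    {f : (Fin n → ℂ) → ℂ} (hf : DifferentiableOn ℂ f U) {u : Fin n → ℂ} {r : ℝ}
    (hr : closedBall u r ⊆ U) :
    ∫ x in closedBall (0 : Fin n → ℂ) r, f (u + x) =
      volume.real (closedBall (0 : Fin n → ℂ) r) • f u := by
  set B := closedBall (0 : Fin n → ℂ) r with hB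
  have hmem : ∀ c : ℂ, ‖c‖ ≤ 1 → ∀ x ∈ B, u + c • x ∈ U := by
    intro c hc x hx
    apply hr
    rw [mem_closedBall, dist_eq_norm, add_sub_cancel_left, norm_smul]
    have := mem_closedBall_zero_iff.1 hx
    nlinarith [norm_nonneg x]
  have hcm : ∀ θ : ℝ, ‖circleMap 0 1 θ‖ = 1 := fun θ => by simp
  have h1 : ∀ θ : ℝ, ∫ x in B, f (u + circleMap 0 1 θ • x) = ∫ x in B, f (u + x) := by
    intro θ
    have hmp := measurePreserving_smul_of_norm_eq_one (n := n) (hcm θ)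
    have hne : circleMap 0 1 θ ≠ 0 := by
      intro h0; have := hcm θ; rw [h0] at this; simp at this
    have hemb : MeasurableEmbedding (fun x : Fin n → ℂ => circleMap 0 1 θ • x) :=
      measurableEmbedding_const_smul₀ hne
    have := hmp.setIntegral_preimage_emb hemb (fun x => f (u + x)) B
    rw [← this]
    congr 2
    ext x
    simp only [hB, mem_preimage, mem_closedBall_zero_iff, norm_smul, hcm, one_mul]
  have hco : ContinuousOn (fun p : ℝ × (Fin n → ℂ) => f (u + circleMap 0 1 p.1 • p.2))
      (Icc 0 (2 * Real.pi) ×ˢ B) := by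
    refine hf.continuousOn.comp (Continuous.continuousOn ?_) ?_
    · exact continuous_const.add (((continuous_circleMap 0 1).comp continuous_fst).smul
        continuous_snd)
    · intro p hp
      exact hmem _ (hcm _).le _ hp.2
  have hInt : Integrable (Function.uncurry fun (θ : ℝ) (x : Fin n → ℂ) =>
      f (u + circleMap 0 1 θ • x))
      ((volume.restrict (uIoc 0 (2 * Real.pi))).prod (volume.restrict B)) := by
    rw [Measure.prod_restrict]
    have := hco.integrableOn_compact (μ := (volume : Measure ℝ).prod volume)
      (isCompact_Icc.prod (isCompact_closedBall 0 r))
    refine this.mono_set (prod_mono_left ?_)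
    rw [uIoc_of_le Real.two_pi_pos.le]
    exact Ioc_subset_Icc_self
  have h2 := intervalIntegral_integral_swap hInt
  simp_rw [h1] at h2
  have h3 : ∀ x ∈ B, ∫ θ in (0:ℝ)..2 * Real.pi, f (u + circleMap 0 1 θ • x)
      = (2 * Real.pi) • f u := by
    intro x hx
    have hd : DiffContOnCl ℂ (fun ζ : ℂ => f (u + ζ • x)) (ball 0 |1|) := by
      apply DifferentiableOn.diffContOnCl
      rw [abs_one, closure_ball _ one_ne_zero]
      refine hf.comp (Differentiable.differentiableOn ?_) ?_
      · fun_prop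
      · intro ζ hζ
        exact hmem _ (mem_closedBall_zero_iff.1 hζ) _ hx
    have := hd.circleAverage
    rw [Real.circleAverage_def] at this
    simp only [zero_smul, add_zero] at this
    rw [← this, smul_smul, mul_inv_cancel₀ Real.two_pi_pos.ne', one_smul]
  rw [setIntegral_congr_fun measurableSet_closedBall h3] at h2
  rw [intervalIntegral.integral_const, setIntegral_const, sub_zero, smul_comm] at h2
  exact smul_right_injective _ Real.two_pi_pos.ne' h2

theorem norm_le_of_memA2 {n : ℕ} {D : Set (Fin n → ℂ)} {u : Fin n → ℂ} {r : ℝ}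
    (hr : closedBall u r ⊆ D) {f : (Fin n → ℂ) → ℂ} (hf : MemA2 D f) :
    volume.real (closedBall (0 : Fin n → ℂ) r) * ‖f u‖ ≤
      Real.sqrt (volume.real (closedBall (0 : Fin n → ℂ) r)) * ‖hf.2.toLp f‖ := by
  have h0 := integral_closedBall_add_eq hf.1 hr
  have hvol : (volume.restrict D) (closedBall u r) = volume (closedBall (0 : Fin n → ℂ) r) := by
    rw [Measure.restrict_eq_self _ hr]
    simpa using (Measure.addHaar_closedBall_center volume u r)
  have hfin : (volume.restrict D) (closedBall u r) ≠ ∞ := by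
    rw [hvol]; exact measure_closedBall_lt_top.ne
  have h1 : ∫ x in closedBall (0 : Fin n → ℂ) r, f (u + x)
      = ∫ x in closedBall u r, f x ∂(volume.restrict D) := by
    rw [Measure.restrict_restrict_of_subset hr]
    have hmp := measurePreserving_add_left (volume : Measure (Fin n → ℂ)) u
    rw [← hmp.setIntegral_preimage_emb (measurableEmbedding_addLeft u) f]
    congr 2
    ext x; simp [dist_eq_norm]
  have h2 : ∫ x in closedBall u r, f x ∂(volume.restrict D)
      = inner ℂ (indicatorConstLp 2 measurableSet_closedBall hfin (1 : ℂ)) (hf.2.toLp f) := by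
    rw [L2.inner_indicatorConstLp_one]
    refine setIntegral_congr_ae measurableSet_closedBall ?_
    filter_upwards [hf.2.coeFn_toLp] with x hx _ using hx.symm
  have h3 := norm_inner_le_norm (𝕜 := ℂ) (indicatorConstLp 2 measurableSet_closedBall hfin (1 : ℂ))
    (hf.2.toLp f)
  rw [← h2, ← h1, h0, norm_smul, norm_indicatorConstLp (by simp) (by simp), norm_one, one_mul,
    Real.norm_of_nonneg measureReal_nonneg] at h3
  have h4 : (volume.restrict D).real (closedBall u r)
      = volume.real (closedBall (0 : Fin n → ℂ) r) := by
    rw [measureReal_def, hvol, measureReal_def]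
  rw [h4] at h3
  rw [Real.sqrt_eq_rpow]
  simpa using h3

theorem wderiv_eq_of_hasFDerivAt {n : ℕ} {f : (Fin n → ℂ) → ℂ} {f' : (Fin n → ℂ) →L[ℝ] ℂ}
    {z : Fin n → ℂ} (h : HasFDerivAt f f' z) {A B : (Fin n → ℂ) → ℂ}
    (hAB : ∀ ξ, f' ξ = A ξ + B ξ) (hA : ∀ ξ, A (Complex.I • ξ) = Complex.I * A ξ)
    (hB : ∀ ξ, B (Complex.I • ξ) = -(Complex.I * B ξ)) (μ : Fin n) :
    wderiv μ f z = A (Pi.single μ 1) ∧ wderivBar μ f z = B (Pi.single μ 1) := by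
  have h1 : (Pi.single μ Complex.I : Fin n → ℂ) = Complex.I • Pi.single μ 1 := by
    rw [← Pi.single_smul]; simp
  unfold wderiv wderivBar
  rw [h.fderiv, h1, hAB, hAB, hA, hB]
  constructor
  · linear_combination (B (Pi.single μ 1) - A (Pi.single μ 1)) / 2 * Complex.I_mul_I
  · linear_combination (A (Pi.single μ 1) - B (Pi.single μ 1)) / 2 * Complex.I_mul_I

section
variable {E L : Type} [NormedAddCommGroup E] [NormedSpace ℂ E]
  [NormedAddCommGroup L] [InnerProductSpace ℂ L] [CompleteSpace L]

theorem differentiableOn_inner_of_pairwise {D : Set E} (hD : IsOpen D) {k : E → L}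
    (hb : ∀ x ∈ D, ∃ R > 0, ∃ C, ∀ y ∈ ball x R, ‖k y‖ ≤ C)
    (hk : ∀ w ∈ D, DifferentiableOn ℂ (fun u => inner ℂ (k u) (k w)) D) (F : L) :
    DifferentiableOn ℂ (fun u => inner ℂ (k u) F) D := by
  set S : Submodule ℂ L := Submodule.span ℂ (k '' D) with hS
  have hspan : ∀ F ∈ S, DifferentiableOn ℂ (fun u => inner ℂ (k u) F) D := by
    intro F hF
    induction hF using Submodule.span_induction with
    | mem x hx => obtain ⟨w, hw, rfl⟩ := hx; exact hk w hw
    | zero => simp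
    | add x y _ _ hx hy => simpa only [inner_add_right] using hx.fun_add hy
    | smul a x _ hx => simpa only [inner_smul_right] using hx.const_mul a
  have hcl : ∀ F ∈ closure (S : Set L), DifferentiableOn ℂ (fun u => inner ℂ (k u) F) D := by
    intro F hF x hx
    obtain ⟨R, hR, C, hC⟩ := hb x hx
    obtain ⟨R', hR', hR'D⟩ := Metric.isOpen_iff.1 hD x hx
    set ρ := min R R'
    have hρ : 0 < ρ := lt_min hR hR'
    have : (𝓝[(S : Set L)] F).NeBot := mem_closure_iff_nhdsWithin_neBot.1 hF
    have hu : TendstoUniformlyOn (fun (G : L) u => inner ℂ (k u) G)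
        (fun u => inner ℂ (k u) F) (𝓝[(S : Set L)] F) (ball x ρ) := by
      rw [Metric.tendstoUniformlyOn_iff]
      intro ε hε
      have hC0 : 0 ≤ C := (norm_nonneg _).trans (hC x (mem_ball_self hR))
      have : ∀ᶠ G in 𝓝[(S : Set L)] F, dist G F < ε / (C + 1) :=
        nhdsWithin_le_nhds (Metric.ball_mem_nhds F (by positivity))
      filter_upwards [this] with G hG y hy
      rw [dist_eq_norm, ← inner_sub_right]
      have h1 := hC y (ball_subset_ball (min_le_left _ _) hy)
      rw [dist_eq_norm', lt_div_iff₀ (by positivity)] at hG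
      calc ‖inner ℂ (k y) (F - G)‖ ≤ ‖k y‖ * ‖F - G‖ := norm_inner_le_norm _ _
        _ ≤ C * ‖F - G‖ := by gcongr
        _ ≤ ‖F - G‖ * (C + 1) := by nlinarith [norm_nonneg (F - G)]
        _ < ε := hG
    have := differentiableOn_of_tendstoUniformlyOn_ball (l := 𝓝[(S : Set L)] F)
      (eventually_mem_nhdsWithin.mono fun G hG =>
        (hspan G hG).mono ((ball_subset_ball (min_le_right _ _)).trans hR'D)) hu
    exact (this.differentiableAt (ball_mem_nhds x hρ)).differentiableWithinAt
  have : CompleteSpace S.topologicalClosure := S.isClosed_topologicalClosure.completeSpace_coe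
  set P := S.topologicalClosure.starProjection F
  have hP : P ∈ closure (S : Set L) := by
    have := S.topologicalClosure.starProjection_apply_mem F
    rwa [← SetLike.mem_coe, Submodule.topologicalClosure_coe] at this
  refine (hcl P hP).congr fun u hu => ?_
  have h1 : F - P ∈ S.topologicalClosureᗮ :=
    S.topologicalClosure.sub_starProjection_mem_orthogonal F
  have h2 := (Submodule.mem_orthogonal _ _).1 h1 (k u)
    (S.le_topologicalClosure (Submodule.subset_span ⟨u, hu, rfl⟩))
  rw [inner_sub_right, sub_eq_zero] at h2
  exact h2

/-- The inverse of the Riesz map, as a real-linear map. -/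
def rieszSymmReal (L : Type) [NormedAddCommGroup L] [InnerProductSpace ℂ L] [CompleteSpace L] :
    (L →L[ℂ] ℂ) →L[ℝ] L :=
  LinearMap.mkContinuous
    { toFun := fun f => (InnerProductSpace.toDual ℂ L).symm f
      map_add' := fun f g => map_add _ f g
      map_smul' := fun r f => by
        have : r • f = (r : ℂ) • f := by ext; simp
        rw [this, map_smulₛₗ]; simp } 1 (fun f => by simp)

@[simp] theorem rieszSymmReal_apply (f : L →L[ℂ] ℂ) :
    rieszSymmReal L f = (InnerProductSpace.toDual ℂ L).symm f := rfl

theorem rieszSymmReal_I_smul (f : L →L[ℂ] ℂ) :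
    rieszSymmReal L (Complex.I • f) = -(Complex.I • rieszSymmReal L f) := by
  simp [map_smulₛₗ]

theorem inner_rieszSymmReal (f : L →L[ℂ] ℂ) (F : L) : inner ℂ (rieszSymmReal L f) F = f F := by
  simp

theorem differentiableOn_toDual_of_pairwise {D : Set E} (hD : IsOpen D) {k : E → L}
    (hb : ∀ x ∈ D, ∃ R > 0, ∃ C, ∀ y ∈ ball x R, ‖k y‖ ≤ C)
    (hk : ∀ w ∈ D, DifferentiableOn ℂ (fun u => inner ℂ (k u) (k w)) D) :
    DifferentiableOn ℂ (fun u => (InnerProductSpace.toDual ℂ L (k u) : L →L[ℂ] ℂ)) D := by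
  refine differentiableOn_clm_of_apply hD ?_ ?_
  · simpa using hb
  · intro F
    simpa using differentiableOn_inner_of_pairwise hD hb hk F
end

section

variable {n : ℕ} {L : Type} [NormedAddCommGroup L] [InnerProductSpace ℂ L] [CompleteSpace L]

/-- The Riesz representative of the derivative of `u ↦ ⟪k u, F⟫` at `z` in direction `ξ`. -/
def kernelDeriv (k : (Fin n → ℂ) → L) (z ξ : Fin n → ℂ) : L :=
  rieszSymmReal L (fderiv ℂ (fun u => (InnerProductSpace.toDual ℂ L (k u) : L →L[ℂ] ℂ)) z ξ)

theorem hasFDerivAt_real_of_toDual {k : (Fin n → ℂ) → L} {z : Fin n → ℂ}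
    (h : DifferentiableAt ℂ (fun u => (InnerProductSpace.toDual ℂ L (k u) : L →L[ℂ] ℂ)) z) :
    HasFDerivAt k ((rieszSymmReal L).comp ((fderiv ℂ (fun u =>
      (InnerProductSpace.toDual ℂ L (k u) : L →L[ℂ] ℂ)) z).restrictScalars ℝ)) z := by
  have := (rieszSymmReal L).hasFDerivAt.comp z (h.hasFDerivAt.restrictScalars ℝ)
  exact this.congr_of_eventuallyEq (.of_forall fun u => by simp)

theorem kernelDeriv_add (k : (Fin n → ℂ) → L) (z ξ η : Fin n → ℂ) :
    kernelDeriv k z (ξ + η) = kernelDeriv k z ξ + kernelDeriv k z η := by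
  simp only [kernelDeriv, map_add]

theorem kernelDeriv_smul (k : (Fin n → ℂ) → L) (z ξ : Fin n → ℂ) (c : ℂ) :
    kernelDeriv k z (c • ξ) = (starRingEnd ℂ) c • kernelDeriv k z ξ := by
  simp only [kernelDeriv, map_smul, rieszSymmReal_apply, map_smulₛₗ]

theorem kernelDeriv_sum (k : (Fin n → ℂ) → L) (z ξ : Fin n → ℂ) :
    kernelDeriv k z ξ = ∑ μ, (starRingEnd ℂ) (ξ μ) • kernelDeriv k z (Pi.single μ 1) := by
  conv_lhs => rw [pi_eq_sum_univ' ξ]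
  have h := map_sum (AddMonoidHom.mk' (kernelDeriv k z) (kernelDeriv_add k z))
    (fun μ => ξ μ • (Pi.single μ 1 : Fin n → ℂ)) Finset.univ
  simp only [AddMonoidHom.mk'_apply, kernelDeriv_smul] at h
  exact h

variable {D : Set (Fin n → ℂ)} {k : (Fin n → ℂ) → L}

theorem inner_kernelDeriv (hD : IsOpen D)
    (he : DifferentiableOn ℂ (fun u => (InnerProductSpace.toDual ℂ L (k u) : L →L[ℂ] ℂ)) D)
    {z : Fin n → ℂ} (hz : z ∈ D) (ξ : Fin n → ℂ) (F : L) :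
    inner ℂ (kernelDeriv k z ξ) F = fderiv ℂ (fun u => inner ℂ (k u) F) z ξ := by
  have h1 := (he.differentiableAt (hD.mem_nhds hz)).hasFDerivAt
  have h2 := (h1.clm_apply (hasFDerivAt_const F z)).fderiv
  simp only [InnerProductSpace.toDual_apply_apply] at h2
  rw [h2, kernelDeriv, inner_rieszSymmReal]
  simp

theorem continuousOn_of_toDual
    (he : DifferentiableOn ℂ (fun u => (InnerProductSpace.toDual ℂ L (k u) : L →L[ℂ] ℂ)) D) :
    ContinuousOn k D := by
  have := (rieszSymmReal L).continuous.comp_continuousOn he.continuousOn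
  refine this.congr fun u _ => ?_
  simp

theorem continuousOn_kernelDeriv (hD : IsOpen D)
    (he : DifferentiableOn ℂ (fun u => (InnerProductSpace.toDual ℂ L (k u) : L →L[ℂ] ℂ)) D) :
    ContinuousOn (fun p : (Fin n → ℂ) × (Fin n → ℂ) => kernelDeriv k p.1 p.2) (D ×ˢ univ) := by
  refine (rieszSymmReal L).continuous.comp_continuousOn ?_
  refine ContinuousOn.clm_apply ?_ continuousOn_snd
  exact (differentiableOn_fderiv_of_isOpen hD he).continuousOn.comp continuousOn_fst
    (fun p hp => hp.1)

theorem hasFDerivAt_kernelDeriv (hD : IsOpen D)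
    (he : DifferentiableOn ℂ (fun u => (InnerProductSpace.toDual ℂ L (k u) : L →L[ℂ] ℂ)) D)
    {z : Fin n → ℂ} (hz : z ∈ D) (η : Fin n → ℂ) :
    ∃ T : (Fin n → ℂ) →L[ℝ] L, HasFDerivAt (fun w => kernelDeriv k w η) T z ∧
      ∀ ξ, T (Complex.I • ξ) = -(Complex.I • T ξ) := by
  have h1 := ((differentiableOn_fderiv_of_isOpen hD he).differentiableAt
    (hD.mem_nhds hz)).hasFDerivAt.clm_apply (hasFDerivAt_const η z)
  refine ⟨_, (rieszSymmReal L).hasFDerivAt.comp z (h1.restrictScalars ℝ), fun ξ => ?_⟩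
  simp only [ContinuousLinearMap.comp_apply, ContinuousLinearMap.coe_restrictScalars', map_smul]
  exact rieszSymmReal_I_smul _

theorem kernelDeriv_I_smul (k : (Fin n → ℂ) → L) (z ξ : Fin n → ℂ) :
    kernelDeriv k z (Complex.I • ξ) = -(Complex.I • kernelDeriv k z ξ) := by
  simp [kernelDeriv_smul]

theorem hasFDerivAt_kernel (hD : IsOpen D)
    (he : DifferentiableOn ℂ (fun u => (InnerProductSpace.toDual ℂ L (k u) : L →L[ℂ] ℂ)) D)
    {z : Fin n → ℂ} (hz : z ∈ D) :
    ∃ T : (Fin n → ℂ) →L[ℝ] L, HasFDerivAt k T z ∧ ∀ ξ, T ξ = kernelDeriv k z ξ :=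
  ⟨_, hasFDerivAt_real_of_toDual (he.differentiableAt (hD.mem_nhds hz)), fun _ => rfl⟩

theorem wderivBar_log_kernel (hD : IsOpen D)
    (he : DifferentiableOn ℂ (fun u => (InnerProductSpace.toDual ℂ L (k u) : L →L[ℂ] ℂ)) D)
    {K : (Fin n → ℂ) → (Fin n → ℂ) → ℂ} (hK : ∀ u ∈ D, K u u = inner ℂ (k u) (k u))
    (hpos : ∀ u ∈ D, k u ≠ 0) {z : Fin n → ℂ} (hz : z ∈ D) (ν : Fin n) :
    wderivBar ν (fun u => Complex.log (K u u)) z =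
      inner ℂ (k z) (kernelDeriv k z (Pi.single ν 1)) * (inner ℂ (k z) (k z))⁻¹ := by
  obtain ⟨T, hT, hTk⟩ := hasFDerivAt_kernel hD he hz
  have h1 := hT.inner ℂ hT
  have hs : inner ℂ (k z) (k z) ∈ Complex.slitPlane := by
    left
    have h0 := hpos z hz
    rw [inner_self_eq_norm_sq_to_K]
    norm_cast
    exact pow_pos (norm_pos_iff.2 h0) 2
  have h2 := ((Complex.hasDerivAt_log hs).hasFDerivAt.restrictScalars ℝ).comp z h1
  have h3 : HasFDerivAt (fun u => Complex.log (K u u)) _ z :=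
    h2.congr_of_eventuallyEq ((hD.eventually_mem hz).mono fun u hu => by
      show Complex.log (K u u) = Complex.log (inner ℂ (k u) (k u))
      rw [hK u hu])
  refine (wderiv_eq_of_hasFDerivAt h3
    (A := fun ξ => inner ℂ (kernelDeriv k z ξ) (k z) * (inner ℂ (k z) (k z))⁻¹)
    (B := fun ξ => inner ℂ (k z) (kernelDeriv k z ξ) * (inner ℂ (k z) (k z))⁻¹) ?_ ?_ ?_ ν).2
  · intro ξ
    simp [fderivInnerCLM_apply, hTk, -inner_self_eq_norm_sq_to_K]
    ring
  · intro ξ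
    simp only [kernelDeriv_I_smul, inner_neg_left, inner_smul_left, Complex.conj_I]
    ring
  · intro ξ
    simp only [kernelDeriv_I_smul, inner_neg_right, inner_smul_right]
    ring

theorem bergmanTensor_eq (hD : IsOpen D)
    (he : DifferentiableOn ℂ (fun u => (InnerProductSpace.toDual ℂ L (k u) : L →L[ℂ] ℂ)) D)
    {K : (Fin n → ℂ) → (Fin n → ℂ) → ℂ} (hK : ∀ u ∈ D, K u u = inner ℂ (k u) (k u))
    (hpos : ∀ u ∈ D, k u ≠ 0) {z : Fin n → ℂ} (hz : z ∈ D) (μ ν : Fin n) :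
    bergmanTensor K μ ν z =
      (inner ℂ (kernelDeriv k z (Pi.single μ 1)) (kernelDeriv k z (Pi.single ν 1)) *
        inner ℂ (k z) (k z) - inner ℂ (k z) (kernelDeriv k z (Pi.single ν 1)) *
        inner ℂ (kernelDeriv k z (Pi.single μ 1)) (k z)) / (inner ℂ (k z) (k z)) ^ 2 := by
  obtain ⟨T, hT, hTk⟩ := hasFDerivAt_kernel hD he hz
  obtain ⟨S, hS, hSI⟩ := hasFDerivAt_kernelDeriv hD he hz (Pi.single ν 1)
  have hne : inner ℂ (k z) (k z) ≠ 0 := inner_self_ne_zero.2 (hpos z hz)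
  have h1 := (hT.inner ℂ hS).fun_mul ((hasFDerivAt_inv hne).restrictScalars ℝ |>.comp z
      (hT.inner ℂ hT))
  have h3 : HasFDerivAt (fun w => wderivBar ν (fun u => Complex.log (K u u)) w) _ z :=
    h1.congr_of_eventuallyEq ((hD.eventually_mem hz).mono fun u hu =>
      wderivBar_log_kernel hD he hK hpos hu ν)
  set N := inner ℂ (k z) (k z) with hN
  set κ := kernelDeriv k z (Pi.single ν 1) with hκ
  unfold bergmanTensor
  rw [(wderiv_eq_of_hasFDerivAt h3
    (A := fun ξ => inner ℂ (kernelDeriv k z ξ) κ * N⁻¹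
      - inner ℂ (k z) κ * (N ^ 2)⁻¹ * inner ℂ (kernelDeriv k z ξ) (k z))
    (B := fun ξ => inner ℂ (k z) (S ξ) * N⁻¹
      - inner ℂ (k z) κ * (N ^ 2)⁻¹ * inner ℂ (k z) (kernelDeriv k z ξ)) ?_ ?_ ?_ μ).1]
  · field_simp
  · intro ξ
    simp [fderivInnerCLM_apply, hTk, ← hN, -inner_self_eq_norm_sq_to_K]
    ring
  · intro ξ
    simp only [kernelDeriv_I_smul, inner_neg_left, inner_smul_left, Complex.conj_I]
    ring
  · intro ξ
    simp only [kernelDeriv_I_smul, hSI, inner_neg_right, inner_smul_right]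
    ring

theorem bergmanQuad_eq (hD : IsOpen D)
    (he : DifferentiableOn ℂ (fun u => (InnerProductSpace.toDual ℂ L (k u) : L →L[ℂ] ℂ)) D)
    {K : (Fin n → ℂ) → (Fin n → ℂ) → ℂ} (hK : ∀ u ∈ D, K u u = inner ℂ (k u) (k u))
    (hpos : ∀ u ∈ D, k u ≠ 0) {z : Fin n → ℂ} (hz : z ∈ D) (ξ : Fin n → ℂ) :
    bergmanQuad K z ξ = (‖kernelDeriv k z ξ‖ ^ 2 * ‖k z‖ ^ 2
      - ‖inner ℂ (k z) (kernelDeriv k z ξ)‖ ^ 2) / ‖k z‖ ^ 4 := by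
  have hne : inner ℂ (k z) (k z) ≠ 0 := inner_self_ne_zero.2 (hpos z hz)
  have h1 : ∑ μ, ∑ ν, bergmanTensor K μ ν z * ξ μ * (starRingEnd ℂ) (ξ ν) =
      (inner ℂ (kernelDeriv k z ξ) (kernelDeriv k z ξ) *
        inner ℂ (k z) (k z) - inner ℂ (k z) (kernelDeriv k z ξ) *
        inner ℂ (kernelDeriv k z ξ) (k z)) / (inner ℂ (k z) (k z)) ^ 2 := by
    have hA : inner ℂ (kernelDeriv k z ξ) (kernelDeriv k z ξ) = ∑ μ, ∑ ν, ξ μ *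
        ((starRingEnd ℂ) (ξ ν) *
        inner ℂ (kernelDeriv k z (Pi.single μ 1)) (kernelDeriv k z (Pi.single ν 1))) := by
      rw [kernelDeriv_sum k z ξ]
      simp only [sum_inner, inner_sum, inner_smul_left, inner_smul_right, Complex.conj_conj,
        Finset.mul_sum]
      rw [Finset.sum_comm]
      exact Finset.sum_congr rfl fun _ _ => Finset.sum_congr rfl fun _ _ => by ring
    have hB : inner ℂ (k z) (kernelDeriv k z ξ) = ∑ ν, (starRingEnd ℂ) (ξ ν) *
        inner ℂ (k z) (kernelDeriv k z (Pi.single ν 1)) := by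
      rw [kernelDeriv_sum k z ξ]
      simp only [inner_sum, inner_smul_right]
    have hC : inner ℂ (kernelDeriv k z ξ) (k z) = ∑ μ, ξ μ *
        inner ℂ (kernelDeriv k z (Pi.single μ 1)) (k z) := by
      rw [kernelDeriv_sum k z ξ]
      simp only [sum_inner, inner_smul_left, Complex.conj_conj]
    rw [hA, hB, hC, mul_comm (∑ ν, (starRingEnd ℂ) (ξ ν) * _), Finset.sum_mul_sum, Finset.sum_mul,
      ← Finset.sum_sub_distrib, Finset.sum_div]
    refine Finset.sum_congr rfl fun μ _ => ?_
    rw [Finset.sum_mul, ← Finset.sum_sub_distrib, Finset.sum_div]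
    refine Finset.sum_congr rfl fun ν _ => ?_
    rw [bergmanTensor_eq hD he hK hpos hz]
    ring
  have h2 : inner ℂ (kernelDeriv k z ξ) (k z)
      = (starRingEnd ℂ) (inner ℂ (k z) (kernelDeriv k z ξ)) := (inner_conj_symm _ _).symm
  unfold bergmanQuad
  rw [h1, h2, Complex.mul_conj, inner_self_eq_norm_sq_to_K, inner_self_eq_norm_sq_to_K,
    Complex.normSq_eq_norm_sq]
  have : ‖k z‖ ^ 4 = (‖k z‖ ^ 2) ^ 2 := by ring
  rw [this]
  have h3 : ∀ r : ℝ, (RCLike.ofReal r : ℂ) = (r : ℂ) := fun _ => rfl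
  simp only [h3, ← Complex.ofReal_pow, ← Complex.ofReal_mul, ← Complex.ofReal_sub,
    ← Complex.ofReal_div, Complex.ofReal_re]

end

section

variable {n : ℕ} {D : Set (Fin n → ℂ)} {K : (Fin n → ℂ) → (Fin n → ℂ) → ℂ}

open Classical in
/-- The class of `K(·, w)` in `L²(D)`. -/
def kernelVec (hK : IsBergmanKernel D K) (w : Fin n → ℂ) : Lp ℂ 2 (volume.restrict D) :=
  if hw : w ∈ D then (hK.1 w hw).2.toLp (fun z => K z w) else 0

theorem kernelVec_eq (hK : IsBergmanKernel D K) {w : Fin n → ℂ} (hw : w ∈ D) :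
    kernelVec hK w = (hK.1 w hw).2.toLp (fun z => K z w) := by
  simp [kernelVec, hw]

theorem inner_kernelVec (hK : IsBergmanKernel D K) {w : Fin n → ℂ} (hw : w ∈ D)
    {f : (Fin n → ℂ) → ℂ} (hf : MemA2 D f) :
    inner ℂ (kernelVec hK w) (hf.2.toLp f) = f w := by
  rw [hK.2 f hf w hw, kernelVec_eq hK hw, L2.inner_def]
  refine integral_congr_ae ?_
  filter_upwards [hf.2.coeFn_toLp, (hK.1 w hw).2.coeFn_toLp] with z h1 h2
  rw [h1, h2, RCLike.inner_apply]

theorem inner_kernelVec_kernelVec (hK : IsBergmanKernel D K) {u w : Fin n → ℂ} (hu : u ∈ D)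
    (hw : w ∈ D) : inner ℂ (kernelVec hK u) (kernelVec hK w) = K u w := by
  rw [kernelVec_eq hK hw, inner_kernelVec hK hu (hK.1 w hw)]

theorem kernel_diag_eq (hK : IsBergmanKernel D K) {u : Fin n → ℂ} (hu : u ∈ D) :
    K u u = ((‖kernelVec hK u‖ ^ 2 : ℝ) : ℂ) := by
  rw [← inner_kernelVec_kernelVec hK hu hu, inner_self_eq_norm_sq_to_K]
  simp

theorem kernelVec_ne_zero (hbdd : Bornology.IsBounded D) (hK : IsBergmanKernel D K)
    {u : Fin n → ℂ} (hu : u ∈ D) : kernelVec hK u ≠ 0 := by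
  intro h0
  have hfin : IsFiniteMeasure (volume.restrict D) :=
    ⟨by rw [Measure.restrict_apply_univ]; exact hbdd.measure_lt_top⟩
  have h1 : MemA2 D (fun _ => (1 : ℂ)) := ⟨by fun_prop, memLp_const 1⟩
  have := inner_kernelVec hK hu h1
  rw [h0, inner_zero_left] at this
  exact zero_ne_one this

theorem kernelVec_locally_bounded (hD : IsOpen D) (hK : IsBergmanKernel D K) {x : Fin n → ℂ}
    (hx : x ∈ D) : ∃ R > 0, ∃ C, ∀ y ∈ ball x R, ‖kernelVec hK y‖ ≤ C := by
  obtain ⟨R, hR, hRD⟩ := Metric.isOpen_iff.1 hD x hx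
  set V := volume.real (closedBall (0 : Fin n → ℂ) (R / 3)) with hV
  have hVpos : 0 < V := by
    rw [hV, measureReal_def]
    exact ENNReal.toReal_pos (measure_closedBall_pos _ _ (by positivity)).ne'
      measure_closedBall_lt_top.ne
  refine ⟨R / 3, by positivity, Real.sqrt V / V, fun y hy => ?_⟩
  have hyD : y ∈ D := hRD (ball_subset_ball (by linarith) hy)
  have hsub : closedBall y (R / 3) ⊆ D := by
    intro w hw
    apply hRD
    have := dist_triangle w y x
    rw [mem_ball] at hy ⊢
    rw [mem_closedBall] at hw
    linarith
  have h1 := norm_le_of_memA2 hsub (hK.1 y hyD)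
  rw [← kernelVec_eq hK hyD, kernel_diag_eq hK hyD, Complex.norm_real,
    Real.norm_of_nonneg (by positivity), ← hV] at h1
  rw [le_div_iff₀ hVpos]
  by_cases h0 : ‖kernelVec hK y‖ = 0
  · rw [h0]; simp
  · have hp : 0 < ‖kernelVec hK y‖ := lt_of_le_of_ne (norm_nonneg _) (Ne.symm h0)
    refine le_of_mul_le_mul_right ?_ hp
    calc ‖kernelVec hK y‖ * V * ‖kernelVec hK y‖ = V * ‖kernelVec hK y‖ ^ 2 := by ring
      _ ≤ _ := h1

theorem differentiableOn_toDual_kernelVec (hD : IsOpen D) (hK : IsBergmanKernel D K) :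
    DifferentiableOn ℂ (fun u => (InnerProductSpace.toDual ℂ (Lp ℂ 2 (volume.restrict D))
      (kernelVec hK u) : Lp ℂ 2 (volume.restrict D) →L[ℂ] ℂ)) D := by
  refine differentiableOn_toDual_of_pairwise hD (fun x hx => kernelVec_locally_bounded hD hK hx) ?_
  intro w hw
  exact (hK.1 w hw).1.congr fun u hu => inner_kernelVec_kernelVec hK hu hw

theorem bergmanQuad_eq_kernelVec (hD : IsOpen D) (hbdd : Bornology.IsBounded D)
    (hK : IsBergmanKernel D K) {z : Fin n → ℂ} (hz : z ∈ D) (ξ : Fin n → ℂ) :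
    bergmanQuad K z ξ = (‖kernelDeriv (kernelVec hK) z ξ‖ ^ 2 * ‖kernelVec hK z‖ ^ 2
      - ‖inner ℂ (kernelVec hK z) (kernelDeriv (kernelVec hK) z ξ)‖ ^ 2)
        / ‖kernelVec hK z‖ ^ 4 :=
  bergmanQuad_eq hD (differentiableOn_toDual_kernelVec hD hK)
    (fun _ hu => (inner_kernelVec_kernelVec hK hu hu).symm)
    (fun _ hu => kernelVec_ne_zero hbdd hK hu) hz ξ

theorem continuousOn_bergmanMetric (hD : IsOpen D) (hbdd : Bornology.IsBounded D)
    (hK : IsBergmanKernel D K) :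
    ContinuousOn (fun p : (Fin n → ℂ) × (Fin n → ℂ) => bergmanMetric K p.1 p.2) (D ×ˢ univ) := by
  have hk := (continuousOn_of_toDual (differentiableOn_toDual_kernelVec hD hK)).comp
    (continuousOn_fst (s := D ×ˢ (univ : Set (Fin n → ℂ)))) (fun p hp => hp.1)
  have hκ := continuousOn_kernelDeriv hD (differentiableOn_toDual_kernelVec hD hK)
  have : ContinuousOn (fun p : (Fin n → ℂ) × (Fin n → ℂ) =>
      Real.sqrt ((‖kernelDeriv (kernelVec hK) p.1 p.2‖ ^ 2 * ‖kernelVec hK p.1‖ ^ 2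
      - ‖inner ℂ (kernelVec hK p.1) (kernelDeriv (kernelVec hK) p.1 p.2)‖ ^ 2)
        / ‖kernelVec hK p.1‖ ^ 4)) (D ×ˢ univ) := by
    refine (ContinuousOn.div ?_ (hk.norm.pow 4) ?_).sqrt
    · exact ((hκ.norm.pow 2).mul (hk.norm.pow 2)).sub ((hk.inner hκ).norm.pow 2)
    · intro p hp
      have := norm_pos_iff.2 (kernelVec_ne_zero hbdd hK hp.1)
      exact (pow_pos this 4).ne'
  refine this.congr fun p hp => ?_
  simp only [bergmanMetric, bergmanQuad_eq_kernelVec hD hbdd hK hp.1]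

theorem norm_inner_le_sqrt_of_orthogonal {L : Type*} [NormedAddCommGroup L]
    [InnerProductSpace ℂ L] {k κ F : L} (hk : k ≠ 0) (hF : inner ℂ k F = 0) :
    ‖inner ℂ κ F‖ ≤ Real.sqrt ((‖κ‖ ^ 2 * ‖k‖ ^ 2 - ‖inner ℂ k κ‖ ^ 2) / ‖k‖ ^ 4) * ‖k‖ * ‖F‖ := by
  have hp : 0 < ‖k‖ := norm_pos_iff.2 hk
  set c := inner ℂ k κ / ((‖k‖ ^ 2 : ℝ) : ℂ) with hc
  have hN : ((‖k‖ ^ 2 : ℝ) : ℂ) ≠ 0 := by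
    rw [Complex.ofReal_ne_zero]; positivity
  have h1 : inner ℂ κ F = inner ℂ (κ - c • k) F := by
    rw [inner_sub_left, inner_smul_left, hF]; simp
  have h2 : ‖κ - c • k‖ ^ 2 = ‖κ‖ ^ 2 - ‖inner ℂ k κ‖ ^ 2 / ‖k‖ ^ 2 := by
    have h3 : inner ℂ k (κ - c • k) = 0 := by
      rw [inner_sub_right, inner_smul_right, inner_self_eq_norm_sq_to_K, hc, sub_eq_zero]
      rw [div_mul_eq_mul_div, eq_div_iff hN]; simp
    have h4 : ‖κ‖ ^ 2 = ‖κ - c • k‖ ^ 2 + ‖c • k‖ ^ 2 := by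
      have h5 : inner ℂ (κ - c • k) (c • k) = 0 := by
        rw [inner_smul_right, ← inner_conj_symm, h3]; simp
      have := norm_add_sq_eq_norm_sq_add_norm_sq_of_inner_eq_zero (κ - c • k) (c • k) h5
      rw [sub_add_cancel] at this
      nlinarith [this]
    rw [h4, norm_smul, hc, norm_div, Complex.norm_real, Real.norm_of_nonneg (by positivity)]
    field_simp
    ring
  have h6 : Real.sqrt ((‖κ‖ ^ 2 * ‖k‖ ^ 2 - ‖inner ℂ k κ‖ ^ 2) / ‖k‖ ^ 4) * ‖k‖ = ‖κ - c • k‖ := by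
    have : (‖κ‖ ^ 2 * ‖k‖ ^ 2 - ‖inner ℂ k κ‖ ^ 2) / ‖k‖ ^ 4 = (‖κ - c • k‖ / ‖k‖) ^ 2 := by
      rw [div_pow, h2]; field_simp
    rw [this, Real.sqrt_sq (by positivity)]
    field_simp
  rw [h1, h6]
  exact norm_inner_le_norm _ _

theorem norm_apply_le_mul_bergmanMetric (hD : IsOpen D) (hbdd : Bornology.IsBounded D)
    (hK : IsBergmanKernel D K) {C : ℝ} (hC : ∀ u ∈ D, ∀ w ∈ D, dist u w ≤ C) {z : Fin n → ℂ}
    (hz : z ∈ D) (ξ : Fin n → ℂ) (j : Fin n) : ‖ξ j‖ ≤ C * bergmanMetric K z ξ := by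
  have hKz := hK.1 z hz
  set F : (Fin n → ℂ) → ℂ := fun u => (u j - z j) * K u z with hF
  have hC0 : 0 ≤ C := dist_nonneg.trans (hC z hz z hz)
  have hle : ∀ u ∈ D, ‖F u‖ ≤ C * ‖K u z‖ := fun u hu => by
    rw [hF, norm_mul]
    gcongr
    rw [← Pi.sub_apply]
    exact (norm_le_pi_norm (u - z) j).trans ((dist_eq_norm u z).symm.le.trans (hC u hu z hz))
  have hFd : DifferentiableOn ℂ F D := by
    refine DifferentiableOn.mul ?_ hKz.1
    fun_prop
  have hae : ∀ᵐ u ∂(volume.restrict D), ‖F u‖ ≤ C * ‖K u z‖ :=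
    (ae_restrict_mem hD.measurableSet).mono hle
  have hFm : MemLp F 2 (volume.restrict D) := hKz.2.of_le_mul
    (hFd.continuousOn.aestronglyMeasurable hD.measurableSet) hae
  have hFA : MemA2 D F := ⟨hFd, hFm⟩
  have hnorm : ‖hFA.2.toLp F‖ ≤ C * ‖kernelVec hK z‖ := by
    refine Lp.norm_le_mul_norm_of_ae_le_mul ?_
    rw [kernelVec_eq hK hz]
    filter_upwards [hae, hFA.2.coeFn_toLp, hKz.2.coeFn_toLp] with u h1 h2 h3
    rw [h2, h3]; exact h1
  have h0 : inner ℂ (kernelVec hK z) (hFA.2.toLp F) = 0 := by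
    rw [inner_kernelVec hK hz hFA, hF]; simp
  have hder : inner ℂ (kernelDeriv (kernelVec hK) z ξ) (hFA.2.toLp F) = ξ j * K z z := by
    rw [inner_kernelDeriv hD (differentiableOn_toDual_kernelVec hD hK) hz]
    have heq : (fun u => inner ℂ (kernelVec hK u) (hFA.2.toLp F)) =ᶠ[𝓝 z] F :=
      (hD.eventually_mem hz).mono fun u hu => inner_kernelVec hK hu hFA
    rw [heq.fderiv_eq]
    have h1 : HasFDerivAt (fun u : Fin n → ℂ => u j - z j)
        (ContinuousLinearMap.proj (R := ℂ) (φ := fun _ : Fin n => ℂ) j) z :=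
      (ContinuousLinearMap.proj (R := ℂ) (φ := fun _ : Fin n => ℂ) j).hasFDerivAt.sub_const _
    have h2 := h1.fun_mul (hKz.1.differentiableAt (hD.mem_nhds hz)).hasFDerivAt
    rw [hF, h2.fderiv]
    simp [mul_comm]
  have hne := kernelVec_ne_zero hbdd hK hz
  have hp := norm_pos_iff.2 hne
  have h1 := norm_inner_le_sqrt_of_orthogonal (κ := kernelDeriv (kernelVec hK) z ξ) hne h0
  rw [← bergmanQuad_eq_kernelVec hD hbdd hK hz, hder, norm_mul, kernel_diag_eq hK hz,
    Complex.norm_real, Real.norm_of_nonneg (by positivity)] at h1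
  change _ ≤ bergmanMetric K z ξ * _ * _ at h1
  have hb : 0 ≤ bergmanMetric K z ξ := Real.sqrt_nonneg _
  refine le_of_mul_le_mul_right ?_ (pow_pos hp 2)
  calc _ ≤ _ := h1
    _ ≤ bergmanMetric K z ξ * ‖kernelVec hK z‖ * (C * ‖kernelVec hK z‖) := by gcongr
    _ = _ := by ring

end

section

variable {n : ℕ} {D : Set (Fin n → ℂ)} {K : (Fin n → ℂ) → (Fin n → ℂ) → ℂ}

theorem map_half_add_restrict_le (hD : IsOpen D) {b : Fin n → ℂ}
    (hb : ∀ w ∈ D, (1 / 2 : ℝ) • w + b ∈ D) :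
    Measure.map (fun w => (1 / 2 : ℝ) • w + b) (volume.restrict D) ≤
      ENNReal.ofReal (2 ^ (2 * n)) • volume.restrict D := by
  have hm1 : Measurable (fun w : Fin n → ℂ => (1 / 2 : ℝ) • w) := measurable_const_smul _
  have hm : Measurable (fun w : Fin n → ℂ => (1 / 2 : ℝ) • w + b) := hm1.add_const b
  have hvol : Measure.map (fun w : Fin n → ℂ => (1 / 2 : ℝ) • w + b) volume =
      ENNReal.ofReal (2 ^ (2 * n)) • volume := by
    have h1 : (fun w : Fin n → ℂ => (1 / 2 : ℝ) • w + b)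
        = (fun w => w + b) ∘ (fun w => (1 / 2 : ℝ) • w) := rfl
    rw [h1, ← Measure.map_map (measurable_add_const b) hm1, Measure.map_addHaar_smul _
        (by norm_num),
      Measure.map_smul, map_add_right_eq_self]
    congr 2
    have : Module.finrank ℝ (Fin n → ℂ) = 2 * n := by
      rw [Module.finrank_pi_fintype]; simp [Complex.finrank_real_complex, mul_comm]
    rw [this, abs_of_nonneg (by positivity)]
    simp
  calc Measure.map (fun w => (1 / 2 : ℝ) • w + b) (volume.restrict D)
      ≤ Measure.map (fun w => (1 / 2 : ℝ) • w + b)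
        (volume.restrict ((fun w => (1 / 2 : ℝ) • w + b) ⁻¹' D)) :=
        Measure.map_mono (Measure.restrict_mono hb le_rfl) hm
    _ = (Measure.map (fun w => (1 / 2 : ℝ) • w + b) volume).restrict D :=
        (Measure.restrict_map hm hD.measurableSet).symm
    _ = _ := by rw [hvol, Measure.restrict_smul]
    _ ≤ _ := le_rfl

theorem norm_kernelVec_le_of_reflection (hD : IsOpen D) (hconv : Convex ℝ D)
    (hbdd : Bornology.IsBounded D) (hK : IsBergmanKernel D K) {x y : Fin n → ℂ} (hx : x ∈ D)
    (hy : y ∈ D) (hxy : (2 : ℝ) • y - x ∈ D) : ‖kernelVec hK y‖ ≤ 2 ^ n * ‖kernelVec hK x‖ := by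
  set b : Fin n → ℂ := (1 / 2 : ℝ) • ((2 : ℝ) • y - x) with hb
  set A : (Fin n → ℂ) → (Fin n → ℂ) := fun w => (1 / 2 : ℝ) • w + b with hA
  have hAD : ∀ w ∈ D, A w ∈ D := fun w hw =>
    hconv hw hxy (by norm_num) (by norm_num) (by norm_num)
  have hmap := map_half_add_restrict_le hD hAD
  have hAx : A x = y := by
    rw [hA, hb]; module
  have hAd : Differentiable ℂ A := by
    have : A = fun w => (1 / 2 : ℂ) • w + b := by
      ext w j; simp [hA]
    rw [this]; fun_prop
  have hKy := hK.1 y hy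
  have hmeas : AEStronglyMeasurable (fun z => K z y)
      (Measure.map A (volume.restrict D)) :=
    (hKy.2.aestronglyMeasurable.smul_measure _).mono_measure hmap
  have hAm : AEMeasurable A (volume.restrict D) := hAd.continuous.aemeasurable
  have hle : eLpNorm (fun w => K (A w) y) 2 (volume.restrict D) ≤
      ENNReal.ofReal (2 ^ n) * eLpNorm (fun z => K z y) 2 (volume.restrict D) := by
    have h1 := eLpNorm_map_measure (p := 2) hmeas hAm
    have h2 : eLpNorm ((fun z => K z y) ∘ A) 2 (volume.restrict D) =
      eLpNorm (fun w => K (A w) y) 2 (volume.restrict D) := rfl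
    rw [← h2, ← h1]
    refine (eLpNorm_mono_measure _ hmap).trans ?_
    rw [eLpNorm_smul_measure_of_ne_top (by simp)]
    refine le_of_eq ?_
    rw [smul_eq_mul]
    congr 1
    rw [ENNReal.ofReal_rpow_of_nonneg (by positivity) (by positivity)]
    congr 1
    rw [pow_mul', ENNReal.toReal_div]
    simp only [ENNReal.toReal_one, ENNReal.toReal_ofNat]
    rw [← Real.sqrt_eq_rpow, Real.sqrt_sq (by positivity)]
  have hFA : MemA2 D (fun w => K (A w) y) := by
    refine ⟨hKy.1.comp hAd.differentiableOn hAD, ?_, hle.trans_lt ?_⟩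
    · exact (hKy.1.comp hAd.differentiableOn hAD).continuousOn.aestronglyMeasurable
        hD.measurableSet
    · exact ENNReal.mul_lt_top ENNReal.ofReal_lt_top hKy.2.2
  have hnorm : ‖hFA.2.toLp _‖ ≤ 2 ^ n * ‖kernelVec hK y‖ := by
    rw [kernelVec_eq hK hy, Lp.norm_toLp, Lp.norm_toLp]
    have := ENNReal.toReal_mono (ENNReal.mul_lt_top ENNReal.ofReal_lt_top hKy.2.2).ne hle
    rwa [ENNReal.toReal_mul, ENNReal.toReal_ofReal (by positivity)] at this
  have h3 := inner_kernelVec hK hx hFA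
  rw [hAx, kernel_diag_eq hK hy] at h3
  have h4 := norm_inner_le_norm (𝕜 := ℂ) (kernelVec hK x) (hFA.2.toLp _)
  rw [h3, Complex.norm_real, Real.norm_of_nonneg (by positivity)] at h4
  have hp : 0 < ‖kernelVec hK y‖ := norm_pos_iff.2 (kernelVec_ne_zero hbdd hK hy)
  refine le_of_mul_le_mul_right ?_ hp
  calc ‖kernelVec hK y‖ * ‖kernelVec hK y‖ = ‖kernelVec hK y‖ ^ 2 := by ring
    _ ≤ _ := h4
    _ ≤ ‖kernelVec hK x‖ * (2 ^ n * ‖kernelVec hK y‖) := by gcongr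
    _ = _ := by ring

theorem bergmanMetric_le_of_disc (hD : IsOpen D) (hconv : Convex ℝ D)
    (hbdd : Bornology.IsBounded D) (hK : IsBergmanKernel D K) {x ξ : Fin n → ℂ} {δ : ℝ}
    (hδ : 0 < δ) (hx : ∀ c : ℂ, ‖c‖ < δ → x + c • ξ ∈ D) :
    bergmanMetric K x ξ ≤ 2 ^ (n + 2) / δ := by
  have hxD : x ∈ D := by simpa using hx 0 (by simpa using hδ)
  have hne := kernelVec_ne_zero hbdd hK hxD
  have hp := norm_pos_iff.2 hne
  set e := fun u => (InnerProductSpace.toDual ℂ (Lp ℂ 2 (volume.restrict D))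
      (kernelVec hK u) : Lp ℂ 2 (volume.restrict D) →L[ℂ] ℂ) with he
  have hed : DifferentiableOn ℂ e D := differentiableOn_toDual_kernelVec hD hK
  have hmaps : MapsTo (fun c : ℂ => x + c • ξ) (ball 0 (δ / 2)) D := fun c hc =>
    hx c (by rw [mem_ball_zero_iff] at hc; linarith)
  have hd : DifferentiableOn ℂ (fun c : ℂ => e (x + c • ξ)) (ball 0 (δ / 2)) :=
    hed.comp (by fun_prop) hmaps
  have hb : ∀ c ∈ ball (0 : ℂ) (δ / 2), ‖e (x + c • ξ)‖ ≤ 2 ^ n * ‖kernelVec hK x‖ := by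
    intro c hc
    rw [he]
    simp only [LinearIsometryEquiv.norm_map]
    refine norm_kernelVec_le_of_reflection hD hconv hbdd hK hxD (hmaps hc) ?_
    have h1 : (2 : ℝ) • (x + c • ξ) - x = x + (2 * c) • ξ := by
      rw [mul_smul, two_smul, two_smul]; module
    rw [h1]
    apply hx
    rw [mem_ball_zero_iff] at hc
    rw [norm_mul, Complex.norm_ofNat]; linarith
  have h1 := norm_fderiv_le_of_bounded_on_ball (by positivity) hd hb
  have h2 : fderiv ℂ (fun c : ℂ => e (x + c • ξ)) 0 1 = fderiv ℂ e x ξ := by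
    have hl : HasFDerivAt (fun c : ℂ => x + c • ξ)
        ((ContinuousLinearMap.id ℂ ℂ).smulRight ξ) 0 :=
      ((ContinuousLinearMap.id ℂ ℂ).smulRight ξ).hasFDerivAt.const_add x
    have he0 : HasFDerivAt e (fderiv ℂ e x) (x + (0 : ℂ) • ξ) := by
      simpa using (hed.differentiableAt (hD.mem_nhds hxD)).hasFDerivAt
    have h5 : HasFDerivAt (e ∘ fun c : ℂ => x + c • ξ) _ 0 := he0.comp (0 : ℂ) hl
    change fderiv ℂ (e ∘ fun c : ℂ => x + c • ξ) 0 1 = _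
    rw [h5.fderiv]
    simp
  have h3 : ‖kernelDeriv (kernelVec hK) x ξ‖ ≤ 2 ^ (n + 2) / δ * ‖kernelVec hK x‖ := by
    have h4 : ‖kernelDeriv (kernelVec hK) x ξ‖ = ‖fderiv ℂ e x ξ‖ := by
      rw [kernelDeriv, rieszSymmReal_apply, LinearIsometryEquiv.norm_map]
    rw [h4, ← h2]
    refine (ContinuousLinearMap.le_opNorm _ _).trans ?_
    rw [norm_one, mul_one]
    refine h1.trans (le_of_eq ?_)
    field_simp
    ring
  rw [bergmanMetric, Real.sqrt_le_left (by positivity), bergmanQuad_eq_kernelVec hD hbdd hK hxD,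
    div_le_iff₀ (by positivity)]
  calc _ ≤ ‖kernelDeriv (kernelVec hK) x ξ‖ ^ 2 * ‖kernelVec hK x‖ ^ 2 := by
        linarith [sq_nonneg ‖inner ℂ (kernelVec hK x) (kernelDeriv (kernelVec hK) x ξ)‖]
    _ ≤ (2 ^ (n + 2) / δ * ‖kernelVec hK x‖) ^ 2 * ‖kernelVec hK x‖ ^ 2 := by gcongr
    _ = _ := by ring

end

section

variable {n : ℕ} {D : Set (Fin n → ℂ)} {K : (Fin n → ℂ) → (Fin n → ℂ) → ℂ}

theorem norm_sub_le_integral_bergmanMetric (hD : IsOpen D) (hbdd : Bornology.IsBounded D)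
    (hK : IsBergmanKernel D K) {C : ℝ} (hC : ∀ u ∈ D, ∀ w ∈ D, dist u w ≤ C)
    {γ : ℝ → (Fin n → ℂ)} {a b : ℝ} (hab : a < b) (hγ : ContDiffOn ℝ 1 γ (Icc a b))
    (hγD : ∀ t ∈ Icc a b, γ t ∈ D) (j : Fin n) :
    IntervalIntegrable (fun t => bergmanMetric K (γ t) (deriv γ t)) volume a b ∧
      ‖γ b j - γ a j‖ ≤ C * ∫ t in a..b, bergmanMetric K (γ t) (deriv γ t) := by
  obtain ⟨γ', hγ'⟩ : ∃ γ' : ℝ → Fin n → ℂ, γ' = derivWithin γ (Icc a b) := ⟨_, rfl⟩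
  have hγ'c : ContinuousOn γ' (Icc a b) :=
    hγ' ▸ hγ.continuousOn_derivWithin (uniqueDiffOn_Icc hab) le_rfl
  have hder : ∀ t ∈ Ioo a b, HasDerivAt γ (γ' t) t := fun t ht =>
    hγ' ▸ ((hγ.differentiableOn one_ne_zero t (Ioo_subset_Icc_self ht)).hasDerivWithinAt).hasDerivAt
      (Icc_mem_nhds ht.1 ht.2)
  have hpc : ContinuousOn (fun t => (γ t, γ' t)) (Icc a b) := hγ.continuousOn.prodMk hγ'c
  have hpm : MapsTo (fun t => (γ t, γ' t)) (Icc a b) (D ×ˢ univ) :=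
    fun t ht => ⟨hγD t ht, mem_univ _⟩
  have hmc : ContinuousOn (fun t => bergmanMetric K (γ t) (γ' t)) (Icc a b) := by
    have := (continuousOn_bergmanMetric hD hbdd hK).comp hpc hpm
    exact this
  have hae : ∀ᵐ t ∂volume, t ∈ Ioc a b →
      bergmanMetric K (γ t) (γ' t) = bergmanMetric K (γ t) (deriv γ t) := by
    have : ∀ᵐ t : ℝ ∂volume, t ≠ b := by
      rw [ae_iff]; simp
    filter_upwards [this] with t htb ht
    rw [(hder t ⟨ht.1, lt_of_le_of_ne ht.2 htb⟩).deriv]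
  have hInt : IntervalIntegrable (fun t => bergmanMetric K (γ t) (γ' t)) volume a b :=
    hmc.intervalIntegrable_of_Icc hab.le
  have hInt' : IntervalIntegrable (fun t => bergmanMetric K (γ t) (deriv γ t)) volume a b := by
    refine hInt.congr_ae ?_
    rw [uIoc_of_le hab.le]
    exact (ae_restrict_iff' measurableSet_Ioc).2 hae
  refine ⟨hInt', ?_⟩
  have hj : ContinuousOn (fun t => γ' t j) (Icc a b) := (continuous_apply j).comp_continuousOn hγ'c
  have hftc := intervalIntegral.integral_eq_sub_of_hasDerivAt_of_le hab.le
    (f := fun t => γ t j) (f' := fun t => γ' t j)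
    ((continuous_apply j).comp_continuousOn hγ.continuousOn)
    (fun t ht => (hasDerivAt_pi.1 (hder t ht)) j) (hj.intervalIntegrable_of_Icc hab.le)
  have hI : ∫ t in a..b, bergmanMetric K (γ t) (deriv γ t)
      = ∫ t in a..b, bergmanMetric K (γ t) (γ' t) := by
    rw [intervalIntegral.integral_of_le hab.le, intervalIntegral.integral_of_le hab.le]
    exact (setIntegral_congr_ae measurableSet_Ioc hae).symm
  rw [← hftc, hI, ← intervalIntegral.integral_const_mul]
  have hle : ∀ t ∈ Ioc a b, ‖γ' t j‖ ≤ C * bergmanMetric K (γ t) (γ' t) := fun t ht =>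
    norm_apply_le_mul_bergmanMetric hD hbdd hK hC (hγD t (Ioc_subset_Icc_self ht)) _ j
  exact intervalIntegral.norm_integral_le_of_norm_le hab.le (ae_of_all _ hle) (hInt.const_mul C)

theorem norm_sub_le_bergmanLength (hD : IsOpen D) (hbdd : Bornology.IsBounded D)
    (hK : IsBergmanKernel D K) {C : ℝ} (hC : ∀ u ∈ D, ∀ w ∈ D, dist u w ≤ C)
    {γ : ℝ → (Fin n → ℂ)} (hγ : PiecewiseC1 γ) (hγD : ∀ t ∈ Icc (0 : ℝ) 1, γ t ∈ D) (j : Fin n) :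
    ‖γ 1 j - γ 0 j‖ ≤ C * bergmanLength K γ := by
  obtain ⟨-, k, t, ht, ht0, ht1, hp⟩ := hγ
  have hmem : ∀ i, t i ∈ Icc (0 : ℝ) 1 := fun i =>
    ⟨ht0 ▸ ht.monotone (Fin.zero_le i), ht1 ▸ ht.monotone (Fin.le_last i)⟩
  have key : ∀ i, IntervalIntegrable (fun t => bergmanMetric K (γ t) (deriv γ t)) volume 0 (t i) ∧
      ‖γ (t i) j - γ 0 j‖ ≤ C * ∫ s in (0 : ℝ)..t i, bergmanMetric K (γ s) (deriv γ s) := by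
    intro i
    induction i using Fin.induction with
    | zero => rw [ht0]; simp
    | succ i ih =>
      have h := norm_sub_le_integral_bergmanMetric hD hbdd hK hC (ht i.castSucc_lt_succ) (hp i)
        (fun s hs => hγD s ⟨(hmem _).1.trans hs.1, hs.2.trans (hmem _).2⟩) j
      refine ⟨ih.1.trans h.1, ?_⟩
      rw [← intervalIntegral.integral_add_adjacent_intervals ih.1 h.1, mul_add]
      calc ‖γ (t i.succ) j - γ 0 j‖
          = ‖(γ (t i.castSucc) j - γ 0 j) + (γ (t i.succ) j - γ (t i.castSucc) j)‖ := by
            congr 1; ring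
        _ ≤ _ := (norm_add_le _ _).trans (add_le_add ih.2 h.2)
  have := (key (Fin.last k)).2
  rwa [ht1] at this

theorem bergmanLength_nonneg (γ : ℝ → (Fin n → ℂ)) : 0 ≤ bergmanLength K γ :=
  intervalIntegral.integral_nonneg zero_le_one fun _ _ => Real.sqrt_nonneg _

theorem piecewiseC1_segment (x y : Fin n → ℂ) : PiecewiseC1 fun t : ℝ => x + t • (y - x) := by
  have h : ContDiff ℝ 1 fun t : ℝ => x + t • (y - x) := by fun_prop
  refine ⟨h.continuous.continuousOn, 1, ![0, 1], ?_, rfl, rfl, fun _ => h.contDiffOn⟩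
  rw [Fin.strictMono_iff_lt_succ]
  intro i
  fin_cases i
  simp

theorem segment_mem (hconv : Convex ℝ D) {x y : Fin n → ℂ} (hx : x ∈ D) (hy : y ∈ D) :
    ∀ t ∈ Icc (0 : ℝ) 1, x + t • (y - x) ∈ D := fun _ ht =>
  hconv.add_smul_sub_mem hx hy ht

theorem bergmanLength_segment_mem (hconv : Convex ℝ D) {x y : Fin n → ℂ} (hx : x ∈ D)
    (hy : y ∈ D) : bergmanLength K (fun t : ℝ => x + t • (y - x)) ∈
      {L : ℝ | ∃ γ : ℝ → (Fin n → ℂ), γ 0 = x ∧ γ 1 = y ∧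
        (∀ t ∈ Set.Icc (0:ℝ) 1, γ t ∈ D) ∧ PiecewiseC1 γ ∧ L = bergmanLength K γ} :=
  ⟨fun t : ℝ => x + t • (y - x), by simp, by simp, segment_mem hconv hx hy,
    piecewiseC1_segment x y, rfl⟩

theorem bergmanDist_le_of_segment (hconv : Convex ℝ D) {x y : Fin n → ℂ} (hx : x ∈ D) (hy : y ∈ D)
    {B : ℝ} (hB : ∀ t ∈ Icc (0 : ℝ) 1, bergmanMetric K (x + t • (y - x)) (y - x) ≤ B) :
    bergmanDist D K x y ≤ B := by
  unfold bergmanDist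
  refine (csInf_le ⟨0, ?_⟩ (bergmanLength_segment_mem hconv hx hy)).trans ?_
  · rintro _ ⟨γ, -, -, -, -, rfl⟩
    exact bergmanLength_nonneg γ
  · have hd : ∀ t : ℝ, deriv (fun t : ℝ => x + t • (y - x)) t = y - x := fun t => by
      have := ((hasDerivAt_id t).smul_const (y - x)).const_add x
      simpa using this.deriv
    have := intervalIntegral.norm_integral_le_of_norm_le_const (a := (0 : ℝ)) (b := 1) (C := B)
      (f := fun t : ℝ => bergmanMetric K (x + t • (y - x)) (deriv (fun t : ℝ => x + t • (y - x)) t))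
      (fun t ht => by
        rw [uIoc_of_le zero_le_one] at ht
        rw [hd, Real.norm_of_nonneg (show 0 ≤ bergmanMetric K _ _ from Real.sqrt_nonneg _)]
        exact hB t (Ioc_subset_Icc_self ht))
    rw [sub_zero, abs_one, mul_one] at this
    exact (Real.le_norm_self _).trans this

theorem exists_map_of_fridmanInv_lt (hD : IsOpen D) (hbdd : Bornology.IsBounded D)
    (hconv : Convex ℝ D) (hK : IsBergmanKernel D K) {p : Fin n → ℂ} (hp : p ∈ D) {c : ℝ}
    (hc : 0 < c) (h : fridmanInv D K p < 1 / c) :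
    ∃ r, c < r ∧ ∃ f : (Fin n → ℂ) → (Fin n → ℂ),
      DifferentiableOn ℂ f (euclUnitBall n) ∧ InjOn f (euclUnitBall n) ∧
      f '' euclUnitBall n ⊆ D ∧ bergmanBall D K p r ⊆ f '' euclUnitBall n := by
  have hne : {c : ℝ | ∃ r : ℝ, 0 < r ∧ c = 1 / r ∧ ∃ f : (Fin n → ℂ) → (Fin n → ℂ),
      DifferentiableOn ℂ f (euclUnitBall n) ∧ InjOn f (euclUnitBall n) ∧
      f '' euclUnitBall n ⊆ D ∧ bergmanBall D K p r ⊆ f '' euclUnitBall n}.Nonempty := by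
    obtain ⟨C, hC⟩ := Metric.isBounded_iff.1 hbdd
    have hC' : ∀ u ∈ D, ∀ w ∈ D, dist u w ≤ C := fun u hu w hw => hC hu hw
    have hC0 : 0 ≤ C := dist_nonneg.trans (hC' p hp p hp)
    obtain ⟨R, hR, hRD⟩ := Metric.isOpen_iff.1 hD p hp
    set r := R / ((C + 1) * (n + 1)) with hr
    have hrpos : 0 < r := by positivity
    refine ⟨1 / r, r, hrpos, rfl, fun z => p + (R : ℂ) • z, by fun_prop, ?_, ?_, ?_⟩
    · intro x _ y _ hxy
      have h1 : (R : ℂ) • x = (R : ℂ) • y := add_left_cancel hxy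
      exact smul_right_injective _ (Complex.ofReal_ne_zero.2 hR.ne') h1
    · rintro _ ⟨z, hz, rfl⟩
      apply hRD
      rw [mem_ball, dist_eq_norm, add_sub_cancel_left, norm_smul, Complex.norm_real,
        Real.norm_of_nonneg hR.le]
      have : ‖z‖ < 1 := by
        rw [pi_norm_lt_iff one_pos]
        intro i
        have h1 : ‖z i‖ ^ 2 ≤ ∑ μ, ‖z μ‖ ^ 2 :=
          Finset.single_le_sum (f := fun μ => ‖z μ‖ ^ 2) (fun _ _ => by positivity)
            (Finset.mem_univ i)
        have h2 : ∑ μ, ‖z μ‖ ^ 2 < 1 := hz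
        nlinarith [norm_nonneg (z i)]
      nlinarith
    · rintro z ⟨hz, hzr⟩
      unfold bergmanDist at hzr
      obtain ⟨_, ⟨γ, h0, h1, hγD, hγ, rfl⟩, hlt⟩ := exists_lt_of_csInf_lt
        ⟨_, bergmanLength_segment_mem hconv hp hz⟩ hzr
      have hj : ∀ j, ‖z j - p j‖ ≤ C * r := fun j => by
        have := norm_sub_le_bergmanLength hD hbdd hK hC' hγ hγD j
        rw [h0, h1] at this
        exact this.trans (by gcongr)
      have hR0 : (R : ℂ) ≠ 0 := Complex.ofReal_ne_zero.2 hR.ne'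
      refine ⟨(R : ℂ)⁻¹ • (z - p), ?_, ?_⟩
      · show ∑ μ, ‖((R : ℂ)⁻¹ • (z - p)) μ‖ ^ 2 < 1
        have hb : ∀ μ ∈ Finset.univ, ‖((R : ℂ)⁻¹ • (z - p)) μ‖ ^ 2 ≤ (1 / ((n : ℝ) + 1)) ^ 2 := by
          intro μ _
          gcongr
          rw [Pi.smul_apply, smul_eq_mul, norm_mul, norm_inv, Complex.norm_real,
            Real.norm_of_nonneg hR.le, Pi.sub_apply, inv_mul_le_iff₀ hR]
          refine (hj μ).trans ?_
          rw [hr, mul_div_assoc', mul_one_div, div_le_div_iff₀ (by positivity) (by positivity)]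
          have : 0 ≤ R * (n + 1) := by positivity
          nlinarith
        refine (Finset.sum_le_sum hb).trans_lt ?_
        rw [Finset.sum_const, Finset.card_univ, Fintype.card_fin, nsmul_eq_mul, one_div, inv_pow,
          ← div_eq_mul_inv, div_lt_one (by positivity)]
        nlinarith [Nat.cast_nonneg (α := ℝ) n]
      · show p + (R : ℂ) • (R : ℂ)⁻¹ • (z - p) = z
        rw [smul_inv_smul₀ hR0]; abel
  obtain ⟨_, ⟨r, hr, rfl, f, hf⟩, hlt⟩ := exists_lt_of_csInf_lt hne h
  exact ⟨r, (one_div_lt_one_div hr hc).1 hlt, f, hf⟩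

end

theorem single_eq_re_im {n : ℕ} (μ : Fin n) (c : ℂ) :
    (Pi.single μ c : Fin n → ℂ) =
      c.re • (Pi.single μ 1 : Fin n → ℂ) + c.im • (Pi.single μ Complex.I : Fin n → ℂ) := by
  rw [← Pi.single_smul, ← Pi.single_smul, ← Pi.single_add]
  congr 1
  apply Complex.ext <;> simp

theorem hasFDerivAt_ofReal {n : ℕ} {f : (Fin n → ℂ) → ℝ} {f' : (Fin n → ℂ) →L[ℝ] ℝ}
    {z : Fin n → ℂ} (h : HasFDerivAt f f' z) :
    HasFDerivAt (fun u => (f u : ℂ)) (Complex.ofRealCLM.comp f') z :=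
  Complex.ofRealCLM.hasFDerivAt.comp z h

theorem fderiv_eq_two_mul_re_sum_wderiv {n : ℕ} {ρ : (Fin n → ℂ) → ℝ} {p : Fin n → ℂ}
    (hρ : DifferentiableAt ℝ ρ p) (ξ : Fin n → ℂ) :
    fderiv ℝ ρ p ξ = 2 * (∑ μ, wderiv μ (fun u => (ρ u : ℂ)) p * ξ μ).re := by
  conv_lhs => rw [← Finset.univ_sum_single ξ]
  rw [map_sum, Complex.re_sum, Finset.mul_sum]
  refine Finset.sum_congr rfl fun μ _ => ?_
  rw [single_eq_re_im, map_add, map_smul, map_smul, wderiv,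
      (hasFDerivAt_ofReal hρ.hasFDerivAt).fderiv]
  simp
  ring

theorem four_mul_leviForm {n : ℕ} {ρ : (Fin n → ℂ) → ℝ} (hρ : ContDiff ℝ 2 ρ)
    (p ξ : Fin n → ℂ) :
    4 * leviForm ρ p ξ = fderiv ℝ (fderiv ℝ ρ) p ξ ξ +
      fderiv ℝ (fderiv ℝ ρ) p (Complex.I • ξ) (Complex.I • ξ) := by
  set H := fderiv ℝ (fderiv ℝ ρ) p with hH
  have hd : Differentiable ℝ ρ := hρ.differentiable (by norm_num)
  have hd2 : HasFDerivAt (fderiv ℝ ρ) H p :=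
    ((hρ.fderiv_right (m := 1) (by norm_num)).differentiable (by norm_num) p).hasFDerivAt
  have hbar : ∀ ν, (fun w => wderivBar ν (fun u => (ρ u : ℂ)) w) = fun w =>
      ((fderiv ℝ ρ w (Pi.single ν 1) : ℂ) + Complex.I *
        fderiv ℝ ρ w (Pi.single ν Complex.I)) / 2 := by
    intro ν
    ext w
    rw [wderivBar, (hasFDerivAt_ofReal (hd w).hasFDerivAt).fderiv]
    simp
  have hev : ∀ e, HasFDerivAt (fun w => (fderiv ℝ ρ w e : ℂ))
      (Complex.ofRealCLM.comp (H.flip e)) p := fun e => by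
    refine hasFDerivAt_ofReal ?_
    have := hd2.clm_apply (hasFDerivAt_const e p)
    simpa using this
  have hw : ∀ μ ν, wderiv μ (fun w => wderivBar ν (fun u => (ρ u : ℂ)) w) p =
      (((H (Pi.single μ 1) (Pi.single ν 1) + H (Pi.single μ Complex.I) (Pi.single ν Complex.I) : ℝ)
        : ℂ) + Complex.I * ((H (Pi.single μ 1) (Pi.single ν Complex.I)
          - H (Pi.single μ Complex.I) (Pi.single ν 1) : ℝ) : ℂ)) / 4 := by
    intro μ ν
    rw [hbar, wderiv, (((hev (Pi.single ν 1)).fun_add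
      ((hev (Pi.single ν Complex.I)).const_mul Complex.I)).mul_const (1 / 2 : ℂ)
          |>.congr_of_eventuallyEq
        (Eventually.of_forall fun x => by ring)).fderiv]
    simp
    linear_combination (-(1 / 4) * (H (Pi.single μ Complex.I) (Pi.single ν Complex.I) : ℂ)) *
        Complex.I_sq
  have hexp : ∀ η : Fin n → ℂ, H η η = ∑ μ, ∑ ν, H (Pi.single μ (η μ)) (Pi.single ν (η ν)) := by
    intro η
    have h1 : ∀ x, H x η = ∑ ν, H x (Pi.single ν (η ν)) := fun x => by
      rw [← map_sum, Finset.univ_sum_single]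
    have h2 : ∀ y, H η y = ∑ μ, H (Pi.single μ (η μ)) y := fun y => by
      conv_lhs => rw [← Finset.univ_sum_single η, ← ContinuousLinearMap.flip_apply, map_sum]
      rfl
    rw [h2]
    exact Finset.sum_congr rfl fun μ _ => h1 _
  rw [leviForm, hexp, hexp, Complex.re_sum, Finset.mul_sum, ← Finset.sum_add_distrib]
  refine Finset.sum_congr rfl fun μ _ => ?_
  rw [Complex.re_sum, Finset.mul_sum, ← Finset.sum_add_distrib]
  refine Finset.sum_congr rfl fun ν _ => ?_
  rw [hw, single_eq_re_im μ (ξ μ), single_eq_re_im ν (ξ ν), single_eq_re_im μ ((Complex.I • ξ) μ),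
    single_eq_re_im ν ((Complex.I • ξ) ν)]
  simp only [map_add, map_smul, add_apply, smul_apply, smul_eq_mul, Pi.smul_apply,
    Complex.mul_re, Complex.mul_im, Complex.I_re, Complex.I_im, Complex.div_ofNat_re,
    Complex.div_ofNat_im, Complex.add_re, Complex.add_im, Complex.ofReal_re, Complex.ofReal_im,
    Complex.conj_re, Complex.conj_im]
  ring

theorem exists_taylor_two_bound {h : ℝ → ℝ} (hh : ContDiff ℝ 3 h) :
    ∃ M, ∀ s ∈ Icc (0 : ℝ) 1,
      |h s - (h 0 + s * deriv h 0 + s ^ 2 / 2 * deriv (deriv h) 0)| ≤ M * s ^ 3 := by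
  obtain ⟨C, hC⟩ := exists_taylor_mean_remainder_bound (f := h) (n := 2) zero_le_one
    (a := (0 : ℝ)) (b := 1) (by exact_mod_cast hh.contDiffOn)
  refine ⟨C, fun s hs => ?_⟩
  have := hC s hs
  have hu := uniqueDiffOn_Icc (zero_lt_one (α := ℝ))
  have h0 : (0 : ℝ) ∈ Icc (0 : ℝ) 1 := ⟨le_rfl, zero_le_one⟩
  have e1 : iteratedDerivWithin 1 h (Icc 0 1) 0 = deriv h 0 := by
    rw [iteratedDerivWithin_eq_iteratedDeriv hu (hh.contDiffAt.of_le (by norm_num)) h0,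
      iteratedDeriv_one]
  have e2 : iteratedDerivWithin 2 h (Icc 0 1) 0 = deriv (deriv h) 0 := by
    rw [iteratedDerivWithin_eq_iteratedDeriv hu (hh.contDiffAt.of_le (by norm_num)) h0,
      iteratedDeriv_succ, iteratedDeriv_one]
  rw [taylorWithinEval_succ, taylorWithinEval_succ, taylor_within_zero_eval] at this
  norm_num [e1, e2] at this
  refine le_trans (le_of_eq ?_) this
  congr 1
  ring

theorem exists_taylor_two_bound_line {E : Type} [NormedAddCommGroup E] [NormedSpace ℝ E]
    {ρ : E → ℝ} (hρ : ContDiff ℝ 3 ρ) (q u : E) :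
    ∃ M, ∀ s ∈ Icc (0 : ℝ) 1, |ρ (q + s • u) -
      (ρ q + s * fderiv ℝ ρ q u + s ^ 2 / 2 * fderiv ℝ (fderiv ℝ ρ) q u u)| ≤ M * s ^ 3 := by
  have hl : ∀ s : ℝ, HasDerivAt (fun s : ℝ => q + s • u) u s := fun s => by
    simpa using ((hasDerivAt_id s).smul_const u).const_add q
  have hd : Differentiable ℝ ρ := hρ.differentiable (by norm_num)
  have hd2 : Differentiable ℝ (fderiv ℝ ρ) :=
    (hρ.fderiv_right (m := 2) (by norm_num)).differentiable (by norm_num)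
  have h1 : deriv (fun s : ℝ => ρ (q + s • u)) = fun s => fderiv ℝ ρ (q + s • u) u := by
    ext s
    exact ((hd _).hasFDerivAt.comp_hasDerivAt s (hl s)).deriv
  have h2 : deriv (fun s : ℝ => fderiv ℝ ρ (q + s • u) u) 0 = fderiv ℝ (fderiv ℝ ρ) q u u := by
    have := (((hd2 _).hasFDerivAt.comp_hasDerivAt 0 (hl 0)).clm_apply (hasDerivAt_const 0 u)).deriv
    simpa using this
  obtain ⟨M, hM⟩ := exists_taylor_two_bound (h := fun s : ℝ => ρ (q + s • u))
    (hρ.comp (by fun_prop))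
  refine ⟨M, fun s hs => ?_⟩
  have := hM s hs
  rw [h1, h2] at this
  simpa using this

section
variable {E : Type} [NormedAddCommGroup E] [NormedSpace ℝ E] {ρ : E → ℝ}

theorem exists_descent (hρ : ContDiff ℝ 1 ρ) {q ν : E} (hν : 1 < fderiv ℝ ρ q ν) :
    ∃ δ > 0, ∀ w, ‖w - q‖ < δ → ∀ t, 0 ≤ t → t ≤ δ → ρ (w - t • ν) ≤ ρ w - t := by
  have hc : ContinuousAt (fun z => fderiv ℝ ρ z ν) q :=
    ((hρ.continuous_fderiv one_ne_zero).clm_apply continuous_const).continuousAt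
  obtain ⟨δ₀, hδ₀, h⟩ := Metric.eventually_nhds_iff.1 (hc.eventually (lt_mem_nhds hν))
  have hd : Differentiable ℝ ρ := hρ.differentiable one_ne_zero
  refine ⟨δ₀ / (2 * (1 + ‖ν‖)), by positivity, fun w hw t ht0 ht => ?_⟩
  have hder : ∀ τ : ℝ, HasDerivAt (fun τ : ℝ => ρ (w - τ • ν) + τ)
      (fderiv ℝ ρ (w - τ • ν) (-ν) + 1) τ := fun τ => by
    have hl : HasDerivAt (fun τ : ℝ => w - τ • ν) (-ν) τ := by
      simpa using ((hasDerivAt_id τ).smul_const ν).const_sub w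
    exact ((hd _).hasFDerivAt.comp_hasDerivAt τ hl).fun_add (hasDerivAt_id τ)
  have hanti : AntitoneOn (fun τ : ℝ => ρ (w - τ • ν) + τ) (Icc 0 t) := by
    refine antitoneOn_of_deriv_nonpos (convex_Icc 0 t)
      (fun τ _ => (hder τ).continuousAt.continuousWithinAt)
      (fun τ _ => (hder τ).differentiableAt.differentiableWithinAt) fun τ hτ => ?_
    rw [interior_Icc] at hτ
    rw [(hder τ).deriv, map_neg]
    have hτδ : τ ≤ δ₀ / (2 * (1 + ‖ν‖)) := hτ.2.le.trans ht
    rw [le_div_iff₀ (by positivity)] at hτδ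
    rw [lt_div_iff₀ (by positivity)] at hw
    have : 1 < fderiv ℝ ρ (w - τ • ν) ν := by
      refine h ?_
      rw [dist_eq_norm]
      calc ‖w - τ • ν - q‖ = ‖(w - q) - τ • ν‖ := by congr 1; abel
        _ ≤ ‖w - q‖ + τ * ‖ν‖ := by
          refine (norm_sub_le _ _).trans_eq ?_
          rw [norm_smul, Real.norm_of_nonneg hτ.1.le]
        _ < δ₀ := by nlinarith [norm_nonneg ν, norm_nonneg (w - q), hτ.1]
    linarith
  have := hanti (left_mem_Icc.2 ht0) (right_mem_Icc.2 ht0) ht0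
  simp only [zero_smul, sub_zero, add_zero] at this
  linarith

theorem add_smul_sub_smul_neg {q ν u : E} {δ M : ℝ} {k : ℕ}
    (hdesc : ∀ w, ‖w - q‖ < δ → ∀ t, 0 ≤ t → t ≤ δ → ρ (w - t • ν) ≤ ρ w - t)
    (hM : ∀ s ∈ Icc (0 : ℝ) 1, ρ (q + s • u) ≤ M * s ^ k) {s t : ℝ} (hs : s ∈ Icc (0 : ℝ) 1)
    (hsu : s * ‖u‖ < δ) (ht : 0 ≤ t) (htδ : t ≤ δ) (hst : M * s ^ k < t) :
    ρ (q - t • ν + s • u) < 0 := by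
  have h1 := hdesc (q + s • u) (by
    rwa [add_sub_cancel_left, norm_smul, Real.norm_of_nonneg hs.1]) t ht htδ
  have h2 := hM s hs
  rw [show q - t • ν + s • u = q + s • u - t • ν by abel]
  linarith

end

theorem exists_pos_of_continuous_of_pos {g : ℝ → ℝ} (hg : Continuous g) (h0 : 0 < g 0) :
    ∃ s ∈ Ioc (0 : ℝ) 1, 0 < g s := by
  obtain ⟨δ, hδ, h⟩ := Metric.eventually_nhds_iff.1 (hg.continuousAt.eventually (lt_mem_nhds h0))
  refine ⟨min 1 (δ / 2), ⟨by positivity, min_le_left _ _⟩, h ?_⟩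
  rw [dist_zero_right, Real.norm_of_nonneg (by positivity)]
  exact (min_le_right _ _).trans_lt (by linarith)

theorem add_smul_mem_of_four {E : Type} [NormedAddCommGroup E] [NormedSpace ℂ E] {D : Set E}
    (hconv : Convex ℝ D) {p v : E} {s : ℝ} (h1 : p + s • v ∈ D) (h2 : p + s • (-v) ∈ D)
    (h3 : p + s • (Complex.I • v) ∈ D) (h4 : p + s • (-(Complex.I • v)) ∈ D) {c : ℂ}
    (hc : ‖c‖ ≤ s / 2) : p + c • v ∈ D := by
  have key : ∀ u : E, p + s • u ∈ D → p + s • (-u) ∈ D → ∀ a : ℝ, |a| ≤ s / 2 →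
      p + (2 * a) • u ∈ D := by
    intro u hu hu' a ha
    rcases eq_or_lt_of_le ((abs_nonneg a).trans ha) with h0 | h0
    · have ha0 : a = 0 := by rw [← h0] at ha; exact abs_nonpos_iff.1 ha
      have hs0 : s = 0 := by linarith
      simpa [ha0, hs0] using hu
    · have hs : 0 < s := by linarith
      rw [abs_le] at ha
      have := hconv hu hu' (a := 1 / 2 + a / s) (b := 1 / 2 - a / s)
        (by have : -(1 / 2) ≤ a / s := by rw [le_div_iff₀ hs]; linarith
            linarith)
        (by have : a / s ≤ 1 / 2 := by rw [div_le_iff₀ hs]; linarith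
            linarith) (by ring)
      convert this using 1
      rw [show (2 * a) • u = ((1 / 2 + a / s) * s - (1 / 2 - a / s) * s) • u by
        congr 1; field_simp; ring]
      module
  have ha := key v h1 h2 c.re ((Complex.abs_re_le_norm c).trans hc)
  have hb := key (Complex.I • v) h3 h4 c.im ((Complex.abs_im_le_norm c).trans hc)
  have := hconv ha hb (a := 1 / 2) (b := 1 / 2) (by norm_num) (by norm_num) (by norm_num)
  convert this using 1
  have : c • v = c.re • v + c.im • (Complex.I • v) := by
    conv_lhs => rw [← Complex.re_add_im c, add_smul, mul_smul]
    simp only [Complex.coe_smul]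
  rw [this]
  module

theorem exists_cubic_region {E : Type} [NormedAddCommGroup E] [NormedSpace ℂ E] {D : Set E}
    (hconv : Convex ℝ D) {ρ : E → ℝ} (hD : ∀ z, ρ z < 0 → z ∈ D) {q ν v : E} {δ : ℝ} (hδ : 0 < δ)
    (hdesc : ∀ w, ‖w - q‖ < δ → ∀ t, 0 ≤ t → t ≤ δ → ρ (w - t • ν) ≤ ρ w - t) {M₁ M₂ M₃ M₄ : ℝ}
    (hM₁ : ∀ s ∈ Icc (0 : ℝ) 1, ρ (q + s • v) ≤ M₁ * s ^ 3)
    (hM₂ : ∀ s ∈ Icc (0 : ℝ) 1, ρ (q + s • -v) ≤ M₂ * s ^ 3)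
    (hM₃ : ∀ s ∈ Icc (0 : ℝ) 1, ρ (q + s • Complex.I • v) ≤ M₃ * s ^ 3)
    (hM₄ : ∀ s ∈ Icc (0 : ℝ) 1, ρ (q + s • -(Complex.I • v)) ≤ M₄ * s ^ 3) :
    ∃ c > 0, ∃ t₁ > 0, ∀ t : ℝ, 0 < t → t ≤ t₁ → ∀ w : ℂ, ‖w‖ ≤ c * t ^ (1 / 3 : ℝ) →
      q - t • ν + w • v ∈ D := by
  set M := 1 + |M₁| + |M₂| + |M₃| + |M₄| with hMdef
  have a1 := abs_nonneg M₁
  have a2 := abs_nonneg M₂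
  have a3 := abs_nonneg M₃
  have a4 := abs_nonneg M₄
  have hM1 : 1 ≤ M := by rw [hMdef]; linarith
  set κ := min 1 (δ / (1 + ‖v‖)) with hκ
  have hκ0 : 0 < κ := by positivity
  refine ⟨1 / (4 * M), by positivity, min δ (κ ^ 3), by positivity, fun t ht htt w hw => ?_⟩
  set s := t ^ (1 / 3 : ℝ) / (2 * M) with hs
  have hr0 : 0 ≤ t ^ (1 / 3 : ℝ) := by positivity
  have hs0 : 0 < s := by positivity
  have hr3 : (t ^ (1 / 3 : ℝ)) ^ 3 = t := by
    rw [← Real.rpow_natCast, ← Real.rpow_mul ht.le]; norm_num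
  have hrκ : t ^ (1 / 3 : ℝ) ≤ κ :=
    (pow_le_pow_iff_left₀ hr0 hκ0.le three_ne_zero).1 (hr3.trans_le (htt.trans (min_le_right _ _)))
  have hsr : s < t ^ (1 / 3 : ℝ) := by
    rw [hs, div_lt_iff₀ (by positivity)]
    have : 0 < t ^ (1 / 3 : ℝ) := by positivity
    nlinarith
  have hs1 : s ∈ Icc (0 : ℝ) 1 := ⟨hs0.le, hsr.le.trans (hrκ.trans (min_le_left _ _))⟩
  have hsv : s * ‖v‖ < δ := by
    have : s ≤ δ / (1 + ‖v‖) := hsr.le.trans (hrκ.trans (min_le_right _ _))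
    rw [le_div_iff₀ (by positivity)] at this
    nlinarith
  have hst : M * s ^ 3 < t := by
    rw [hs, div_pow, hr3, mul_pow, mul_div_assoc', div_lt_iff₀ (by positivity)]
    have : M ≤ M ^ 3 := le_self_pow₀ hM1 three_ne_zero
    nlinarith
  have hfin : ∀ M' u, M' ≤ M → ‖u‖ = ‖v‖ → (∀ s ∈ Icc (0 : ℝ) 1, ρ (q + s • u) ≤ M' * s ^ 3) →
      q - t • ν + s • u ∈ D := by
    intro M' u hM' hu hb
    apply hD
    refine add_smul_sub_smul_neg hdesc hb hs1 (by rwa [hu]) ht.le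
      (htt.trans (min_le_left _ _)) (lt_of_le_of_lt ?_ hst)
    gcongr
  have hIn : ‖Complex.I • v‖ = ‖v‖ := by rw [norm_smul, Complex.norm_I, one_mul]
  refine add_smul_mem_of_four hconv
    (hfin M₁ v (by linarith [le_abs_self M₁]) rfl hM₁)
    (hfin M₂ (-v) (by linarith [le_abs_self M₂]) (norm_neg v) hM₂)
    (hfin M₃ _ (by linarith [le_abs_self M₃]) hIn hM₃)
    (hfin M₄ _ (by linarith [le_abs_self M₄]) ((norm_neg _).trans hIn) hM₄) (hw.trans_eq ?_)
  rw [hs]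
  field_simp
  norm_num

theorem exists_quadratic_region {E : Type} [NormedAddCommGroup E] [NormedSpace ℂ E] {D : Set E}
    {ρ : E → ℝ} (hD : ∀ z, ρ z < 0 → z ∈ D) {q ν : E} {δ : ℝ} (hδ : 0 < δ)
    (hdesc : ∀ w, ‖w - q‖ < δ → ∀ t, 0 ≤ t → t ≤ δ → ρ (w - t • ν) ≤ ρ w - t) {M₁ M₂ : ℝ}
    (hM₁ : ∀ s ∈ Icc (0 : ℝ) 1, ρ (q + s • Complex.I • ν) ≤ M₁ * s ^ 2)
    (hM₂ : ∀ s ∈ Icc (0 : ℝ) 1, ρ (q + s • -(Complex.I • ν)) ≤ M₂ * s ^ 2) :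
    ∃ c > 0, ∃ t₁ > 0, ∀ x : ℝ, 0 < x → x ≤ t₁ → ∀ y : ℝ, y ^ 2 ≤ c * x →
      q - ((x : ℂ) + y * Complex.I) • ν ∈ D := by
  set M := 1 + |M₁| + |M₂| with hMdef
  have a1 := abs_nonneg M₁
  have a2 := abs_nonneg M₂
  have hM1 : 1 ≤ M := by rw [hMdef]; linarith
  set κ := min 1 (δ / (1 + ‖ν‖)) with hκ
  have hκ0 : 0 < κ := by positivity
  refine ⟨1 / (2 * M), by positivity, min δ (κ ^ 2), by positivity, fun x hx hxx y hy => ?_⟩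
  rw [div_mul_eq_mul_div, one_mul, le_div_iff₀ (by positivity)] at hy
  have hyκ : |y| ≤ κ := by
    rw [← sq_le_sq₀ (abs_nonneg y) hκ0.le, sq_abs]
    have : x ≤ κ ^ 2 := hxx.trans (min_le_right _ _)
    nlinarith [sq_nonneg y]
  have hs1 : |y| ∈ Icc (0 : ℝ) 1 := ⟨abs_nonneg y, hyκ.trans (min_le_left _ _)⟩
  have hsv : |y| * ‖ν‖ < δ := by
    have : |y| ≤ δ / (1 + ‖ν‖) := hyκ.trans (min_le_right _ _)
    rw [le_div_iff₀ (by positivity)] at this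
    rcases eq_or_lt_of_le (abs_nonneg y) with h0 | h0
    · rw [← h0, zero_mul]; exact hδ
    · nlinarith
  have hst : M * |y| ^ 2 < x := by
    rw [sq_abs]; nlinarith
  have hIn : ‖Complex.I • ν‖ = ‖ν‖ := by rw [norm_smul, Complex.norm_I, one_mul]
  have hfin : ∀ M' u, M' ≤ M → ‖u‖ = ‖ν‖ → (∀ s ∈ Icc (0 : ℝ) 1, ρ (q + s • u) ≤ M' * s ^ 2) →
      q - x • ν + |y| • u ∈ D := by
    intro M' u hM' hu hb
    apply hD
    refine add_smul_sub_smul_neg hdesc hb hs1 (by rwa [hu]) hx.le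
      (hxx.trans (min_le_left _ _)) (lt_of_le_of_lt ?_ hst)
    gcongr
  have hre : q - ((x : ℂ) + y * Complex.I) • ν = q - x • ν - y • (Complex.I • ν) := by
    rw [add_smul, mul_smul, Complex.coe_smul, Complex.coe_smul, sub_sub]
  rw [hre]
  rcases le_total 0 y with h0 | h0
  · have := hfin M₂ _ (by linarith [le_abs_self M₂]) ((norm_neg _).trans hIn) hM₂
    rwa [abs_of_nonneg h0, smul_neg, ← sub_eq_add_neg] at this
  · have := hfin M₁ _ (by linarith [le_abs_self M₁]) hIn hM₁
    rwa [abs_of_nonpos h0, neg_smul, ← sub_eq_add_neg] at this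

theorem exists_local_geometry {n : ℕ} {D : Set (Fin n → ℂ)} (hopen : IsOpen D)
    (hconv : Convex ℝ D) {ρ : (Fin n → ℂ) → ℝ} (hρ : ContDiff ℝ 3 ρ)
    (hdef : IsDefiningFunction D ρ) {q : Fin n → ℂ} (hq : q ∈ frontier D) {v : Fin n → ℂ}
    (hv : v ∈ complexTangent ρ q) (hlev : leviForm ρ q v ≤ 0) :
    ∃ (L : (Fin n → ℂ) →L[ℂ] ℂ) (ν : Fin n → ℂ), L ν = 1 ∧ L v = 0 ∧
      (∀ z ∈ D, (L (z - q)).re < 0) ∧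
      (∃ c > 0, ∃ t₁ > 0, ∀ t : ℝ, 0 < t → t ≤ t₁ → ∀ w : ℂ, ‖w‖ ≤ c * t ^ (1 / 3 : ℝ) →
        q - t • ν + w • v ∈ D) ∧
      ∃ c > 0, ∃ t₁ > 0, ∀ x : ℝ, 0 < x → x ≤ t₁ → ∀ y : ℝ, y ^ 2 ≤ c * x →
        q - ((x : ℂ) + y * Complex.I) • ν ∈ D := by
  have hd : Differentiable ℝ ρ := hρ.differentiable (by norm_num)
  set L : (Fin n → ℂ) →L[ℂ] ℂ :=
    ∑ μ, wderiv μ (fun u => (ρ u : ℂ)) q • ContinuousLinearMap.proj (R := ℂ)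
        (φ := fun _ : Fin n => ℂ) μ with hL
  have hLa : ∀ ξ, L ξ = ∑ μ, wderiv μ (fun u => (ρ u : ℂ)) q * ξ μ := fun ξ => by
    rw [hL]; simp
  have hdL : ∀ ξ, fderiv ℝ ρ q ξ = 2 * (L ξ).re := fun ξ => by
    rw [hLa, fderiv_eq_two_mul_re_sum_wderiv (hd q)]
  have hLv : L v = 0 := by rw [hLa]; exact hv
  obtain ⟨ν, hν⟩ : ∃ ν, L ν = 1 := by
    obtain ⟨u, hu⟩ : ∃ u, fderiv ℝ ρ q u ≠ 0 := by
      by_contra! h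
      exact hdef.2 q hq (ContinuousLinearMap.ext h)
    have : L u ≠ 0 := fun h => hu (by rw [hdL, h]; simp)
    exact ⟨(L u)⁻¹ • u, by rw [map_smul, smul_eq_mul, inv_mul_cancel₀ this]⟩
  have hqD : q ∉ D := fun h => by
    rw [hopen.frontier_eq] at hq; exact hq.2 h
  have hqc : q ∈ closure D := frontier_subset_closure hq
  have hρq : ρ q = 0 := by
    refine le_antisymm ?_ (not_lt.1 fun h => hqD ((hdef.1 q).2 h))
    exact closure_minimal (fun z hz => ((hdef.1 z).1 hz).le)
      (isClosed_le hρ.continuous continuous_const) hqc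
  have hle : ∀ z ∈ D, (L (z - q)).re ≤ 0 := by
    intro z hz
    by_contra! hpos
    obtain ⟨M, hM⟩ := exists_taylor_two_bound_line hρ q (z - q)
    obtain ⟨s, hs, hsp⟩ := exists_pos_of_continuous_of_pos (g := fun s => fderiv ℝ ρ q (z - q) +
      s / 2 * fderiv ℝ (fderiv ℝ ρ) q (z - q) (z - q) - M * s ^ 2) (by fun_prop)
      (by simp only [hdL]; simpa using hpos)
    have h1 := (abs_le.1 (hM s (Ioc_subset_Icc_self hs))).1
    have h2 : q + s • (z - q) ∈ D := by
      have := hconv.openSegment_closure_interior_subset_interior hqc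
        (by rwa [hopen.interior_eq] : z ∈ interior D)
      rw [hopen.interior_eq] at this
      rcases eq_or_lt_of_le hs.2 with rfl | hs1
      · simpa using hz
      · exact this ⟨1 - s, s, by linarith, hs.1, by ring, by module⟩
    rw [hdef.1] at h2
    rw [hρq] at h1
    nlinarith [mul_pos hs.1 hsp]
  have hlt : ∀ z ∈ D, (L (z - q)).re < 0 := by
    intro z hz
    obtain ⟨r, hr, hrD⟩ := Metric.isOpen_iff.1 hopen z hz
    have h1 : z + (r / (2 * (1 + ‖ν‖))) • ν ∈ D := hrD (by
      rw [mem_ball, dist_eq_norm, add_sub_cancel_left, norm_smul, Real.norm_of_nonneg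
          (by positivity),
        div_mul_eq_mul_div, div_lt_iff₀ (by positivity)]
      nlinarith [norm_nonneg ν])
    have h2 := hle _ h1
    rw [add_sub_right_comm, map_add, ← Complex.coe_smul, map_smul, hν, Complex.add_re] at h2
    have : 0 < r / (2 * (1 + ‖ν‖)) := by positivity
    rw [smul_eq_mul, mul_one, Complex.ofReal_re] at h2
    linarith
  have hHnn : ∀ u, (L u).re = 0 → 0 ≤ fderiv ℝ (fderiv ℝ ρ) q u u := by
    intro u hu
    by_contra! hneg
    obtain ⟨M, hM⟩ := exists_taylor_two_bound_line hρ q u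
    obtain ⟨s, hs, hsp⟩ := exists_pos_of_continuous_of_pos
      (g := fun s => -(1 / 2 * fderiv ℝ (fderiv ℝ ρ) q u u) - M * s) (by fun_prop)
      (by simp only [mul_zero, sub_zero]; linarith)
    have h1 := (abs_le.1 (hM s (Ioc_subset_Icc_self hs))).2
    rw [hρq, hdL, hu] at h1
    have h2 : q + s • u ∈ D := by
      rw [hdef.1]
      nlinarith [mul_pos (pow_pos hs.1 2) hsp]
    have h3 := hlt _ h2
    rw [add_sub_cancel_left, ← Complex.coe_smul, map_smul, smul_eq_mul, Complex.re_ofReal_mul, hu]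
        at h3
    simp at h3
  have hbound3 : ∀ u, (L u).re = 0 → fderiv ℝ (fderiv ℝ ρ) q u u = 0 →
      ∃ M, ∀ s ∈ Icc (0 : ℝ) 1, ρ (q + s • u) ≤ M * s ^ 3 := by
    intro u hu hH
    obtain ⟨M, hM⟩ := exists_taylor_two_bound_line hρ q u
    refine ⟨M, fun s hs => ?_⟩
    have h1 := (abs_le.1 (hM s hs)).2
    rw [hρq, hdL, hu, hH] at h1
    linarith
  have hbound2 : ∀ u, (L u).re = 0 →
      ∃ M, ∀ s ∈ Icc (0 : ℝ) 1, ρ (q + s • u) ≤ M * s ^ 2 := by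
    intro u hu
    obtain ⟨M, hM⟩ := exists_taylor_two_bound_line hρ q u
    refine ⟨|M| + |fderiv ℝ (fderiv ℝ ρ) q u u|, fun s hs => ?_⟩
    have h1 := (abs_le.1 (hM s hs)).2
    rw [hρq, hdL, hu] at h1
    have h2 := le_abs_self M
    have h3 := le_abs_self (fderiv ℝ (fderiv ℝ ρ) q u u)
    have h4 : s ^ 3 ≤ s ^ 2 := pow_le_pow_of_le_one hs.1 hs.2 (by norm_num)
    have h5 : M * s ^ 3 ≤ |M| * s ^ 2 :=
      mul_le_mul h2 h4 (pow_nonneg hs.1 _) (abs_nonneg _)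
    have h6 := abs_nonneg (fderiv ℝ (fderiv ℝ ρ) q u u)
    nlinarith [sq_nonneg s]
  have hIv : L (Complex.I • v) = 0 := by rw [map_smul, hLv, smul_zero]
  have hsum := four_mul_leviForm (hρ.of_le (by norm_num)) q v
  have hv1 := hHnn v (by rw [hLv]; rfl)
  have hv2 := hHnn (Complex.I • v) (by rw [hIv]; rfl)
  have hHv : fderiv ℝ (fderiv ℝ ρ) q v v = 0 := by linarith
  have hHIv : fderiv ℝ (fderiv ℝ ρ) q (Complex.I • v) (Complex.I • v) = 0 := by linarith
  obtain ⟨δ, hδ, hdesc⟩ := exists_descent (hρ.of_le (by norm_num)) (q := q) (ν := ν)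
    (by rw [hdL, hν]; norm_num)
  refine ⟨L, ν, hν, hLv, hlt, ?_, ?_⟩
  · obtain ⟨M₁, hM₁⟩ := hbound3 v (by rw [hLv]; rfl) hHv
    obtain ⟨M₂, hM₂⟩ := hbound3 (-v) (by rw [map_neg, hLv]; simp) (by simpa using hHv)
    obtain ⟨M₃, hM₃⟩ := hbound3 (Complex.I • v) (by rw [hIv]; rfl) hHIv
    obtain ⟨M₄, hM₄⟩ := hbound3 (-(Complex.I • v)) (by rw [map_neg, hIv]; simp)
      (by simpa using hHIv)
    exact exists_cubic_region hconv (fun z => (hdef.1 z).2) hδ hdesc hM₁ hM₂ hM₃ hM₄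
  · obtain ⟨M₁, hM₁⟩ := hbound2 (Complex.I • ν) (by simp [hν])
    obtain ⟨M₂, hM₂⟩ := hbound2 (-(Complex.I • ν)) (by simp [hν])
    exact exists_quadratic_region (fun z => (hdef.1 z).2) hδ hdesc hM₁ hM₂

section
variable {E : Type} [NormedAddCommGroup E] [NormedSpace ℂ E] {D : Set E} {q ν v : E}

theorem exists_disc_radius (hbdd : Bornology.IsBounded D) (hv : v ≠ 0) {p : E} {r : ℝ}
    (hr : 0 < r) (h : ∀ w : ℂ, ‖w‖ ≤ r → p + w • v ∈ D) :
    ∃ δ, r ≤ δ ∧ (∀ w : ℂ, ‖w‖ < δ → p + w • v ∈ D) ∧ ∃ w : ℂ, ‖w‖ ≤ 2 * δ ∧ p + w • v ∉ D := by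
  set S : Set ℝ := {s | ∀ w : ℂ, ‖w‖ < s → p + w • v ∈ D} with hS
  have hrS : r ∈ S := fun w hw => h w hw.le
  obtain ⟨C, hC⟩ := Metric.isBounded_iff.1 hbdd
  have hp : p ∈ D := by simpa using h 0 (by simpa using hr.le)
  have hC0 : 0 ≤ C := dist_nonneg.trans (hC hp hp)
  have hv0 : 0 < ‖v‖ := norm_pos_iff.2 hv
  have hbS : BddAbove S := by
    refine ⟨(C + 1) / ‖v‖, fun s hs => ?_⟩
    by_contra! hlt
    have h1 := hC (hs (((C + 1) / ‖v‖ : ℝ) : ℂ) (by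
      rwa [Complex.norm_real, Real.norm_of_nonneg (by positivity)])) hp
    rw [dist_eq_norm, add_sub_cancel_left, norm_smul, Complex.norm_real,
      Real.norm_of_nonneg (by positivity), div_mul_cancel₀ _ hv0.ne'] at h1
    linarith
  have hle : r ≤ sSup S := le_csSup hbS hrS
  refine ⟨sSup S, hle, fun w hw => ?_, ?_⟩
  · obtain ⟨s, hs, hws⟩ := exists_lt_of_lt_csSup ⟨r, hrS⟩ hw
    exact hs w hws
  · by_contra! hall
    have : 2 * sSup S ∈ S := fun w hw => hall w hw.le
    linarith [le_csSup hbS this]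

theorem exists_scale (hbdd : Bornology.IsBounded D) (hconv : Convex ℝ D) (hv : v ≠ 0)
    {c t₁ : ℝ} (hc : 0 < c) (ht₁ : 0 < t₁)
    (h : ∀ t : ℝ, 0 < t → t ≤ t₁ → ∀ w : ℂ, ‖w‖ ≤ c * t ^ (1 / 3 : ℝ) →
      q - t • ν + w • v ∈ D) {τ : ℝ} (hτ : 0 < τ) :
    ∃ t₀ : ℝ, 0 < t₀ ∧ t₀ ≤ τ ∧ ∃ δ₀ : ℝ, 0 < δ₀ ∧
      (∃ w : ℂ, ‖w‖ ≤ 2 * δ₀ ∧ q - t₀ • ν + w • v ∉ D) ∧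
      ∀ x : ℝ, 0 < x → x ≤ 4 → ∀ w : ℂ, ‖w‖ ≤ 1 / 4 * δ₀ * x ^ (1 / 3 : ℝ) →
        q - (t₀ * x) • ν + w • v ∈ D := by
  have hex : ∀ t : ℝ, 0 < t → t ≤ t₁ → ∃ δ, c * t ^ (1 / 3 : ℝ) ≤ δ ∧
      (∀ w : ℂ, ‖w‖ < δ → q - t • ν + w • v ∈ D) ∧
      ∃ w : ℂ, ‖w‖ ≤ 2 * δ ∧ q - t • ν + w • v ∉ D := fun t ht ht' =>
    exists_disc_radius hbdd hv (by positivity) (h t ht ht')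
  choose! δ hδ1 hδ2 hδ3 using hex
  set T := min τ (t₁ / 13) with hT
  have hT0 : 0 < T := by positivity
  have hTt : T ≤ t₁ := (min_le_right _ _).trans (by linarith)
  have hδ0 : ∀ t, 0 < t → t ≤ t₁ → 0 < δ t := fun t ht ht' =>
    lt_of_lt_of_le (by positivity) (hδ1 t ht ht')
  set A := (fun t => t ^ (1 / 3 : ℝ) / δ t) '' Ioc 0 T with hA
  have hbA : BddAbove A := by
    refine ⟨1 / c, ?_⟩
    rintro _ ⟨t, ht, rfl⟩
    have := hδ1 t ht.1 (ht.2.trans hTt)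
    show t ^ (1 / 3 : ℝ) / δ t ≤ 1 / c
    rw [div_le_div_iff₀ (hδ0 t ht.1 (ht.2.trans hTt)) hc]
    linarith
  have hApos : 0 < sSup A := by
    refine lt_of_lt_of_le ?_ (le_csSup hbA ⟨T, ⟨hT0, le_rfl⟩, rfl⟩)
    have := hδ0 T hT0 hTt
    positivity
  obtain ⟨_, ⟨t₀, ht₀, rfl⟩, hlt⟩ := exists_lt_of_lt_csSup
    (⟨_, ⟨T, ⟨hT0, le_rfl⟩, rfl⟩⟩ : A.Nonempty) (half_lt_self hApos)
  have ht₀1 : t₀ ≤ t₁ := ht₀.2.trans hTt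
  have hd0 := hδ0 t₀ ht₀.1 ht₀1
  refine ⟨t₀, ht₀.1, ht₀.2.trans (min_le_left _ _), δ t₀, hd0, hδ3 t₀ ht₀.1 ht₀1, ?_⟩
  intro x hx hx4 w hw
  have ht13 : t₀ ≤ t₁ / 13 := ht₀.2.trans (min_le_right _ _)
  rcases le_total x 1 with hx1 | hx1
  · have htx : 0 < t₀ * x := mul_pos ht₀.1 hx
    have htx' : t₀ * x ≤ t₀ := mul_le_of_le_one_right ht₀.1.le hx1
    refine hδ2 _ htx (htx'.trans ht₀1) w (hw.trans_lt ?_)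
    have h1 : (t₀ * x) ^ (1 / 3 : ℝ) / δ (t₀ * x) ≤ 2 * (t₀ ^ (1 / 3 : ℝ) / δ t₀) := by
      have : (t₀ * x) ^ (1 / 3 : ℝ) / δ (t₀ * x) ≤ sSup A :=
        le_csSup hbA ⟨_, ⟨htx, htx'.trans ht₀.2⟩, rfl⟩
      simp only at hlt
      linarith
    have hdx := hδ0 _ htx (htx'.trans ht₀1)
    have ht3 : 0 < t₀ ^ (1 / 3 : ℝ) := Real.rpow_pos_of_pos ht₀.1 _
    have hx3 : 0 < x ^ (1 / 3 : ℝ) := Real.rpow_pos_of_pos hx _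
    rw [Real.mul_rpow ht₀.1.le hx.le, mul_div_assoc', div_le_div_iff₀ hdx hd0] at h1
    have h2 : t₀ ^ (1 / 3 : ℝ) * (x ^ (1 / 3 : ℝ) * δ t₀) ≤
        t₀ ^ (1 / 3 : ℝ) * (2 * δ (t₀ * x)) := by linarith
    have h3 := le_of_mul_le_mul_left h2 ht3
    nlinarith [mul_pos hx3 hd0]
  · set θ := (t₀ * x - t₀) / (t₁ - t₀) with hθ
    have hpos : 0 < t₁ - t₀ := by linarith [ht₀.1]
    have hθ0 : 0 ≤ θ := div_nonneg (by nlinarith [ht₀.1]) hpos.le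
    have hθ1 : θ ≤ 1 / 4 := by
      rw [hθ, div_le_iff₀ hpos]; nlinarith [ht₀.1]
    have hx3 : x ^ (1 / 3 : ℝ) ≤ 2 := by
      calc x ^ (1 / 3 : ℝ) ≤ 8 ^ (1 / 3 : ℝ) :=
            Real.rpow_le_rpow hx.le (by linarith) (by norm_num)
        _ = 2 := by
          rw [show (8 : ℝ) = 2 ^ (3 : ℝ) by norm_num, ← Real.rpow_mul (by norm_num)]; norm_num
    have h1θ : 0 < 1 - θ := by linarith
    have hT1 : q - t₁ • ν ∈ D := by simpa using h t₁ ht₁ le_rfl 0 (by simp; positivity)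
    have hw0 : q - t₀ • ν + ((1 - θ)⁻¹ • w) • v ∈ D := by
      refine hδ2 t₀ ht₀.1 ht₀1 _ ?_
      rw [norm_smul, norm_inv, Real.norm_of_nonneg h1θ.le, inv_mul_lt_iff₀ h1θ]
      nlinarith
    have := hconv hw0 hT1 h1θ.le hθ0 (by ring)
    convert this using 1
    have e1 : t₀ * x = (1 - θ) * t₀ + θ * t₁ := by
      rw [hθ]; field_simp; ring
    rw [e1, smul_add, smul_assoc, smul_inv_smul₀ h1θ.ne']
    module

theorem exists_rescaled_window (hbdd : Bornology.IsBounded D) (hconv : Convex ℝ D) (hv : v ≠ 0)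
    {c t₁ c' t₁' : ℝ} (hc : 0 < c) (ht₁ : 0 < t₁) (hc' : 0 < c') (ht₁' : 0 < t₁')
    (h : ∀ t : ℝ, 0 < t → t ≤ t₁ → ∀ w : ℂ, ‖w‖ ≤ c * t ^ (1 / 3 : ℝ) →
      q - t • ν + w • v ∈ D)
    (h' : ∀ x : ℝ, 0 < x → x ≤ t₁' → ∀ y : ℝ, y ^ 2 ≤ c' * x →
        q - ((x : ℂ) + y * Complex.I) • ν ∈ D) {ε : ℝ} (hε : 0 < ε) {τ : ℝ} (hτ : 0 < τ) :
    ∃ t₀ : ℝ, 0 < t₀ ∧ t₀ ≤ τ ∧ ∃ δ₀ : ℝ, 0 < δ₀ ∧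
      (∃ s : ℂ, ‖s‖ ≤ 2 ∧ q - t₀ • ν + s • δ₀ • v ∉ D) ∧
      ∀ ω μ : ℂ, ε ≤ ω.re → ω.re ≤ 4 → |ω.im| ≤ 4 → ‖μ‖ ≤ 1 / 8 * ω.re ^ (1 / 3 : ℝ) →
        q - ω • t₀ • ν + μ • δ₀ • v ∈ D := by
  obtain ⟨t₀, ht₀, ht₀τ, δ₀, hδ₀, ⟨w, hw, hwD⟩, hall⟩ := exists_scale hbdd hconv hv hc ht₁ h
    (τ := min τ (min (c' * ε / 64) (t₁' / 4))) (by positivity)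
  refine ⟨t₀, ht₀, ht₀τ.trans (min_le_left _ _), δ₀, hδ₀, ⟨δ₀⁻¹ • w, ?_, ?_⟩, ?_⟩
  · rw [norm_smul, norm_inv, Real.norm_of_nonneg hδ₀.le, inv_mul_le_iff₀ hδ₀]; linarith
  · rwa [smul_assoc, smul_comm w δ₀ v, inv_smul_smul₀ hδ₀.ne']
  · intro ω μ hω hω4 hωi hμ
    have hω0 : 0 < ω.re := hε.trans_le hω
    have ht1 : t₀ ≤ c' * ε / 64 := ht₀τ.trans ((min_le_right _ _).trans (min_le_left _ _))
    have ht2 : t₀ ≤ t₁' / 4 := ht₀τ.trans ((min_le_right _ _).trans (min_le_right _ _))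
    have h1 := hall ω.re hω0 hω4 (2 * δ₀ * μ) (by
      rw [norm_mul, norm_mul, Complex.norm_real, Real.norm_of_nonneg hδ₀.le]
      norm_num
      nlinarith)
    have h2 := h' (t₀ * ω.re) (mul_pos ht₀ hω0) (by nlinarith) (2 * t₀ * ω.im) (by
      have : ω.im ^ 2 ≤ 16 := by nlinarith [abs_le.1 hωi]
      calc (2 * t₀ * ω.im) ^ 2 = 4 * t₀ * t₀ * ω.im ^ 2 := by ring
        _ ≤ 4 * t₀ * (c' * ε / 64) * 16 := by gcongr
        _ = c' * (t₀ * ε) := by ring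
        _ ≤ c' * (t₀ * ω.re) := by gcongr)
    have := hconv h1 h2 (a := 1 / 2) (b := 1 / 2) (by norm_num) (by norm_num) (by norm_num)
    convert this using 1
    have e1 : (((t₀ * ω.re : ℝ) : ℂ) + ((2 * t₀ * ω.im : ℝ) : ℂ) * Complex.I) • ν =
        (t₀ * ω.re) • ν + (2 * t₀ * ω.im) • Complex.I • ν := by
      rw [add_smul, mul_smul, Complex.coe_smul, Complex.coe_smul]
    have e2 : ω • t₀ • ν = (t₀ * ω.re) • ν + (t₀ * ω.im) • Complex.I • ν := by
      conv_lhs => rw [← Complex.re_add_im ω]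
      rw [add_smul, mul_smul, Complex.coe_smul, Complex.coe_smul, smul_comm Complex.I t₀ ν]
      module
    have e3 : (2 * (δ₀ : ℂ) * μ) • v = (2 : ℝ) • μ • δ₀ • v := by
      rw [smul_comm μ δ₀ v, ← Complex.coe_smul]
      module
    rw [e1, e2, e3]
    module

end

theorem mul_rpow_third_le {r x : ℝ} (hr : 0 ≤ r) (hr1 : r ≤ 1) (hx : 0 ≤ x) :
    r * x ^ (1 / 3 : ℝ) ≤ (r * x) ^ (1 / 3 : ℝ) := by
  rw [Real.mul_rpow hr hx]
  refine mul_le_mul_of_nonneg_right ?_ (Real.rpow_nonneg hx _)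
  simpa using Real.rpow_le_rpow_of_exponent_ge' hr hr1 (by norm_num : (0 : ℝ) ≤ 1 / 3)
    (by norm_num : (1 / 3 : ℝ) ≤ 1)

theorem window_thickening {ε : ℝ} (hε : 0 < ε) (hε1 : ε ≤ 1) {ω μ c : ℂ} {t : ℝ}
    (hω : ε ≤ ω.re) (hω1 : ‖ω - 1‖ ≤ 2) (hμ : ‖μ‖ ≤ 1 / 16 * ω.re ^ (1 / 3 : ℝ))
    (ht : t ∈ Icc (0 : ℝ) 1) (hc : ‖c‖ < ε / 16) :
    ε / 2 ≤ (1 + t * (ω - 1) + c * (ω - 1)).re ∧ (1 + t * (ω - 1) + c * (ω - 1)).re ≤ 4 ∧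
      |(1 + t * (ω - 1) + c * (ω - 1)).im| ≤ 4 ∧
      ‖t * μ + c * μ‖ ≤ 1 / 8 * (1 + t * (ω - 1) + c * (ω - 1)).re ^ (1 / 3 : ℝ) := by
  obtain ⟨ht0, ht1⟩ := ht
  have hw : ‖c * (ω - 1)‖ ≤ ε / 8 := by
    rw [norm_mul]; nlinarith [norm_nonneg c, norm_nonneg (ω - 1)]
  have hre := (Complex.abs_re_le_norm _).trans hw
  have him := (Complex.abs_im_le_norm _).trans hw
  have hre1 := (Complex.abs_re_le_norm _).trans hω1
  have him1 := (Complex.abs_im_le_norm _).trans hω1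
  generalize hd : c * (ω - 1) = d at *
  simp only [Complex.sub_re, Complex.sub_im, Complex.one_re, Complex.one_im, sub_zero] at hre1 him1
  rw [abs_le] at hre him hre1 him1
  have e1 : (1 + t * (ω - 1) + d).re = 1 + t * (ω.re - 1) + d.re := by simp
  have e2 : (1 + t * (ω - 1) + d).im = t * ω.im + d.im := by simp
  rw [e1, e2]
  set x := ω.re with hx
  set y := 1 + t * (x - 1) with hy
  have hyε : ε ≤ y := by nlinarith
  have hy3 : y ≤ 3 := by nlinarith
  have hytx : t * x ≤ y := by nlinarith
  have hX1 : t * x ^ (1 / 3 : ℝ) ≤ y ^ (1 / 3 : ℝ) :=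
    (mul_rpow_third_le ht0 ht1 (hε.le.trans hω)).trans
      (Real.rpow_le_rpow (mul_nonneg ht0 (hε.le.trans hω)) hytx (by norm_num))
  have hX2 : ε ≤ y ^ (1 / 3 : ℝ) := by
    have := mul_rpow_third_le hε.le hε1 zero_le_one
    simp only [Real.one_rpow, mul_one] at this
    exact this.trans (Real.rpow_le_rpow hε.le hyε (by norm_num))
  have hx2 : x ^ (1 / 3 : ℝ) ≤ 2 := by
    have h8 : (8 : ℝ) ^ (1 / 3 : ℝ) = 2 := by
      rw [show (8 : ℝ) = 2 ^ (3 : ℝ) by norm_num, ← Real.rpow_mul (by norm_num)]; norm_num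
    rw [← h8]
    exact Real.rpow_le_rpow (hε.le.trans hω) (by linarith) (by norm_num)
  have hX3 : 7 / 8 * y ^ (1 / 3 : ℝ) ≤ (y + d.re) ^ (1 / 3 : ℝ) :=
    (mul_rpow_third_le (by norm_num) (by norm_num) (hε.le.trans hyε)).trans
      (Real.rpow_le_rpow (by linarith) (by linarith) (by norm_num))
  refine ⟨by linarith, by linarith, abs_le.2 ⟨by nlinarith, by nlinarith⟩, ?_⟩
  have h1 : ‖(t : ℂ) * μ‖ ≤ 1 / 16 * y ^ (1 / 3 : ℝ) := by
    rw [norm_mul, Complex.norm_real, Real.norm_of_nonneg ht0]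
    nlinarith
  have h2 : ‖c * μ‖ ≤ ε / 128 := by
    rw [norm_mul]
    have : ‖μ‖ ≤ 1 / 8 := by linarith
    nlinarith [norm_nonneg c, norm_nonneg μ]
  linarith [norm_add_le (t * μ : ℂ) (c * μ)]

section
variable {n : ℕ} {D : Set (Fin n → ℂ)} {K : (Fin n → ℂ) → (Fin n → ℂ) → ℂ}

theorem bergmanDist_le_of_window (hD : IsOpen D) (hconv : Convex ℝ D)
    (hbdd : Bornology.IsBounded D) (hK : IsBergmanKernel D K) {q a b : Fin n → ℂ} {ε : ℝ}
    (hε : 0 < ε) (hε1 : ε ≤ 1)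
    (hwin : ∀ ω μ : ℂ, ε / 2 ≤ ω.re → ω.re ≤ 4 → |ω.im| ≤ 4 →
      ‖μ‖ ≤ 1 / 8 * ω.re ^ (1 / 3 : ℝ) → q + ω • a + μ • b ∈ D)
    {ω μ : ℂ} (hω : ε ≤ ω.re) (hω1 : ‖ω - 1‖ ≤ 2) (hμ : ‖μ‖ ≤ 1 / 16 * ω.re ^ (1 / 3 : ℝ)) :
    q + ω • a + μ • b ∈ D ∧
      bergmanDist D K (q + a) (q + ω • a + μ • b) ≤ 2 ^ (n + 2) / (ε / 16) := by
  have key : ∀ t ∈ Icc (0 : ℝ) 1, ∀ c : ℂ, ‖c‖ < ε / 16 →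
      (q + a) + t • ((q + ω • a + μ • b) - (q + a)) + c • ((q + ω • a + μ • b) - (q + a)) ∈ D := by
    intro t ht c hc
    obtain ⟨h1, h2, h3, h4⟩ := window_thickening hε hε1 hω hω1 hμ ht hc
    have := hwin _ _ h1 h2 h3 h4
    rw [← Complex.coe_smul t]
    convert this using 1
    module
  have hp : q + a ∈ D := by
    simpa using key 0 (by simp) 0 (by simpa using hε)
  have hy : q + ω • a + μ • b ∈ D := by
    have := key 1 (by simp) 0 (by simpa using hε)
    simpa using this
  exact ⟨hy, bergmanDist_le_of_segment hconv hp hy fun t ht =>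
    bergmanMetric_le_of_disc hD hconv hbdd hK (by positivity) (key t ht)⟩

theorem false_of_bergmanBall_subset_image (hD : IsOpen D) (hconv : Convex ℝ D)
    (hbdd : Bornology.IsBounded D) (hK : IsBergmanKernel D K) {q a b : Fin n → ℂ} {ε : ℝ}
    (hε : ε = (1 / 2) ^ 174)
    (hwin : ∀ ω μ : ℂ, ε / 2 ≤ ω.re → ω.re ≤ 4 → |ω.im| ≤ 4 →
      ‖μ‖ ≤ 1 / 8 * ω.re ^ (1 / 3 : ℝ) → q + ω • a + μ • b ∈ D)
    {l : (Fin n → ℂ) → ℂ} (hl : Differentiable ℂ l) (hlD : ∀ z ∈ D, 0 < (l z).re)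
    (hlQ : ∀ ω : ℂ, l (q + ω • a) = ω) {s : ℂ} (hs : ‖s‖ ≤ 2) (hsD : q + a + s • b ∉ D)
    (hfr : fridmanInv D K (q + a) < 1 / (2 ^ (n + 2) / (ε / 16))) : False := by
  have hε0 : 0 < ε := by rw [hε]; positivity
  have hε1 : ε ≤ 1 := by rw [hε]; exact pow_le_one₀ (by norm_num) (by norm_num)
  have hp : q + a ∈ D := by
    simpa using hwin 1 0 (by simp; linarith) (by simp) (by simp) (by simp)
  obtain ⟨r, hr, f, hf, hinj, hfD, hball⟩ :=
    exists_map_of_fridmanInv_lt hD hbdd hconv hK hp (by positivity) hfr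
  obtain ⟨m, hm⟩ := RCLike.geometric_hahn_banach_open_point (𝕜 := ℂ) hconv hD hsD
  set e := EuclideanSpace.equiv (Fin n) ℂ with he
  have hmem : ∀ x : EuclideanSpace ℂ (Fin n), x ∈ ball (0 : EuclideanSpace ℂ (Fin n)) 1 ↔
      e x ∈ euclUnitBall n := by
    intro x
    rw [mem_ball_zero_iff, ← sq_lt_one_iff₀ (norm_nonneg x), EuclideanSpace.norm_sq_eq]
    rfl
  have himg : (f ∘ e) '' ball (0 : EuclideanSpace ℂ (Fin n)) 1 = f '' euclUnitBall n := by
    ext z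
    constructor
    · rintro ⟨x, hx, rfl⟩
      exact ⟨e x, (hmem x).1 hx, rfl⟩
    · rintro ⟨y, hy, rfl⟩
      refine ⟨e.symm y, (hmem _).2 (by simpa using hy), by simp⟩
  have hfe : DifferentiableOn ℂ (f ∘ e) (ball (0 : EuclideanSpace ℂ (Fin n)) 1) :=
    hf.comp e.differentiable.differentiableOn fun x hx => (hmem x).1 hx
  have hinje : InjOn (f ∘ e) (ball (0 : EuclideanSpace ℂ (Fin n)) 1) := fun x hx y hy hxy =>
    e.injective (hinj ((hmem x).1 hx) ((hmem y).1 hy) hxy)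
  obtain ⟨hgo, g, hg, hgf⟩ := exists_holomorphic_inverse (by simp) isOpen_ball hfe hinje
  refine false_of_ball_image_contains_window hfe
    (fun x hx => hfD ⟨e x, (hmem x).1 hx, rfl⟩) hgo hg hgf hε hl hlD hlQ m hs hm ?_
  intro ω hω hω1 μ hμ
  obtain ⟨h1, h2⟩ := bergmanDist_le_of_window hD hconv hbdd hK hε0 hε1 hwin hω hω1 hμ
  rw [himg]
  exact hball ⟨h1, h2.trans_lt hr⟩

end

/-- if `h_D(z) → 0` as `z → ∂D` on a smoothly bounded convex domain, then
`∂D` is strongly pseudoconvex at every boundary point. -/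
theorem strongly_pseudoconvex_of_fridman_tendsto_zero_convex {n : ℕ}
    (D : Set (Fin n → ℂ)) (hopen : IsOpen D) (hconn : IsConnected D)
    (hbdd : Bornology.IsBounded D) (hconv : Convex ℝ D)
    (ρ : (Fin n → ℂ) → ℝ) (hρ : ContDiff ℝ (⊤ : ℕ∞) ρ) (hdef : IsDefiningFunction D ρ)
    (K : (Fin n → ℂ) → (Fin n → ℂ) → ℂ) (hK : IsBergmanKernel D K)
    (hlim : ∀ q ∈ frontier D, Filter.Tendsto (fridmanInv D K) (nhdsWithin q D) (nhds 0)) :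
    ∀ q ∈ frontier D, StronglyPseudoconvexAt ρ q := by
  intro q hq v hv hv0
  by_contra hlev
  obtain ⟨L, ν, hLν, hLv, hLD, ⟨c, hc, t₁, ht₁, hcub⟩, c', hc', t₁', ht₁', hquad⟩ :=
    exists_local_geometry hopen hconv (contDiff_infty.1 hρ 3) hdef hq hv
      (not_lt.1 hlev)
  obtain ⟨ε, hε⟩ : ∃ ε : ℝ, ε = (1 / 2) ^ 174 := ⟨_, rfl⟩
  have hε0 : 0 < ε := by rw [hε]; positivity
  have hev := (hlim q hq).eventually
    (gt_mem_nhds (show (0 : ℝ) < 1 / (2 ^ (n + 2) / (ε / 16)) by positivity))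
  rw [eventually_nhdsWithin_iff, Metric.eventually_nhds_iff] at hev
  obtain ⟨κ, hκ, hev⟩ := hev
  obtain ⟨t₀, ht₀, ht₀τ, δ₀, hδ₀, ⟨s, hs, hsD⟩, hwin⟩ :=
    exists_rescaled_window hbdd hconv hv0 hc ht₁ hc' ht₁' hcub hquad (half_pos hε0)
      (τ := κ / (2 * (‖ν‖ + 1))) (by positivity)
  have hwin' : ∀ ω μ : ℂ, ε / 2 ≤ ω.re → ω.re ≤ 4 → |ω.im| ≤ 4 →
      ‖μ‖ ≤ 1 / 8 * ω.re ^ (1 / 3 : ℝ) → q + ω • (-(t₀ • ν)) + μ • (δ₀ • v) ∈ D := by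
    intro ω μ h1 h2 h3 h4
    have := hwin ω μ h1 h2 h3 h4
    rwa [sub_eq_add_neg, ← smul_neg] at this
  have hp : q + -(t₀ • ν) ∈ D := by
    have hε1 : ε ≤ 1 := by rw [hε]; exact pow_le_one₀ (by norm_num) (by norm_num)
    simpa using hwin' 1 0 (by simp; linarith) (by simp) (by simp) (by simp)
  have hdist : dist (q + -(t₀ • ν)) q < κ := by
    rw [dist_eq_norm, add_sub_cancel_left, norm_neg, norm_smul, Real.norm_of_nonneg ht₀.le]
    have hν := norm_nonneg ν
    rw [le_div_iff₀ (by positivity)] at ht₀τ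
    nlinarith
  refine false_of_bergmanBall_subset_image hopen hconv hbdd hK hε hwin'
    (l := fun z => -(L (z - q)) / t₀) ?_ ?_ ?_ hs (by rwa [sub_eq_add_neg] at hsD) (hev hdist hp)
  · have : Differentiable ℂ fun z => L (z - q) :=
      L.differentiable.comp (differentiable_id.sub_const q)
    simpa only [div_eq_mul_inv] using this.fun_neg.mul_const (t₀ : ℂ)⁻¹
  · intro z hz
    rw [Complex.div_ofReal_re, Complex.neg_re]
    exact div_pos (neg_pos.2 (hLD z hz)) ht₀
  · intro ω
    have ht : (t₀ : ℂ) ≠ 0 := by exact_mod_cast ht₀.ne'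
    have : L (q + ω • (-(t₀ • ν)) - q) = -(ω * t₀) := by
      rw [add_sub_cancel_left, ← Complex.coe_smul t₀, map_smul, map_neg, map_smul, hLν]
      simp
    simp only [this, neg_neg]
    field_simp


end
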